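/- arXiv:0801.1634 — 8 statements merged into one kernel-verified Lean document; each statement's English description precedes it below -/
import Mathlib

section
/- Let k be a field of characteristic different from 2 and let A be a central simple k-algebra of odd degree n (i.e. dim_k A = n² with n odd). If A admits an involution of the first kind, then A is split: A is isomorphic as a k-algebra to the matrix algebra Mₙ(k). -/
open Matrix in
/-- An involution of the first kind on a matrix algebra over a division algebra `D` induces one
on `D` itself. -/
theorem exists_involution_of_matrix {k D ι : Type*} [Field k] [DivisionRing D] [Algebra k D]
    [Fintype ι] [DecidableEq ι] [Nonempty ι]
    (σ : Matrix ι ι D →ₗ[k] Matrix ι ι D) (hmul : ∀ x y, σ (x * y) = σ y * σ x)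
    (hinvol : ∀ x, σ (σ x) = x) :
    ∃ θ : D →ₗ[k] D, (∀ x y, θ (x * y) = θ y * θ x) ∧ ∀ x, θ (θ x) = x := by
  obtain ⟨i⟩ := ‹Nonempty ι›
  let f : D → Matrix ι ι D := fun d => single i i d
  have hf : ∀ a b, f a * f b = f (a * b) := fun a b => single_mul_single_same ..
  have hcorner : ∀ M : Matrix ι ι D, f 1 * M * f 1 = f (M i i) := fun M => by
    simp [f, single_mul_mul_single]
  -- a symmetric or skew-symmetric nonzero element of `σ e * M * e`, where `e = f 1`
  obtain ⟨ε, w, hε, hw0, hwe, hσw⟩ : ∃ (ε : k) (w : Matrix ι ι D),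
      ε * ε = 1 ∧ w ≠ 0 ∧ w * f 1 = w ∧ σ w = ε • w := by
    have hne : σ (f 1) ≠ 0 := fun h => by
      have h1 := congrFun₂ (hinvol (f 1)) i i
      simp [h, f] at h1
    obtain ⟨a, b, hab⟩ : ∃ a b, σ (f 1) a b ≠ 0 := by
      by_contra! h
      exact hne (Matrix.ext h)
    let v := σ (f 1) * single b i (1 : D)
    have hv0 : v ≠ 0 := fun h => hab <| by
      simpa [v] using congrFun₂ h a i
    have hve : v * f 1 = v := by simp [v, f, mul_assoc]
    have hσv : σ v * f 1 = σ v := by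
      rw [← hinvol (f 1), ← hmul, ← mul_assoc, ← hmul, hf, one_mul]
    by_cases h : v + σ v = 0
    · exact ⟨-1, v, by simp, hv0, hve, by simpa using eq_neg_of_add_eq_zero_right h⟩
    · exact ⟨1, v + σ v, by simp, h, by rw [add_mul, hve, hσv], by
        rw [map_add, hinvol, one_smul, add_comm]⟩
  obtain ⟨u, hu⟩ : ∃ u, u * w = f 1 := by
    obtain ⟨a, b, hab⟩ : ∃ a b, w a b ≠ 0 := by
      by_contra! h
      exact hw0 (Matrix.ext h)
    have hb : b = i := by
      by_contra hb
      exact hab (by rw [← hwe]; simp [f, hb])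
    subst hb
    refine ⟨single b a (w a b)⁻¹, ?_⟩
    calc _ = single b a (w a b)⁻¹ * w * f 1 := by rw [mul_assoc, hwe]
      _ = f 1 := by simp [f, single_mul_mul_single, hab]
  have hwv : w * (ε • σ u) = σ (f 1) := by
    rw [← hu, hmul, hσw, mul_smul_comm, smul_mul_assoc]
  have hinj : ∀ a b, w * f a = w * f b → a = b := fun a b h => by
    have h1 : f 1 * f a = f 1 * f b := by rw [← hu, mul_assoc, h, mul_assoc]
    simpa [hf, f] using congrFun₂ h1 i i
  let θ : D →ₗ[k] D :=
    { toFun := fun d => (ε • σ u * σ (f d) * w) i i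
      map_add' := fun a b => by
        have : f (a + b) = f a + f b := single_add ..
        rw [this, map_add, mul_add, add_mul, Matrix.add_apply]
      map_smul' := fun c a => by
        have : f (c • a) = c • f a := (smul_single ..).symm
        rw [this, map_smul, mul_smul_comm, smul_mul_assoc, Matrix.smul_apply, RingHom.id_apply] }
  have hθ : ∀ d, w * f (θ d) = σ (f d) * w := fun d => by
    calc w * f (θ d) = w * (f 1 * (ε • σ u * σ (f d) * w) * f 1) := by rw [hcorner]; rfl
      _ = (w * f 1) * (ε • σ u) * σ (f d) * (w * f 1) := by simp only [mul_assoc]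
      _ = σ (f d) * w := by rw [hwe, hwv, ← hmul, hf, mul_one]
  refine ⟨θ, fun x y => hinj _ _ ?_, fun x => hinj _ _ ?_⟩
  · rw [hθ, ← hf, hmul, mul_assoc, ← hθ, ← mul_assoc, ← hθ, mul_assoc, hf]
  · have h := congrArg σ (hθ x)
    rw [hmul, hmul, hinvol, hσw, mul_smul_comm, smul_mul_assoc, ← hθ] at h
    calc w * f (θ (θ x)) = (ε * ε) • (w * f (θ (θ x))) := by rw [hε, one_smul]
      _ = w * f x := by rw [mul_smul, h, ← mul_smul, hε, one_smul]

/-- In an odd-dimensional division algebra of characteristic not two, an involution of the first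
kind has no nonzero skew-symmetric elements. -/
theorem eq_zero_of_skew {k D : Type*} [Field k] (h2 : (2 : k) ≠ 0) [DivisionRing D] [Algebra k D]
    [FiniteDimensional k D] (hodd : Odd (Module.finrank k D)) (θ : D →ₗ[k] D)
    (hmul : ∀ x y, θ (x * y) = θ y * θ x) (hinvol : ∀ x, θ (θ x) = x)
    {x : D} (hx : θ x = -x) : x = 0 := by
  by_contra hx0
  let E := Subalgebra.centralizer k {x}
  have hE : ∀ y, y ∈ E ↔ x * y = y * x := fun y => by
    simp [E, Subalgebra.mem_centralizer_iff]
  let : DivisionRing E := divisionRingOfFiniteDimensional k E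
  have hoddE : Odd (Module.finrank k E) := by
    rw [← Module.finrank_mul_finrank k E D] at hodd
    exact (Nat.odd_mul.mp hodd).1
  let T : E →ₗ[k] E := θ.restrict (p := Subalgebra.toSubmodule E) (q := Subalgebra.toSubmodule E)
    fun y hy => by
      have h := congrArg θ ((hE y).mp hy)
      rw [hmul, hmul, hx, mul_neg, neg_mul, neg_inj] at h
      exact (hE _).mpr h.symm
  have hT : ∀ y : E, (T y : D) = θ y := fun _ => rfl
  have hTT : T * T = 1 := LinearMap.ext fun y => Subtype.ext <| by
    simp [hT, hinvol]
  let X : E := ⟨x, (hE x).mpr rfl⟩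
  have hX0 : X ≠ 0 := fun h => hx0 (congrArg Subtype.val h)
  let L := LinearMap.mulLeft k X
  have hL : L * LinearMap.mulLeft k X⁻¹ = 1 := LinearMap.ext fun y => by
    simp [L, ← mul_assoc, mul_inv_cancel₀ hX0]
  have hTL : T * L = (-1 : k) • (L * T) := LinearMap.ext fun y => Subtype.ext <| by
    have hy := (hE _).mp (T y).2
    simp only [Module.End.mul_apply, LinearMap.smul_apply, L, LinearMap.mulLeft_apply, neg_smul,
      one_smul, hT]
    rw [hT] at hy
    simp [X, hT, hmul, hx, hy]
  have hdet := congrArg LinearMap.det hTL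
  rw [LinearMap.det_smul, hoddE.neg_one_pow, map_mul, map_mul, mul_comm (LinearMap.det T)] at hdet
  have hT0 : LinearMap.det T ≠ 0 := left_ne_zero_of_mul (b := LinearMap.det T) <| by
    rw [← map_mul, hTT, map_one]; exact one_ne_zero
  have hL0 : LinearMap.det L ≠ 0 :=
    left_ne_zero_of_mul (b := LinearMap.det (LinearMap.mulLeft k X⁻¹)) <| by
      rw [← map_mul, hL, map_one]; exact one_ne_zero
  refine mul_ne_zero h2 (mul_ne_zero hL0 hT0) ?_
  linear_combination hdet

/-- An odd-dimensional division algebra of characteristic not two with an involution of the first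
kind is commutative. -/
theorem mul_comm_of_involution {k D : Type*} [Field k] (h2 : (2 : k) ≠ 0) [DivisionRing D]
    [Algebra k D] [FiniteDimensional k D] (hodd : Odd (Module.finrank k D)) (θ : D →ₗ[k] D)
    (hmul : ∀ x y, θ (x * y) = θ y * θ x) (hinvol : ∀ x, θ (θ x) = x) (x y : D) :
    x * y = y * x := by
  have hid : ∀ z, θ z = z := fun z => (sub_eq_zero.mp <| eq_zero_of_skew h2 hodd θ hmul hinvol
    (x := z - θ z) (by rw [map_sub, hinvol, neg_sub])).symm
  simpa only [hid] using hmul x y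

/-- A commutative division algebra some nonempty matrix algebra over which is central is the base
field. -/
theorem algebraMap_bijective_of_center_matrix {k D ι : Type*} [Field k] [DivisionRing D]
    [Algebra k D] [Fintype ι] [DecidableEq ι] [Nonempty ι] (hcomm : ∀ x y : D, x * y = y * x)
    (hcenter : Subalgebra.center k (Matrix ι ι D) = ⊥) :
    Function.Bijective (algebraMap k D) := by
  refine ⟨(algebraMap k D).injective, fun d => ?_⟩
  have hd : Matrix.scalarAlgHom ι k d ∈ Subalgebra.center k (Matrix ι ι D) := by
    rw [Matrix.subalgebraCenter_eq_scalarAlgHom_map]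
    exact ⟨d, Subalgebra.mem_center_iff.mpr fun b => hcomm b d, rfl⟩
  rw [hcenter] at hd
  obtain ⟨c, hc⟩ := Algebra.mem_bot.mp hd
  obtain ⟨i⟩ := ‹Nonempty ι›
  refine ⟨c, ?_⟩
  simpa [Matrix.algebraMap_matrix_apply] using congrFun₂ hc i i


/-- Let `k` be a field of characteristic different from 2 and let `A` be a
central simple `k`-algebra of odd degree `n` (i.e. `dim_k A = n ^ 2` with `n` odd): `A` is a
finite-dimensional associative unital `k`-algebra whose center is exactly `k` and which has no
nonzero proper two-sided ideals.  If `A` admits an involution of the first kind (a `k`-linear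
anti-automorphism `τ` with `τ ∘ τ = id`), then `A` is split: `A ≅ Mₙ(k)` as a `k`-algebra. -/
theorem odd_degree_first_kind_involution_split
    (k : Type) [Field k] (h2 : (2 : k) ≠ 0)
    (A : Type) [Ring A] [Algebra k A] [FiniteDimensional k A]
    (hcenter : Subalgebra.center k A = ⊥)
    (hsimple : IsSimpleRing A)
    (n : ℕ) (hn : Odd n)
    (hdim : Module.finrank k A = n ^ 2)
    (τ : A →ₗ[k] A)
    (hτmul : ∀ x y : A, τ (x * y) = τ y * τ x)
    (hτinvol : ∀ x : A, τ (τ x) = x) :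
    Nonempty (A ≃ₐ[k] Matrix (Fin n) (Fin n) k) := by
  obtain ⟨m, hm, D, _, _, _, ⟨e⟩⟩ :=
    have := hsimple
    have := IsArtinianRing.of_finite k A
    IsSimpleRing.exists_algEquiv_matrix_divisionRing_finite k A
  have hfin : m ^ 2 * Module.finrank k D = n ^ 2 := by
    rw [← hdim, e.toLinearEquiv.finrank_eq, Module.finrank_matrix]
    simp [sq]
  obtain ⟨θ, hθmul, hθinvol⟩ := exists_involution_of_matrix
    (e.toLinearMap ∘ₗ τ ∘ₗ e.symm.toLinearMap) (fun x y => by simp [hτmul])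
    (fun x => by simp [hτinvol])
  have hodd : Odd (Module.finrank k D) :=
    (Nat.odd_mul.mp (hfin ▸ hn.pow : Odd (m ^ 2 * Module.finrank k D))).2
  have hbij : Function.Bijective (algebraMap k D) :=
    algebraMap_bijective_of_center_matrix (ι := Fin m)
      (mul_comm_of_involution h2 hodd θ hθmul hθinvol) <| by
        refine eq_bot_iff.mpr fun x hx => ?_
        have hy : e.symm x ∈ Subalgebra.center k A := Subalgebra.mem_center_iff.mpr fun b =>
          e.injective <| by simpa using Subalgebra.mem_center_iff.mp hx (e b)
        rw [hcenter] at hy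
        obtain ⟨c, hc⟩ := Algebra.mem_bot.mp hy
        exact Algebra.mem_bot.mpr ⟨c, by rw [← e.commutes, hc, e.apply_symm_apply]⟩
  let g : k ≃ₐ[k] D := AlgEquiv.ofBijective (Algebra.ofId k D) hbij
  have hmn : m = n := by
    rw [← g.toLinearEquiv.finrank_eq, Module.finrank_self, mul_one] at hfin
    exact Nat.pow_left_injective two_ne_zero hfin
  subst hmn
  exact ⟨e.trans g.symm.mapMatrix⟩
end

section
/- Let k be a field of characteristic different from 2, let n be odd, and let A be a central simple k-algebra of degree 2n (i.e. dim_k A = 4n²) admitting an involution of the first kind. Then there exist a, b ∈ k* such that A is isomorphic as a k-algebra to Mₙ(Q), where Q = (a,b)_k is the quaternion k-algebra determined by a and b. -/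
open TensorProduct in
theorem AlgHom.mulLeftRight_surjective_of_isSimpleRing (k A : Type*) [Field k] [Ring A]
    [Algebra k A] [FiniteDimensional k A] [Algebra.IsCentral k A] [IsSimpleRing A] :
    Function.Surjective (AlgHom.mulLeftRight k A) := by
  let S := (AlgHom.mulLeftRight k A).range
  have hmem (a b : A) : AlgHom.mulLeftRight k A (a ⊗ₜ MulOpposite.op b) ∈ S := ⟨_, rfl⟩
  have hsmul (a b x : A) :
      (⟨AlgHom.mulLeftRight k A (a ⊗ₜ MulOpposite.op b), hmem a b⟩ : S) • x = a * x * b := by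
    change AlgHom.mulLeftRight k A (a ⊗ₜ MulOpposite.op b) x = _
    simp
  have hsimple : IsSimpleModule S A := by
    rw [isSimpleModule_iff]
    refine { eq_bot_or_eq_top := fun N ↦ ?_ }
    by_contra! hN
    obtain ⟨x, hxN, hx⟩ := N.ne_bot_iff.mp hN.1
    let I : TwoSidedIdeal A := .mk' N N.zero_mem N.add_mem
      (fun {y} hy ↦ by
        have h := N.smul_mem ⟨_, hmem (-1) 1⟩ hy
        rwa [hsmul, mul_one, neg_one_mul] at h)
      (fun {a y} hy ↦ by
        have h := N.smul_mem ⟨_, hmem a 1⟩ hy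
        rwa [hsmul, mul_one] at h)
      (fun {y a} hy ↦ by
        have h := N.smul_mem ⟨_, hmem 1 a⟩ hy
        rwa [hsmul, one_mul] at h)
    have h1 : (1 : A) ∈ N := by
      have := IsSimpleRing.one_mem_of_ne_zero_mem I hx (by simpa [I] using hxN)
      simpa [I] using this
    refine hN.2 (eq_top_iff.mpr fun y _ ↦ ?_)
    have h := N.smul_mem ⟨_, hmem y 1⟩ h1
    rwa [hsmul, mul_one, mul_one] at h
  intro f
  have hscalar (g : Module.End S A) : ∃ c : k, ∀ x, g x = c • x := by
    have hl (x : A) : g x = x * g 1 := by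
      have h := g.map_smul ⟨_, hmem x 1⟩ 1
      rwa [hsmul, hsmul, mul_one, mul_one, mul_one] at h
    have hr (x : A) : g x = g 1 * x := by
      have h := g.map_smul ⟨_, hmem 1 x⟩ 1
      rwa [hsmul, hsmul, one_mul, one_mul, one_mul] at h
    obtain ⟨c, hc⟩ := (Algebra.IsCentral.mem_center_iff k).mp
      (Subalgebra.mem_center_iff.mpr fun x ↦ (hl x).symm.trans (hr x))
    exact ⟨c, fun x ↦ by rw [hr, hc, Algebra.smul_def]⟩
  let F : Module.End (Module.End S A) A :=
    { toFun := f
      map_add' := f.map_add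
      map_smul' := fun g x ↦ by
        obtain ⟨c, hc⟩ := hscalar g
        simp [hc] }
  let b := Module.finBasis k A
  classical
  obtain ⟨⟨_, t, rfl⟩, hr⟩ := jacobson_density (R := S) F (Finset.univ.image b)
  exact ⟨t, b.ext fun i ↦ (hr (b i) (by simp)).symm⟩

section BaseChange

open TensorProduct

variable {k : Type*} (E : Type*) {A : Type*} [Field k] [Field E] [Algebra k E] [Ring A]
    [Algebra k A]

theorem LinearMap.baseChange_mulLeftRight_tmul (a b : A) (z : E ⊗[k] A) :
    (AlgHom.mulLeftRight k A (a ⊗ₜ MulOpposite.op b)).baseChange E z =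
      (1 ⊗ₜ[k] a) * z * (1 ⊗ₜ[k] b) := by
  induction z with
  | zero => simp
  | tmul e x => simp
  | add x y hx hy => simp only [map_add, hx, hy, mul_add, add_mul]

variable [FiniteDimensional k A] [Algebra.IsCentral k A] [IsSimpleRing A]

theorem TwoSidedIdeal.baseChange_mem (I : TwoSidedIdeal (E ⊗[k] A)) {z : E ⊗[k] A} (hz : z ∈ I)
    (f : A →ₗ[k] A) : f.baseChange E z ∈ I := by
  obtain ⟨t, rfl⟩ := AlgHom.mulLeftRight_surjective_of_isSimpleRing k A f
  induction t with
  | zero => simp [I.zero_mem]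
  | tmul a b =>
    rw [← MulOpposite.op_unop b, LinearMap.baseChange_mulLeftRight_tmul]
    exact I.mul_mem_right _ _ (I.mul_mem_left _ _ hz)
  | add x y hx hy =>
    rw [map_add, LinearMap.baseChange_add, LinearMap.add_apply]
    exact I.add_mem hx hy

theorem LinearMap.baseChange_apply_of_mem_center {z : E ⊗[k] A}
    (hz : z ∈ Subalgebra.center E (E ⊗[k] A)) (f : A →ₗ[k] A) :
    f.baseChange E z = z * (1 ⊗ₜ[k] f 1) := by
  obtain ⟨t, rfl⟩ := AlgHom.mulLeftRight_surjective_of_isSimpleRing k A f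
  induction t with
  | zero => simp
  | tmul a b =>
    rw [← MulOpposite.op_unop b, LinearMap.baseChange_mulLeftRight_tmul,
      Subalgebra.mem_center_iff.mp hz, mul_assoc]
    simp
  | add x y hx hy =>
    rw [map_add, LinearMap.baseChange_add, LinearMap.add_apply, hx, hy, LinearMap.add_apply,
      tmul_add, mul_add]

theorem Algebra.TensorProduct.isSimpleRing_of_isCentral : IsSimpleRing (E ⊗[k] A) := by
  have : Nontrivial (E ⊗[k] A) := inferInstance
  refine .of_eq_bot_or_eq_top fun I ↦ or_iff_not_imp_left.mpr fun hI ↦ ?_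
  obtain ⟨z, hzI, hz⟩ := SetLike.exists_of_lt (bot_lt_iff_ne_bot.mpr hI)
  let b := Module.finBasis k A
  obtain ⟨i, hi⟩ : ∃ i, (b.baseChange E).repr z i ≠ 0 := by
    by_contra! h
    exact hz ((TwoSidedIdeal.mem_bot _).mpr ((b.baseChange E).repr.map_eq_zero_iff.mp
      (Finsupp.ext h)))
  have hf : ((b.coord i).smulRight (1 : A)).baseChange E =
      ((b.baseChange E).coord i).smulRight 1 := by
    refine (b.baseChange E).ext fun j ↦ ?_
    by_cases h : j = i
    · subst h; simp [Algebra.TensorProduct.one_def]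
    · simp [h]
  have h := I.baseChange_mem E hzI ((b.coord i).smulRight 1)
  rw [hf, LinearMap.smulRight_apply, Module.Basis.coord_apply] at h
  rw [← I.one_mem_iff]
  have := I.mul_mem_left (algebraMap E _ ((b.baseChange E).repr z i)⁻¹) _ h
  rwa [← Algebra.smul_def, smul_smul, inv_mul_cancel₀ hi, one_smul] at this

theorem Algebra.TensorProduct.isCentral_baseChange : Algebra.IsCentral E (E ⊗[k] A) where
  out z hz := by
    obtain ⟨l, hl⟩ := Module.Projective.exists_dual_ne_zero k (one_ne_zero (α := A))
    let f : A →ₗ[k] A := ((l 1)⁻¹ • l).smulRight 1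
    have h := LinearMap.baseChange_apply_of_mem_center E hz f
    have hf : f 1 = 1 := by simp [f, hl]
    rw [hf, ← Algebra.TensorProduct.one_def, mul_one] at h
    rw [← h]
    clear h hz
    induction z with
    | zero => simp
    | tmul e x =>
      refine Algebra.mem_bot.mpr ⟨((l 1)⁻¹ * l x) • e, ?_⟩
      simp [f, smul_tmul]
    | add x y hx hy => rw [map_add]; exact add_mem hx hy

end BaseChange

theorem Algebra.IsCentral.of_matrix {k D n : Type*} [Field k] [Ring D] [Algebra k D]
    [Fintype n] [DecidableEq n] [Nonempty n] [Algebra.IsCentral k (Matrix n n D)] :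
    Algebra.IsCentral k D where
  out x hx := by
    have h : Matrix.scalar n x ∈ Subalgebra.center k (Matrix n n D) :=
      Subalgebra.mem_center_iff.mpr fun M ↦
        (Matrix.scalar_commute x (fun y ↦ (Subalgebra.mem_center_iff.mp hx y).symm) M).symm
    obtain ⟨c, hc⟩ := (Algebra.IsCentral.mem_center_iff k).mp h
    obtain ⟨i⟩ := ‹Nonempty n›
    refine Algebra.mem_bot.mpr ⟨c, ?_⟩
    simpa [Matrix.algebraMap_matrix_apply] using (congrFun (congrFun hc i) i).symm

theorem IsSimpleRing.exists_algEquiv_matrix_central_divisionRing (k A : Type) [Field k] [Ring A]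
    [Algebra k A] [FiniteDimensional k A] [Algebra.IsCentral k A] [IsSimpleRing A] :
    ∃ (n : ℕ) (_ : NeZero n) (D : Type) (_ : DivisionRing D) (_ : Algebra k D)
      (_ : FiniteDimensional k D) (_ : Algebra.IsCentral k D),
      Nonempty (A ≃ₐ[k] Matrix (Fin n) (Fin n) D) := by
  have := IsArtinianRing.of_finite k A
  obtain ⟨n, hn, D, _, _, _, ⟨e⟩⟩ := exists_algEquiv_matrix_divisionRing_finite k A
  have := Algebra.IsCentral.of_algEquiv k _ _ e
  exact ⟨n, hn, D, _, _, ‹_›, .of_matrix (n := Fin n), ⟨e⟩⟩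

/-- `τ` is an involution of the first kind on the `k`-algebra `A`. -/
structure LinearMap.IsAlgInvolution {k A : Type*} [CommSemiring k] [Semiring A] [Algebra k A]
    (τ : A →ₗ[k] A) : Prop where
  map_mul (x y : A) : τ (x * y) = τ y * τ x
  involutive (x : A) : τ (τ x) = x

namespace LinearMap.IsAlgInvolution

theorem map_one {k A : Type*} [CommSemiring k] [Semiring A] [Algebra k A] {τ : A →ₗ[k] A}
    (h : τ.IsAlgInvolution) : τ 1 = 1 := by
  have := h.map_mul (τ 1) 1
  rw [mul_one, h.involutive, mul_one] at this
  exact this.symm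

theorem conj {k A B : Type*} [CommSemiring k] [Semiring A] [Algebra k A] [Semiring B]
    [Algebra k B] {τ : A →ₗ[k] A} (h : τ.IsAlgInvolution) (e : A ≃ₐ[k] B) :
    (e.toLinearMap ∘ₗ τ ∘ₗ e.symm.toLinearMap).IsAlgInvolution where
  map_mul x y := by simp [h.map_mul]
  involutive x := by simp [h.involutive]

open TensorProduct in
theorem baseChange {k A : Type*} (E : Type*) [CommRing k] [Ring A] [Algebra k A] [CommRing E]
    [Algebra k E] {τ : A →ₗ[k] A} (h : τ.IsAlgInvolution) :
    (τ.baseChange E : E ⊗[k] A →ₗ[E] E ⊗[k] A).IsAlgInvolution where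
  map_mul x y := by
    induction x with
    | zero => simp
    | add x x' hx hx' => simp [add_mul, mul_add, hx, hx']
    | tmul e a =>
      induction y with
      | zero => simp
      | add y y' hy hy' => simp only [add_mul, mul_add, hy, hy', _root_.map_add]
      | tmul e' b => simp [h.map_mul, mul_comm]
  involutive x := by
    induction x with
    | zero => simp
    | add x x' hx hx' => simp [hx, hx']
    | tmul e a => simp [h.involutive]

/-- An involution of the first kind on a matrix algebra over a division algebra descends to the
division algebra. -/
theorem exists_of_matrix {k D n : Type*} [Field k] [DivisionRing D] [Algebra k D]
    [Fintype n] [DecidableEq n] [Nonempty n]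
    {τ : Matrix n n D →ₗ[k] Matrix n n D} (h : τ.IsAlgInvolution) :
    ∃ σ : D →ₗ[k] D, σ.IsAlgInvolution := by
  obtain ⟨o⟩ := ‹Nonempty n›
  set e : Matrix n n D := Matrix.single o o 1 with he
  have hee : e * e = e := by simp [he]
  have hcorner (M : Matrix n n D) : e * M * e = Matrix.single o o (M o o) := by
    simp [he]
  have hff : τ e * τ e = τ e := by rw [← h.map_mul, hee]
  have he0 : e ≠ 0 := fun h0 ↦ one_ne_zero (α := D) <| by
    simpa [he] using congrFun (congrFun h0 o) o
  have hf0 : τ e ≠ 0 := fun h0 ↦ he0 (by rw [← h.involutive e, h0, _root_.map_zero])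
  obtain ⟨w, ε, hε, hw0, hew, hwf, hτw⟩ : ∃ (w : Matrix n n D) (ε : k), ε * ε = 1 ∧ w ≠ 0 ∧
      e * w = w ∧ w * τ e = w ∧ τ w = ε • w := by
    obtain ⟨a, ha⟩ : ∃ a, e * a * τ e ≠ 0 := by
      by_contra! h0
      refine hf0 (Matrix.ext fun i j ↦ ?_)
      have := congrFun (congrFun (h0 (Matrix.single o i 1)) o) j
      simpa [he, Matrix.single_mul_apply_same] using this
    have hτ : τ (e * a * τ e) = e * τ a * τ e := by
      rw [h.map_mul, h.map_mul, h.involutive, mul_assoc]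
    by_cases h0 : e * a * τ e + τ (e * a * τ e) = 0
    · exact ⟨e * a * τ e, -1, by simp, ha, by simp only [← mul_assoc, hee],
        by simp only [mul_assoc, hff],
        by rw [neg_one_smul]; exact (neg_eq_of_add_eq_zero_right h0).symm⟩
    · refine ⟨_, 1, by simp, h0, ?_, ?_, ?_⟩
      · rw [hτ]; simp only [mul_add, ← mul_assoc, hee]
      · rw [hτ]; simp only [add_mul, mul_assoc, hff]
      · rw [_root_.map_add, h.involutive, one_smul, add_comm]
  obtain ⟨w', hfw', hwe, hww'⟩ : ∃ w', τ e * w' = w' ∧ w' * e = w' ∧ w * w' = e := by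
    obtain ⟨j, hj⟩ : ∃ j, w o j ≠ 0 := by
      by_contra! h0
      refine hw0 (Matrix.ext fun i j ↦ ?_)
      rw [← hew]
      by_cases hi : i = o
      · subst hi; simp [he, h0]
      · simp [he, hi]
    refine ⟨τ e * Matrix.single j o (w o j)⁻¹, by rw [← mul_assoc, hff],
      by simp [he, mul_assoc], ?_⟩
    rw [← mul_assoc, hwf, ← hew, he]
    simp [hj]
  have hτwe : τ w' * e = τ w' := by rw [← h.involutive e, ← h.map_mul, hfw']
  have hww : w' * w = τ e := by
    have hτ : τ (w' * w) = ε • (w * τ w') := by rw [h.map_mul, hτw, smul_mul_assoc]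
    have hc : e * τ (w' * w) * e = τ (w' * w) := by
      rw [hτ, mul_smul_comm, smul_mul_assoc, ← mul_assoc, hew, mul_assoc, hτwe]
    have hid : τ (w' * w) * τ (w' * w) = τ (w' * w) := by
      rw [← h.map_mul]
      congr 1
      rw [mul_assoc, ← mul_assoc w, hww', hew]
    rw [hcorner] at hc
    set g := τ (w' * w) o o with hg
    have hg2 : g * g = g := by
      have := congrFun (congrFun hid o) o
      rw [← hc] at this
      simpa using this
    have hg1 : g = 1 := by
      refine (mul_eq_left₀ ?_).mp hg2
      intro hg0
      rw [hg0, Matrix.single_zero] at hc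
      have h0 : w' * w = 0 := by rw [← h.involutive (w' * w), ← hc, _root_.map_zero]
      apply hw0
      rw [← hew, ← hww', mul_assoc, h0, mul_zero]
    rw [← h.involutive (w' * w), ← hc, hg1]
  have hτw' : τ w' = ε • w' := by
    have h1 : τ w' * τ w = τ e := by rw [← h.map_mul, hww']
    rw [hτw, mul_smul_comm] at h1
    rw [← hτwe, ← hww', ← mul_assoc, ← one_smul k (τ w' * w), ← hε, mul_smul, h1, smul_mul_assoc,
      hfw']
  let ι : D →ₗ[k] Matrix n n D := Matrix.singleLinearMap k o o
  have hι (d : D) : e * ι d = ι d ∧ ι d * e = ι d := by simp [ι, he, Matrix.singleLinearMap]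
  have hιmul (x y : D) : ι (x * y) = ι x * ι y := by simp [ι, Matrix.singleLinearMap]
  let σ : D →ₗ[k] D := Matrix.entryLinearMap k D o o ∘ₗ LinearMap.mulLeftRight k (w, w') ∘ₗ τ ∘ₗ ι
  have hσ (d : D) : ι (σ d) = w * τ (ι d) * w' := by
    have : e * (w * τ (ι d) * w') * e = w * τ (ι d) * w' := by
      rw [← mul_assoc, ← mul_assoc, hew, mul_assoc, hwe]
    rw [← this, hcorner]
    rfl
  have hιinj : Function.Injective ι := fun x y hxy ↦ by
    simpa [ι, Matrix.singleLinearMap] using congrFun (congrFun hxy o) o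
  refine ⟨σ, ⟨fun x y ↦ hιinj ?_, fun x ↦ hιinj ?_⟩⟩
  · rw [hσ, hιmul, hιmul, hσ, hσ, h.map_mul]
    calc w * (τ (ι y) * τ (ι x)) * w' = w * τ (e * ι y) * τ (ι x) * w' := by
          rw [(hι y).1]; simp only [mul_assoc]
      _ = _ := by rw [h.map_mul, ← hww]; simp only [mul_assoc]
  · rw [hσ, hσ, h.map_mul, h.map_mul, h.involutive, hτw, hτw']
    simp only [smul_mul_assoc, mul_smul_comm, smul_smul, hε, one_smul]
    simp only [← mul_assoc]
    rw [hww', (hι x).1, mul_assoc, hww', (hι x).2]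

end LinearMap.IsAlgInvolution

theorem LinearMap.BilinForm.not_nondegenerate_of_odd_finrank {k V : Type*} [Field k]
    [AddCommGroup V] [Module k V] [FiniteDimensional k V] (h2 : (2 : k) ≠ 0)
    (hodd : Odd (Module.finrank k V)) (B : LinearMap.BilinForm k V)
    (hB : ∀ x y, B y x = -B x y) : ¬ B.Nondegenerate := by
  rw [nondegenerate_iff_det_ne_zero (Module.finBasis k V), not_not]
  set M := BilinForm.toMatrix (Module.finBasis k V) B with hM
  have hT : M.transpose = -M := by
    ext i j
    simpa [hM, BilinForm.toMatrix_apply] using hB _ _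
  have h := M.det_transpose
  rw [hT, Matrix.det_neg, Fintype.card_fin, hodd.neg_one_pow, neg_one_mul, eq_comm,
    eq_neg_iff_add_eq_zero, ← two_mul] at h
  exact (mul_eq_zero.mp h).resolve_left h2

/-- A central division algebra of odd degree admitting an involution of the first kind is
trivial. -/
theorem LinearMap.IsAlgInvolution.finrank_eq_one_of_odd {k D : Type*} [Field k] [DivisionRing D]
    [Algebra k D] [FiniteDimensional k D] [Algebra.IsCentral k D] (h2 : (2 : k) ≠ 0)
    {τ : D →ₗ[k] D} (h : τ.IsAlgInvolution) (hodd : Odd (Module.finrank k D)) :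
    Module.finrank k D = 1 := by
  obtain ⟨l, hl⟩ := Module.Projective.exists_dual_ne_zero k (one_ne_zero (α := D))
  let lam : Module.Dual k D := l + l ∘ₗ τ
  have hlam1 : lam 1 ≠ 0 := by
    simpa [lam, h.map_one, ← two_mul] using ⟨h2, hl⟩
  have hlamτ (x : D) : lam (τ x) = lam x := by simp [lam, h.involutive, add_comm]
  have hskew (s : D) (hs : τ s = -s) : s = 0 := by
    by_contra hs0
    let B : LinearMap.BilinForm k D :=
      LinearMap.mk₂ k (fun x y ↦ lam (τ x * s * y)) (by simp [add_mul]) (by simp)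
        (by simp [mul_add]) (by simp)
    have hBapp (x y : D) : B x y = lam (τ x * s * y) := rfl
    have hB (x y : D) : B y x = -B x y := by
      rw [hBapp, hBapp, ← hlamτ, h.map_mul, h.map_mul, h.involutive, hs, ← _root_.map_neg]
      congr 1
      simp [mul_assoc]
    refine LinearMap.BilinForm.not_nondegenerate_of_odd_finrank h2 hodd B hB
      ⟨fun x hx ↦ ?_, fun y hy ↦ ?_⟩
    · by_contra hx0
      have hτx : τ x ≠ 0 := fun h0 ↦ hx0 (by rw [← h.involutive x, h0, _root_.map_zero])
      apply hlam1
      rw [← hx (τ x * s)⁻¹, hBapp, mul_inv_cancel₀ (mul_ne_zero hτx hs0)]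
    · by_contra hy0
      apply hlam1
      rw [← hy (τ (s * y)⁻¹), hBapp, h.involutive, mul_assoc,
        inv_mul_cancel₀ (mul_ne_zero hs0 hy0)]
  have hid (x : D) : τ x = x :=
    (sub_eq_zero.mp (hskew (x - τ x) (by rw [_root_.map_sub, h.involutive, neg_sub]))).symm
  have htop : (⊥ : Subalgebra k D) = ⊤ := by
    rw [← Algebra.IsCentral.center_eq_bot k D, eq_top_iff]
    refine fun x _ ↦ Subalgebra.mem_center_iff.mpr fun y ↦ ?_
    have := h.map_mul y x
    rwa [hid, hid, hid] at this
  exact Subalgebra.bot_eq_top_iff_finrank_eq_one.mp htop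

theorem IsSepClosed.exists_algEquiv_matrix (K A : Type) [Field K] [IsSepClosed K] [Ring A]
    [Algebra K A] [FiniteDimensional K A] [Algebra.IsCentral K A] [IsSimpleRing A] :
    ∃ (n : ℕ) (_ : NeZero n), Nonempty (A ≃ₐ[K] Matrix (Fin n) (Fin n) K) := by
  obtain ⟨n, hn, D, _, _, _, _, ⟨e⟩⟩ :=
    IsSimpleRing.exists_algEquiv_matrix_central_divisionRing K A
  have hbot : (⊥ : Subalgebra K D) = ⊤ := by
    by_contra hne
    obtain ⟨x, hx, hsep⟩ := JacobsonNoether.exists_separable_and_not_isCentral' hne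
    refine hx (Algebra.mem_bot.mpr (minpoly.mem_range_of_degree_eq_one K x ?_))
    exact IsSepClosed.degree_eq_one_of_irreducible K
      (minpoly.irreducible (Algebra.IsIntegral.isIntegral x)) hsep
  have hbij : Function.Bijective (Algebra.ofId K D) :=
    ⟨(algebraMap K D).injective, fun x ↦ by
      simpa [Algebra.mem_bot] using hbot.ge (Algebra.mem_top (x := x))⟩
  exact ⟨n, hn, ⟨e.trans (AlgEquiv.ofBijective _ hbij).symm.mapMatrix⟩⟩

open TensorProduct in
/-- A central simple algebra is split by a finite Galois extension. -/
theorem IsSimpleRing.exists_galois_algHom_matrix (k A : Type) [Field k] [Ring A]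
    [Algebra k A] [FiniteDimensional k A] [Algebra.IsCentral k A] [IsSimpleRing A] :
    ∃ (d : ℕ) (L : Type) (_ : Field L) (_ : Algebra k L), d ≠ 0 ∧ FiniteDimensional k L ∧
      IsGalois k L ∧ Module.finrank k A = d ^ 2 ∧
      Nonempty (A →ₐ[k] Matrix (Fin d) (Fin d) L) := by
  let K := SeparableClosure k
  have := Algebra.TensorProduct.isSimpleRing_of_isCentral (k := k) K (A := A)
  have := Algebra.TensorProduct.isCentral_baseChange (k := k) K (A := A)
  obtain ⟨d, hd, ⟨e⟩⟩ := IsSepClosed.exists_algEquiv_matrix K (K ⊗[k] A)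
  let ρ : A →ₐ[k] Matrix (Fin d) (Fin d) K :=
    (e.restrictScalars k).toAlgHom.comp Algebra.TensorProduct.includeRight
  let b := Module.finBasis k A
  let s : Set K := Set.range fun x : _ × Fin d × Fin d ↦ ρ (b x.1) x.2.1 x.2.2
  let L := FiniteGaloisIntermediateField.adjoin k s
  have hρ (a : A) (i j : Fin d) : ρ a i j ∈ L.toIntermediateField := by
    rw [← b.sum_repr a, map_sum, Matrix.sum_apply]
    refine sum_mem fun x _ ↦ ?_
    rw [map_smul, Matrix.smul_apply]
    exact L.toIntermediateField.smul_mem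
      (FiniteGaloisIntermediateField.subset_adjoin k s ⟨(x, i, j), rfl⟩)
  let ι : Matrix (Fin d) (Fin d) L.toIntermediateField →ₐ[k] Matrix (Fin d) (Fin d) K :=
    L.toIntermediateField.val.mapMatrix
  have hι : Function.Injective ι := Matrix.map_injective Subtype.val_injective
  let ρ' : A →ₐ[k] ι.range :=
    ρ.codRestrict ι.range fun a ↦ ⟨Matrix.of fun i j ↦ ⟨ρ a i j, hρ a i j⟩, rfl⟩
  refine ⟨d, L.toIntermediateField, inferInstance, inferInstance, hd.ne, L.finiteDimensional,
    L.isGalois, ?_, ⟨(AlgEquiv.ofInjective ι hι).symm.toAlgHom.comp ρ'⟩⟩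
  rw [← Module.finrank_baseChange (R := K), e.toLinearEquiv.finrank_eq, Module.finrank_matrix]
  simp [sq]

/-- The dimension of a module over `Matrix n n D` is a multiple of that of the column module. -/
theorem Matrix.dvd_finrank_of_algHom {k D n V : Type*} [Field k] [DivisionRing D]
    [Algebra k D] [Fintype n] [DecidableEq n] [Nonempty n] [AddCommGroup V] [Module k V]
    [FiniteDimensional k V] (ρ : Matrix n n D →ₐ[k] Module.End k V) :
    Fintype.card n * Module.finrank k D ∣ Module.finrank k V := by
  obtain ⟨o⟩ := ‹Nonempty n›
  let e (i j : n) : Module.End k V := ρ (single i j 1)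
  have he (i j l : n) (v : V) : e i j (e j l v) = e i l v := by
    simp only [e, ← Module.End.mul_apply, ← map_mul, single_mul_single_same, mul_one]
  have he0 (i j j' l : n) (hj : j ≠ j') (v : V) : e i j (e j' l v) = 0 := by
    simp only [e, ← Module.End.mul_apply, ← map_mul]
    simp [hj]
  have hsum (v : V) : ∑ i, e i i v = v := by
    have : ∑ i : n, single i i (1 : D) = 1 := by
      ext i j
      simp [Matrix.sum_apply, Matrix.one_apply, single_apply, ite_and]
    simp only [e]
    rw [← LinearMap.sum_apply, ← map_sum, this, map_one, Module.End.one_apply]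
  let W := LinearMap.range (e o o)
  have hW (w : W) : e o o w = w := by
    obtain ⟨_, v, rfl⟩ := w
    exact he _ _ _ _
  let f : V ≃ₗ[k] (n → W) :=
    { toFun := fun v i ↦ ⟨e o i v, e o i v, he _ _ _ _⟩
      map_add' := fun x y ↦ by ext; simp
      map_smul' := fun c x ↦ by ext; simp
      invFun := fun w ↦ ∑ i, e i o (w i)
      left_inv := fun v ↦ by simp only [he, hsum]
      right_inv := fun w ↦ by
        funext i
        ext
        simp only [map_sum]
        rw [Finset.sum_eq_single i, he, hW]
        · intro j _ hj
          exact he0 _ _ _ _ hj.symm _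
        · simp }
  have hDW (d : D) (w : W) : ρ (single o o d) w ∈ W := by
    refine ⟨ρ (single o o d) w, ?_⟩
    simp only [e, ← Module.End.mul_apply, ← map_mul, single_mul_single_same, one_mul]
  let _ : Module D W :=
    { smul := fun d w ↦ ⟨ρ (single o o d) w, hDW d w⟩
      one_smul := fun w ↦ Subtype.ext (hW w)
      mul_smul := fun a b w ↦ Subtype.ext <| by
        change ρ (single o o (a * b)) w = ρ (single o o a) (ρ (single o o b) w)
        rw [← Module.End.mul_apply, ← map_mul, single_mul_single_same]
      smul_zero := fun d ↦ Subtype.ext (map_zero (ρ (single o o d)))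
      smul_add := fun d x y ↦ Subtype.ext (map_add (ρ (single o o d)) x.1 y.1)
      add_smul := fun a b w ↦ Subtype.ext <| by
        change ρ (single o o (a + b)) w = ρ (single o o a) w + ρ (single o o b) w
        rw [single_add, map_add, LinearMap.add_apply]
      zero_smul := fun w ↦ Subtype.ext <| by
        change ρ (single o o 0) w = 0
        simp }
  have : IsScalarTower k D W := ⟨fun c d w ↦ Subtype.ext <| by
    change ρ (single o o (c • d)) w = c • ρ (single o o d) w
    rw [← smul_single, map_smul, LinearMap.smul_apply]⟩
  rw [f.finrank_eq, Module.finrank_pi_fintype, Finset.sum_const, Finset.card_univ, smul_eq_mul]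
  exact mul_dvd_mul_left _ ⟨_, (Module.finrank_mul_finrank k D W).symm⟩

theorem Matrix.dvd_finrank_of_algHom_matrix {k L D n m : Type*} [Field k] [Field L] [Algebra k L]
    [FiniteDimensional k L] [DivisionRing D] [Algebra k D] [Fintype n] [DecidableEq n] [Nonempty n]
    [Fintype m] [DecidableEq m] (ρ : Matrix n n D →ₐ[k] Matrix m m L) :
    Fintype.card n * Module.finrank k D ∣ Fintype.card m * Module.finrank k L := by
  let φ : Matrix m m L →ₐ[k] Module.End k (m → L) :=
    { toFun := fun M ↦ (Matrix.toLin' M).restrictScalars k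
      map_one' := by ext; simp
      map_mul' := fun M N ↦ by ext; simp
      map_zero' := by ext; simp
      map_add' := fun M N ↦ by ext; simp
      commutes' := fun c ↦ LinearMap.ext fun v ↦ by
        simp [Algebra.algebraMap_eq_smul_one, Matrix.smul_mulVec] }
  have h := Matrix.dvd_finrank_of_algHom (φ.comp ρ)
  rwa [Module.finrank_pi_fintype, Finset.sum_const, Finset.card_univ, smul_eq_mul] at h

/-- If a division algebra `D` embeds in `m × m` matrices over `L`, then `[D : k] ∣ |m| [L : k]`. -/
theorem AlgHom.finrank_dvd_of_matrix {k L D m : Type*} [Field k] [Field L] [Algebra k L]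
    [FiniteDimensional k L] [DivisionRing D] [Algebra k D] [Fintype m] [DecidableEq m]
    (ρ : D →ₐ[k] Matrix m m L) :
    Module.finrank k D ∣ Fintype.card m * Module.finrank k L := by
  simpa using Matrix.dvd_finrank_of_algHom_matrix
    (ρ.comp (Matrix.uniqueAlgEquiv (m := Unit) (R := k) (A := D)).toAlgHom)

open TensorProduct in
/-- The degree of a central division algebra with an involution of the first kind has no odd
prime divisor. -/
theorem LinearMap.IsAlgInvolution.eq_two_of_prime_dvd {k D : Type} [Field k] [DivisionRing D]
    [Algebra k D] [FiniteDimensional k D] [Algebra.IsCentral k D] (h2 : (2 : k) ≠ 0)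
    {τ : D →ₗ[k] D} (h : τ.IsAlgInvolution) {d p : ℕ} (hd : Module.finrank k D = d ^ 2)
    (hp : p.Prime) (hpd : p ∣ d) : p = 2 := by
  by_contra hp2
  obtain ⟨d', L, _, _, hd0, _, _, hd', ⟨ρ⟩⟩ := IsSimpleRing.exists_galois_algHom_matrix k D
  obtain rfl : d = d' := Nat.pow_left_injective two_ne_zero (hd.symm.trans hd')
  have := Fact.mk hp
  obtain ⟨P⟩ := (inferInstance : Nonempty (Sylow p Gal(L/k)))
  let E := IntermediateField.fixedField (P : Subgroup Gal(L/k))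
  have hLE : Module.finrank E L = Nat.card P := IntermediateField.finrank_fixedField_eq_card _
  have hEk : Module.finrank k E = (P : Subgroup Gal(L/k)).index := by
    have h1 := Module.finrank_mul_finrank k E L
    rw [hLE, ← IsGalois.card_aut_eq_finrank k L, ← (P : Subgroup Gal(L/k)).card_mul_index,
      mul_comm] at h1
    exact Nat.eq_of_mul_eq_mul_left Nat.card_pos h1
  obtain ⟨a, ha⟩ := IsPGroup.iff_card.mp P.isPGroup'
  have := Algebra.TensorProduct.isSimpleRing_of_isCentral (k := k) E (A := D)
  have := Algebra.TensorProduct.isCentral_baseChange (k := k) E (A := D)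
  obtain ⟨s, hs, D', _, _, _, _, ⟨e⟩⟩ :=
    IsSimpleRing.exists_algEquiv_matrix_central_divisionRing E (E ⊗[k] D)
  obtain ⟨t, -, -, -, ht0, -, -, ht, -⟩ := IsSimpleRing.exists_galois_algHom_matrix E D'
  have hst : d = s * t := by
    refine Nat.pow_left_injective two_ne_zero ?_
    have := e.toLinearEquiv.finrank_eq
    rw [Module.finrank_baseChange, Module.finrank_matrix, hd, ht, Fintype.card_fin] at this
    simp only [this]
    ring
  let ρE : E ⊗[k] D →ₐ[E] Matrix (Fin d) (Fin d) L :=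
    Algebra.TensorProduct.lift (Algebra.ofId _ _) ρ fun x y ↦ Algebra.commutes x (ρ y)
  have htp : t ∣ p ^ a := by
    have := Matrix.dvd_finrank_of_algHom_matrix (ρE.comp e.symm.toAlgHom)
    rw [Fintype.card_fin, Fintype.card_fin, ht, hLE, ha, hst, sq, ← mul_assoc] at this
    exact Nat.dvd_of_mul_dvd_mul_left (Nat.pos_of_ne_zero (mul_ne_zero hs.ne ht0)) this
  have htodd : Odd t := (hp.odd_of_ne_two hp2).pow.of_dvd_nat htp
  obtain ⟨σ, hσ⟩ := ((h.baseChange E).conj e).exists_of_matrix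
  have h2E : (2 : E) ≠ 0 := by
    rw [← map_ofNat (algebraMap k E) 2]
    exact (map_ne_zero _).mpr h2
  have hD'_one := hσ.finrank_eq_one_of_odd h2E (ht ▸ htodd.pow)
  obtain rfl : t = 1 := by simpa [hD'_one] using ht.symm
  rw [mul_one] at hst
  subst hst
  let ε : E ≃ₐ[E] D' := AlgEquiv.ofBijective (Algebra.ofId E D')
    (Algebra.finrank_eq_one_iff_bijective_algebraMap.mp hD'_one)
  have hdvd := AlgHom.finrank_dvd_of_matrix
    (((e.trans ε.symm.mapMatrix).restrictScalars k).toAlgHom.comp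
      Algebra.TensorProduct.includeRight)
  rw [hd, Fintype.card_fin, hEk, sq] at hdvd
  exact P.not_dvd_index (hpd.trans (Nat.dvd_of_mul_dvd_mul_left (Nat.pos_of_ne_zero hd0) hdvd))

namespace QuaternionAlgebra.Basis

variable {k A : Type*} [Field k] [Ring A] [Nontrivial A] [Algebra k A] {a b : k}

theorem liftHom_injective (h2 : (2 : k) ≠ 0) (ha : a ≠ 0) (hb : b ≠ 0)
    (q : QuaternionAlgebra.Basis A a 0 b) : Function.Injective q.liftHom := by
  have hi : q.i * q.i = algebraMap k A a := by
    rw [q.i_mul_i, zero_smul, add_zero, Algebra.algebraMap_eq_smul_one]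
  have hj : q.j * q.j = algebraMap k A b := by rw [q.j_mul_j, Algebra.algebraMap_eq_smul_one]
  have hji : q.j * q.i = -(q.i * q.j) := by rw [q.j_mul_i, zero_smul, zero_sub, q.i_mul_j]
  have hi0 {z : A} (hz : z * q.i = 0) : z = 0 := by
    have := congrArg (· * q.i) hz
    simp only [mul_assoc, hi, zero_mul, ← Algebra.commutes, ← Algebra.smul_def] at this
    exact (smul_eq_zero_iff_right ha).mp this
  have hj0 {z : A} (hz : z * q.j = 0) : z = 0 := by
    have := congrArg (· * q.j) hz
    simp only [mul_assoc, hj, zero_mul, ← Algebra.commutes, ← Algebra.smul_def] at this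
    exact (smul_eq_zero_iff_right hb).mp this
  have hC {r s : k} (h : r • (1 : A) + s • q.i = 0) : r = 0 ∧ s = 0 := by
    have hr : r • (1 : A) = 0 := by
      have h1 : (2 : k) • (r • (1 : A)) * q.j = 0 := by
        have := congr(q.j * $h + $h * q.j)
        simp only [mul_add, add_mul, mul_smul_comm, smul_mul_assoc, hji, mul_one, one_mul,
          mul_zero, zero_mul, smul_neg, add_zero] at this
        rw [smul_mul_assoc, smul_mul_assoc, one_mul, two_smul, ← this]
        abel
      exact (smul_eq_zero_iff_right h2).mp (hj0 h1)
    have hs : s • (1 : A) * q.i = 0 := by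
      rwa [hr, zero_add, ← one_mul q.i, ← smul_mul_assoc] at h
    exact ⟨(smul_eq_zero_iff_left one_ne_zero).mp hr,
      (smul_eq_zero_iff_left one_ne_zero).mp (hi0 hs)⟩
  refine (injective_iff_map_eq_zero _).mpr fun x hx ↦ ?_
  have hx' : x.re • (1 : A) + x.imI • q.i + x.imJ • q.j + x.imK • (q.i * q.j) = 0 := by
    rw [q.i_mul_j, ← Algebra.algebraMap_eq_smul_one]
    exact hx
  have h1 : x.re • (1 : A) + x.imI • q.i = 0 := by
    refine hi0 ((smul_eq_zero_iff_right h2).mp ?_)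
    have := congr(q.i * $hx' + $hx' * q.i)
    simp only [mul_add, add_mul, mul_smul_comm, smul_mul_assoc, hji, mul_one, one_mul,
      mul_zero, zero_mul, smul_neg, add_zero, mul_assoc, mul_neg] at this
    simp only [add_mul, smul_mul_assoc, one_mul]
    rw [two_smul, ← this]
    abel
  have h3 : x.imJ • (1 : A) + x.imK • q.i = 0 := by
    refine hj0 ?_
    rw [h1, zero_add] at hx'
    rwa [add_mul, smul_mul_assoc, smul_mul_assoc, one_mul]
  exact QuaternionAlgebra.ext (hC h1).1 (hC h1).2 (hC h3).1 (hC h3).2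

open Quaternion in
theorem nonempty_algEquiv [FiniteDimensional k A] (h2 : (2 : k) ≠ 0) (ha : a ≠ 0) (hb : b ≠ 0)
    (q : QuaternionAlgebra.Basis A a 0 b) (hA : Module.finrank k A = 4) :
    Nonempty (A ≃ₐ[k] ℍ[k, a, b]) := by
  have hinj := q.liftHom_injective h2 ha hb
  have hsurj := (LinearMap.injective_iff_surjective_of_finrank_eq_finrank
    (f := q.liftHom.toLinearMap) (by rw [hA, QuaternionAlgebra.finrank_eq_four])).mp hinj
  exact ⟨(AlgEquiv.ofBijective q.liftHom ⟨hinj, hsurj⟩).symm⟩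

end QuaternionAlgebra.Basis

open Quaternion in
theorem Matrix.nonempty_algEquiv_quaternion {k : Type*} [Field k] (h2 : (2 : k) ≠ 0) :
    Nonempty (Matrix (Fin 2) (Fin 2) k ≃ₐ[k] ℍ[k, (1 : k), (1 : k)]) :=
  QuaternionAlgebra.Basis.nonempty_algEquiv h2 one_ne_zero one_ne_zero
    { i := !![1, 0; 0, -1]
      j := !![0, 1; 1, 0]
      k := !![0, 1; -1, 0]
      i_mul_i := by simp [Matrix.one_fin_two]
      j_mul_j := by simp [Matrix.one_fin_two]
      i_mul_j := by simp
      j_mul_i := by simp }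
    (by simp [Module.finrank_matrix])

theorem Subalgebra.finrank_dvd_finrank {k D : Type*} [Field k] [DivisionRing D] [Algebra k D]
    [FiniteDimensional k D] (K : Subalgebra k D) : Module.finrank k K ∣ Module.finrank k D := by
  let _ : DivisionRing K := divisionRingOfFiniteDimensional k K
  exact ⟨_, (Module.finrank_mul_finrank k K D).symm⟩

/-- A noncommutative division algebra of dimension four is quadratic. -/
theorem DivisionRing.exists_mul_self_eq_of_finrank_eq_four {k D : Type*} [Field k]
    [DivisionRing D] [Algebra k D] [FiniteDimensional k D] [Algebra.IsCentral k D]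
    (hD : Module.finrank k D = 4) (y : D) : ∃ p q : k, y * y = algebraMap k D p + q • y := by
  by_cases hy : y ∈ (⊥ : Subalgebra k D)
  · obtain ⟨c, rfl⟩ := Algebra.mem_bot.mp hy
    exact ⟨c * c, 0, by simp⟩
  let K := Algebra.adjoin k {y}
  have hK4 : Module.finrank k K ≠ 4 := by
    intro hK
    have htop : Subalgebra.toSubmodule K = ⊤ := Submodule.eq_top_of_finrank_eq (hK.trans hD.symm)
    refine hy ?_
    rw [← Algebra.IsCentral.center_eq_bot k D, Subalgebra.mem_center_iff]
    intro x
    have hx : x ∈ K := htop.ge (Submodule.mem_top (x := x))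
    exact (Algebra.commute_of_mem_adjoin_self hx).symm
  have hK : Module.finrank k K ≤ 2 := by
    have hdvd : Module.finrank k K ∣ 4 := hD ▸ K.finrank_dvd_finrank
    have := Nat.le_of_dvd (by norm_num) hdvd
    by_contra! hlt
    have h3 : Module.finrank k K = 3 := by omega
    rw [h3] at hdvd
    omega
  let z : K := ⟨y, Algebra.self_mem_adjoin_singleton k y⟩
  have hdep : ¬ LinearIndependent k ![1, z, z * z] := fun h ↦ by
    simpa using h.fintype_card_le_finrank.trans hK
  obtain ⟨g, hg, hg0⟩ := Fintype.not_linearIndependent_iff.mp hdep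
  have hg' : algebraMap k D (g 0) + g 1 • y + g 2 • (y * y) = 0 := by
    simpa [Fin.sum_univ_three, z, Algebra.algebraMap_eq_smul_one] using
      congrArg (Subtype.val : K → D) hg
  have h2 : g 2 ≠ 0 := by
    intro h2
    rw [h2, zero_smul, add_zero] at hg'
    by_cases h1 : g 1 = 0
    · rw [h1, zero_smul, add_zero, map_eq_zero] at hg'
      obtain ⟨i, hi⟩ := hg0
      fin_cases i <;> simp_all
    · refine hy (Algebra.mem_bot.mpr ⟨(g 1)⁻¹ * -g 0, ?_⟩)
      rw [map_mul, map_neg, neg_eq_of_add_eq_zero_right hg', ← Algebra.smul_def, smul_smul,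
        inv_mul_cancel₀ h1, one_smul]
  refine ⟨(g 2)⁻¹ * -g 0, (g 2)⁻¹ * -g 1, ?_⟩
  rw [map_mul, ← Algebra.smul_def, mul_smul, ← smul_add, eq_inv_smul_iff₀ h2, map_neg, neg_smul,
    ← neg_add]
  exact (neg_eq_of_add_eq_zero_right hg').symm

open Quaternion in
/-- A central division algebra of dimension four is a quaternion algebra. -/
theorem DivisionRing.exists_algEquiv_quaternion {k D : Type*} [Field k]
    [DivisionRing D] [Algebra k D] [FiniteDimensional k D] [Algebra.IsCentral k D]
    (h2 : (2 : k) ≠ 0) (hD : Module.finrank k D = 4) :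
    ∃ a b : k, a ≠ 0 ∧ b ≠ 0 ∧ Nonempty (D ≃ₐ[k] ℍ[k, a, b]) := by
  have hsub : ∃ x : D, x ∉ (⊥ : Subalgebra k D) := by
    by_contra! hbot
    have := Subalgebra.bot_eq_top_iff_finrank_eq_one.mp (eq_top_iff.mpr fun x _ ↦ hbot x)
    omega
  obtain ⟨i, a, hi, hia⟩ : ∃ (i : D) (a : k), i ∉ (⊥ : Subalgebra k D) ∧
      i * i = algebraMap k D a := by
    obtain ⟨x, hx⟩ := hsub
    obtain ⟨p, q, hpq⟩ := exists_mul_self_eq_of_finrank_eq_four hD x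
    refine ⟨x - algebraMap k D (q / 2), p + (q / 2) * (q / 2), fun h ↦ hx ?_, ?_⟩
    · simpa using add_mem h (algebraMap_mem ⊥ (q / 2))
    · have hq : q • x = algebraMap k D (q / 2) * x + algebraMap k D (q / 2) * x := by
        rw [← add_mul, ← map_add, ← Algebra.smul_def, ← mul_two, div_mul_cancel₀ q h2]
      rw [sub_mul, mul_sub, mul_sub, hpq, hq, map_add, map_mul, ← Algebra.commutes _ x]
      abel
  have ha : a ≠ 0 := fun h0 ↦ hi (by
    rw [h0, map_zero, mul_self_eq_zero] at hia
    exact hia ▸ zero_mem _)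
  obtain ⟨c, hc⟩ : ∃ c : D, c * i ≠ i * c := by
    by_contra! h
    refine hi ?_
    rwa [← Algebra.IsCentral.center_eq_bot k D, Subalgebra.mem_center_iff]
  obtain ⟨j, hj0, hji⟩ : ∃ j : D, j ≠ 0 ∧ j * i = -(i * j) := by
    refine ⟨i * c - c * i, sub_ne_zero.mpr hc.symm, ?_⟩
    rw [sub_mul, mul_sub, mul_assoc c, hia, ← mul_assoc i i, hia, Algebra.commutes, mul_assoc]
    abel
  obtain ⟨b, q, hj⟩ := exists_mul_self_eq_of_finrank_eq_four hD j
  have hjji : j * j * i = i * (j * j) := by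
    rw [mul_assoc, hji, mul_neg, ← mul_assoc, hji, neg_mul, neg_neg, mul_assoc]
  have hq : q = 0 := by
    rw [hj, add_mul, mul_add, Algebra.commutes, add_right_inj, smul_mul_assoc, hji,
      mul_smul_comm, smul_neg, neg_eq_iff_add_eq_zero, ← two_smul k, smul_smul, smul_eq_zero,
      mul_eq_zero] at hjji
    have hi0 : i ≠ 0 := fun h ↦ hi (h ▸ zero_mem _)
    simpa [h2, hi0, hj0] using hjji
  rw [hq, zero_smul, add_zero] at hj
  have hb : b ≠ 0 := fun h0 ↦ hj0 (by rwa [h0, map_zero, mul_self_eq_zero] at hj)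
  exact ⟨a, b, ha, hb, QuaternionAlgebra.Basis.nonempty_algEquiv h2 ha hb
    { i := i
      j := j
      k := i * j
      i_mul_i := by rw [hia, zero_smul, add_zero, Algebra.algebraMap_eq_smul_one]
      j_mul_j := by rw [hj, Algebra.algebraMap_eq_smul_one]
      i_mul_j := rfl
      j_mul_i := by rw [hji, zero_smul, zero_sub] } hD⟩

open Quaternion in
/-- Let `k` be a field of characteristic different from 2, `n` odd, and `A` a
central simple `k`-algebra of degree `2n` (i.e. `dim_k A = 4n² = (2n)²`) admitting an involution
of the first kind.  Then there are `a b ∈ k*` with `A ≅ Mₙ(Q)` as `k`-algebras, where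
`Q = (a,b)_k` is the quaternion algebra with `i² = a`, `j² = b`, `ji = -ij`. -/
theorem odd_degree_symplectic_first_kind_involution_matrix_quaternion
    (k : Type) [Field k] (h2 : (2 : k) ≠ 0)
    (A : Type) [Ring A] [Algebra k A] [FiniteDimensional k A]
    (hcenter : Subalgebra.center k A = ⊥)
    (hsimple : IsSimpleRing A)
    (n : ℕ) (hn : Odd n)
    (hdim : Module.finrank k A = (2 * n) ^ 2)
    (τ : A →ₗ[k] A)
    (hτmul : ∀ x y : A, τ (x * y) = τ y * τ x)
    (hτinvol : ∀ x : A, τ (τ x) = x) :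
    ∃ a b : k, a ≠ 0 ∧ b ≠ 0 ∧
      Nonempty (A ≃ₐ[k] Matrix (Fin n) (Fin n) ℍ[k, a, b]) := by
  have : Algebra.IsCentral k A := ⟨hcenter.le⟩
  have hτ : τ.IsAlgInvolution := ⟨hτmul, hτinvol⟩
  obtain ⟨r, hr, D, _, _, _, _, ⟨e⟩⟩ :=
    IsSimpleRing.exists_algEquiv_matrix_central_divisionRing k A
  obtain ⟨d, -, -, -, hd0, -, -, hd, -⟩ := IsSimpleRing.exists_galois_algHom_matrix k D
  obtain ⟨σ, hσ⟩ := (hτ.conj e).exists_of_matrix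
  have hrd : 2 * n = r * d := by
    refine Nat.pow_left_injective two_ne_zero ?_
    have := e.toLinearEquiv.finrank_eq
    rw [hdim, Module.finrank_matrix, hd, Fintype.card_fin] at this
    simp only [this]
    ring
  have hpow : d = 2 ^ d.primeFactorsList.length :=
    Nat.eq_prime_pow_of_unique_prime_dvd hd0 fun hp hpd ↦ hσ.eq_two_of_prime_dvd h2 hd hp hpd
  obtain rfl | rfl : d = 1 ∨ d = 2 := by
    rcases h : d.primeFactorsList.length with - | - | m
    · exact .inl (by simpa [h] using hpow)
    · exact .inr (by simpa [h] using hpow)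
    · rw [h, pow_succ, pow_succ, mul_assoc] at hpow
      obtain ⟨l, rfl⟩ := hn
      exfalso
      have : 4 ∣ 2 * (2 * l + 1) := hrd ▸ hpow ▸ ⟨r * 2 ^ m, by ring⟩
      omega
  · obtain rfl : n * 2 = r := by omega
    let ε : k ≃ₐ[k] D := AlgEquiv.ofBijective (Algebra.ofId k D)
      (Algebra.finrank_eq_one_iff_bijective_algebraMap.mp (by simpa using hd))
    obtain ⟨q⟩ := Matrix.nonempty_algEquiv_quaternion h2
    exact ⟨1, 1, one_ne_zero, one_ne_zero,
      ⟨e.trans <| ε.symm.mapMatrix.trans <|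
        (Matrix.reindexAlgEquiv k k finProdFinEquiv.symm).trans <|
        (Matrix.compAlgEquiv (Fin n) (Fin 2) k k).symm.trans q.mapMatrix⟩⟩
  · obtain rfl : n = r := by omega
    obtain ⟨a, b, ha, hb, ⟨q⟩⟩ := DivisionRing.exists_algEquiv_quaternion h2 hd
    exact ⟨a, b, ha, hb, ⟨e.trans q.mapMatrix⟩⟩
end

section
/- Let k be a field of characteristic different from 2, let K/k be a separable quadratic field extension with nontrivial k-automorphism ι, and let A be a central simple K-algebra of odd degree n (dim_K A = n²) equipped with a unitary involution over k. Then there exists a finite field extension L/k of odd degree such that A ⊗_k L is isomorphic as a ring to the matrix algebra Mₙ(K ⊗_k L). (Since [L : k] is odd and [K : k] = 2, the ring K ⊗_k L is a field.) -/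
section

open Module IntermediateField TensorProduct

/-- A central simple algebra stays simple under extension of scalars to a field. -/
theorem isSimpleRing_tensorProduct (K C A : Type*) [Field K] [Field C] [Algebra K C] [Ring A]
    [Algebra K A] [IsSimpleRing A] [Algebra.IsCentral K A] : IsSimpleRing (C ⊗[K] A) := by
  classical
  let b := Module.Basis.ofVectorSpace K C
  let e := TensorProduct.equivFinsuppOfBasisLeft (N := A) b
  have he_tmul (c : C) (a : A) (i) : e (c ⊗ₜ a) i = b.repr c i • a := by simp [e]
  have he_left (a : A) (y : C ⊗[K] A) (i) : e ((1 ⊗ₜ a) * y) i = a * e y i := by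
    induction y with
    | zero => simp
    | add y z hy hz => simp [mul_add, hy, hz]
    | tmul c a' => simp [he_tmul]
  have he_right (a : A) (y : C ⊗[K] A) (i) : e (y * (1 ⊗ₜ a)) i = e y i * a := by
    induction y with
    | zero => simp
    | add y z hy hz => simp [add_mul, hy, hz]
    | tmul c a' => simp [he_tmul]
  have key (I : TwoSidedIdeal (C ⊗[K] A)) (N : ℕ) :
      ∀ x ∈ I, x ≠ 0 → (e x).support.card = N → I = ⊤ := by
    induction N using Nat.strong_induction_on with
    | _ N ih =>
    intro x hxI hx0 hN
    obtain ⟨i₀, hi₀⟩ : (e x).support.Nonempty := by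
      rw [Finsupp.support_nonempty_iff]; simpa using hx0
    let J : TwoSidedIdeal A := .mk' {a | ∃ y ∈ I, e y i₀ = a ∧ (e y).support ⊆ (e x).support}
      ⟨0, I.zero_mem, by simp, by simp⟩
      (by
        rintro _ _ ⟨y, hy, rfl, hys⟩ ⟨z, hz, rfl, hzs⟩
        exact ⟨y + z, I.add_mem hy hz, by simp, by
          rw [map_add]; exact Finsupp.support_add.trans (Finset.union_subset hys hzs)⟩)
      (by
        rintro _ ⟨y, hy, rfl, hys⟩
        exact ⟨-y, I.neg_mem hy, by simp, by rw [map_neg, Finsupp.support_neg]; exact hys⟩)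
      (by
        rintro a _ ⟨y, hy, rfl, hys⟩
        refine ⟨(1 ⊗ₜ a) * y, I.mul_mem_left _ _ hy, he_left .., fun i hi ↦ hys ?_⟩
        rw [Finsupp.mem_support_iff, he_left] at hi
        exact Finsupp.mem_support_iff.2 (right_ne_zero_of_mul hi))
      (by
        rintro _ a ⟨y, hy, rfl, hys⟩
        refine ⟨y * (1 ⊗ₜ a), I.mul_mem_right _ _ hy, he_right .., fun i hi ↦ hys ?_⟩
        rw [Finsupp.mem_support_iff, he_right] at hi
        exact Finsupp.mem_support_iff.2 (left_ne_zero_of_mul hi))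
    have hJ : (1 : A) ∈ J := by
      have hmem : e x i₀ ∈ J :=
        (TwoSidedIdeal.mem_mk' ..).2 ⟨x, hxI, rfl, Finset.Subset.refl _⟩
      have : J = ⊤ := (eq_bot_or_eq_top J).resolve_left fun h ↦ by
        rw [h, TwoSidedIdeal.mem_bot] at hmem
        exact Finsupp.mem_support_iff.1 hi₀ hmem
      rw [this]; trivial
    obtain ⟨y, hyI, hy1, hys⟩ := (TwoSidedIdeal.mem_mk' ..).1 hJ
    by_cases hcomm : ∀ a : A, (1 ⊗ₜ a) * y - y * (1 ⊗ₜ a) = 0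
    · have hcoef (i) : ∃ c : K, algebraMap K A c = e y i := by
        have : e y i ∈ Subalgebra.center K A := by
          rw [Subalgebra.mem_center_iff]
          intro a
          rw [← he_left, ← he_right, sub_eq_zero.1 (hcomm a)]
        simpa [Algebra.mem_bot] using Algebra.IsCentral.out this
      choose c hc using hcoef
      obtain ⟨d, hd⟩ : ∃ d : C, y = d ⊗ₜ 1 := by
        refine ⟨∑ i ∈ (e y).support, c i • b i, ?_⟩
        rw [TensorProduct.sum_tmul]
        conv_lhs => rw [← e.symm_apply_apply y]
        rw [TensorProduct.equivFinsuppOfBasisLeft_symm_apply]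
        refine Finset.sum_congr rfl fun i _ ↦ ?_
        rw [TensorProduct.smul_tmul, ← hc, Algebra.algebraMap_eq_smul_one]
      have hd0 : d ≠ 0 := by
        rintro rfl
        rw [hd] at hy1
        simp at hy1
      rw [← TwoSidedIdeal.one_mem_iff]
      have := I.mul_mem_left (d⁻¹ ⊗ₜ 1) _ hyI
      rwa [hd, Algebra.TensorProduct.tmul_mul_tmul, inv_mul_cancel₀ hd0, one_mul] at this
    · push Not at hcomm
      obtain ⟨a, ha⟩ := hcomm
      refine ih _ ?_ _ (I.sub_mem (I.mul_mem_left _ _ hyI) (I.mul_mem_right _ _ hyI)) ha rfl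
      rw [← hN]
      refine Finset.card_lt_card ⟨fun i hi ↦ hys ?_, fun h ↦ ?_⟩
      · rw [Finsupp.mem_support_iff, map_sub, Finsupp.sub_apply, he_left, he_right] at hi
        refine Finsupp.mem_support_iff.2 fun h0 ↦ hi (by simp [h0])
      · have := h hi₀
        rw [Finsupp.mem_support_iff, map_sub, Finsupp.sub_apply, he_left, he_right] at this
        simp [hy1] at this
  refine ⟨⟨fun I ↦ ?_⟩⟩
  by_cases h : ∃ x ∈ I, x ≠ 0
  · obtain ⟨x, hx, hx0⟩ := h
    exact .inr (key I _ x hx hx0 rfl)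
  · push Not at h
    exact .inl (le_bot_iff.1 fun x hx ↦ (TwoSidedIdeal.mem_bot _).2 (h x hx))

/-- A simple algebra of dimension `n ^ 2` over `F` having a module of `F`-dimension `n * m`
with `m` prime to `n` is a matrix algebra over `F`. -/
theorem nonempty_algEquiv_matrix_of_coprime (F B V : Type*) [Field F] [Ring B] [Algebra F B]
    [IsSimpleRing B] [FiniteDimensional F B] [AddCommGroup V] [Module F V] [Module B V]
    [IsScalarTower F B V] [FiniteDimensional F V] {n m : ℕ} (hB : finrank F B = n ^ 2)
    (hV : finrank F V = n * m) (hnm : n.Coprime m) :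
    Nonempty (B ≃ₐ[F] Matrix (Fin n) (Fin n) F) := by
  classical
  have hn : 0 < n := by
    have : 0 < n ^ 2 := hB ▸ finrank_pos
    exact Nat.pos_of_ne_zero (by rintro rfl; simp at this)
  have := IsArtinianRing.of_finite F B
  obtain ⟨r, hr, S, hS, ⟨e⟩⟩ := (IsSimpleRing.isIsotypic B B).linearEquiv_fun
  have hSV : IsIsotypicOfType B V S := by
    let f : S →ₗ[B] V × B := (LinearMap.inr B V B).comp S.subtype
    have hf : Function.Injective f := LinearMap.inr_injective.comp S.subtype_injective
    let g := LinearEquiv.ofInjective f hf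
    have : IsSimpleModule B (LinearMap.range f) := .congr g.symm
    exact ((IsSimpleRing.isIsotypic B (V × B) (LinearMap.range f)).of_injective
      (LinearMap.inl B V B) LinearMap.inl_injective).of_linearEquiv_type g.symm
  have : Module.Finite B V := .of_restrictScalars_finite F B V
  obtain ⟨t, ⟨e'⟩⟩ := hSV.linearEquiv_fun
  have hrS : n ^ 2 = r * finrank F S := by
    rw [← hB, (e.restrictScalars F).finrank_eq, finrank_pi_fintype]; simp
  have htS : n * m = t * finrank F S := by
    rw [← hV, (e'.restrictScalars F).finrank_eq, finrank_pi_fintype]; simp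
  let φ : B ≃ₐ[F] Matrix (Fin r) (Fin r) (Module.End B S)ᵐᵒᵖ :=
    .trans (.opOp F B) <| .trans (.op <|
      .trans (.moduleEndSelf F) <| .trans (e.conjAlgEquiv F) (endVecAlgEquivMatrixEnd ..))
        (.symm .mopMatrix)
  have hrd : n ^ 2 = r * r * finrank F (Module.End B S)ᵐᵒᵖ := by
    rw [← hB, φ.toLinearEquiv.finrank_eq, finrank_matrix]; simp
  have hS0 : 0 < finrank F S := Nat.pos_of_ne_zero fun h ↦ by
    rw [h, mul_zero] at hrS
    exact (pow_pos hn 2).ne' hrS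
  have hrm : r * m = t * n := by
    apply Nat.eq_of_mul_eq_mul_left (Nat.mul_pos hn hS0)
    calc n * finrank F S * (r * m) = (n * m) * (r * finrank F S) := by ring
      _ = (t * finrank F S) * n ^ 2 := by rw [htS, hrS]
      _ = _ := by ring
  obtain ⟨c, hc⟩ : n ∣ r := hnm.dvd_of_dvd_mul_right (hrm ▸ dvd_mul_left n t)
  have hcd : c * c * finrank F (Module.End B S)ᵐᵒᵖ = 1 := by
    apply Nat.eq_of_mul_eq_mul_left (pow_pos hn 2)
    rw [hc] at hrd
    linarith
  have hd : finrank F (Module.End B S)ᵐᵒᵖ = 1 := Nat.eq_one_of_mul_eq_one_left hcd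
  obtain rfl : r = n := by
    rw [hc, Nat.eq_one_of_mul_eq_one_left (Nat.eq_one_of_mul_eq_one_right hcd), mul_one]
  have hbij : Function.Bijective (algebraMap F (Module.End B S)ᵐᵒᵖ) :=
    ⟨(algebraMap F _).injective, by
      have := Module.finite_of_finrank_eq_succ hd
      have h := Subalgebra.bot_eq_top_iff_finrank_eq_one.2 hd
      intro x
      exact Algebra.mem_bot.1 (h ▸ Algebra.mem_top)⟩
  exact ⟨φ.trans (.mapMatrix (.symm (.ofBijective (Algebra.ofId F _) hbij)))⟩

/-- In characteristic different from `2`, a finite normal extension is an extension of `2`-power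
degree of an extension of odd degree. -/
theorem exists_intermediateField_odd_finrank (k E : Type*) [Field k] [Field E] [Algebra k E]
    [FiniteDimensional k E] [Normal k E] (h2 : (2 : k) ≠ 0) :
    ∃ L : IntermediateField k E, Odd (finrank k L) ∧ ∃ a, finrank L E = 2 ^ a := by
  classical
  obtain ⟨P⟩ : Nonempty (Sylow 2 Gal(E/k)) := inferInstance
  have hP := finrank_fixedField_eq_card (P : Subgroup Gal(E/k))
  refine ⟨fixedField (P : Subgroup Gal(E/k)), ?_, ?_⟩
  · have hcard : Field.finSepDegree k E = Nat.card Gal(E/k) :=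
      Nat.card_congr (Normal.algHomEquivAut k (AlgebraicClosure E) E)
    obtain ⟨q, hq⟩ := ExpChar.exists k
    obtain ⟨s, hs⟩ := finInsepDegree_eq_pow k E q
    have h1 := Field.finSepDegree_mul_finInsepDegree k E
    have h3 := finrank_mul_finrank k (fixedField (P : Subgroup Gal(E/k))) E
    have h4 := (P : Subgroup Gal(E/k)).index_mul_card
    have hodd : Odd q := by
      rcases hq with _ | hp
      · exact odd_one
      · refine hp.odd_of_ne_two ?_
        rintro rfl
        exact h2 (CharTwo.two_eq_zero (R := k))
    have : finrank k (fixedField (P : Subgroup Gal(E/k))) = (P : Subgroup Gal(E/k)).index * q ^ s := by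
      apply Nat.eq_of_mul_eq_mul_right (Nat.card_pos (α := P))
      rw [← hP, h3, ← h1, hcard, ← h4, hs, hP]
      ring
    rw [this]
    refine Odd.mul ?_ hodd.pow
    rw [← Nat.not_even_iff_odd, even_iff_two_dvd]
    exact P.not_dvd_index
  · rw [hP]
    exact (IsPGroup.iff_card.1 P.isPGroup')

/-- A central simple `K`-algebra of dimension `n ^ 2` maps to `n × n` matrices over some finite
normal extension of a given subfield `k` of `K`. -/
theorem exists_algHom_matrix_normal (k K A : Type*) [Field k] [Field K] [Algebra k K]
    [FiniteDimensional k K] [Ring A] [Algebra K A] [IsSimpleRing A] [Algebra.IsCentral K A]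
    [FiniteDimensional K A] {n : ℕ} (hA : finrank K A = n ^ 2) :
    ∃ (E : IntermediateField k (AlgebraicClosure K)) (i : K →ₐ[k] E)
      (f : A →+* Matrix (Fin n) (Fin n) E), FiniteDimensional k E ∧ Normal k E ∧
      ∀ (c : K) (a : A), f (c • a) = i c • f a := by
  classical
  let Ω := AlgebraicClosure K
  have := isSimpleRing_tensorProduct K Ω A
  obtain ⟨m, _, ⟨g⟩⟩ := IsSimpleRing.exists_algEquiv_matrix_of_isAlgClosed Ω (Ω ⊗[K] A)
  obtain rfl : m = n := by
    have h := g.toLinearEquiv.finrank_eq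
    rw [finrank_baseChange, hA, finrank_matrix, finrank_self] at h
    simp only [Fintype.card_fin, mul_one, ← sq] at h
    exact (Nat.pow_left_injective two_ne_zero h).symm
  let φ : A →ₐ[K] Matrix (Fin m) (Fin m) Ω :=
    (g.toAlgHom.restrictScalars K).comp Algebra.TensorProduct.includeRight
  let b := finBasis K A
  let c := finBasis k K
  let S : Set Ω := Set.range (fun i ↦ algebraMap K Ω (c i)) ∪
    Set.range (fun p : Fin (finrank K A) × Fin m × Fin m ↦ φ (b p.1) p.2.1 p.2.2)
  have hS : S.Finite := (Set.finite_range _).union (Set.finite_range _)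
  have : Algebra.IsAlgebraic k Ω := Algebra.IsAlgebraic.trans k K Ω
  have : FiniteDimensional k (adjoin k S) := by
    have := hS.to_subtype
    exact finiteDimensional_adjoin fun x _ ↦ Algebra.IsIntegral.isIntegral x
  let E : IntermediateField k Ω := normalClosure k (adjoin k S) Ω
  have : FiniteDimensional k E := normalClosure.is_finiteDimensional k _ Ω
  have : Normal k E := normalClosure.normal k _ Ω
  have hSE : S ⊆ E := fun x hx ↦ le_normalClosure (adjoin k S) (subset_adjoin k S hx)
  have hK (x : K) : algebraMap K Ω x ∈ E := by
    rw [← c.sum_repr x, map_sum]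
    refine sum_mem fun i _ ↦ ?_
    rw [Algebra.smul_def, map_mul, ← IsScalarTower.algebraMap_apply]
    exact mul_mem (E.algebraMap_mem _) (hSE (.inl ⟨i, rfl⟩))
  have hφ (a : A) (i j) : φ a i j ∈ E := by
    rw [← b.sum_repr a, map_sum, Matrix.sum_apply]
    refine sum_mem fun l _ ↦ ?_
    rw [map_smul, Matrix.smul_apply, Algebra.smul_def]
    exact mul_mem (hK _) (hSE (.inr ⟨(l, i, j), rfl⟩))
  refine ⟨E, (IsScalarTower.toAlgHom k K Ω).codRestrict E.toSubalgebra hK,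
    { toFun a := .of fun i j ↦ ⟨φ a i j, hφ a i j⟩
      map_one' := ?_
      map_mul' x y := ?_
      map_zero' := ?_
      map_add' x y := ?_ }, inferInstance, inferInstance, fun x a ↦ ?_⟩
  · ext i j
    simp [Matrix.one_apply, apply_ite]
  · ext i j
    simp [Matrix.mul_apply]
  · ext i j
    simp
  · ext i j
    simp
  · ext i j
    change φ (x • a) i j = algebraMap K Ω x * φ a i j
    rw [map_smul, Matrix.smul_apply, Algebra.smul_def]

/-- If `A` is represented by matrices over an extension `E` of `M`, of degree coprime to the degree
of `A`, then `A` is split by `M`. -/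
theorem nonempty_baseChange_algEquiv_matrix (K M E A : Type*) [Field K] [Field M] [Field E]
    [Algebra K M] [Algebra K E] [Algebra M E] [IsScalarTower K M E] [FiniteDimensional M E]
    [Ring A] [Algebra K A] [IsSimpleRing A] [Algebra.IsCentral K A]
    [FiniteDimensional K A] {n : ℕ} (hA : finrank K A = n ^ 2)
    (f : A →ₐ[K] Matrix (Fin n) (Fin n) E) (hn : n.Coprime (finrank M E)) :
    Nonempty (M ⊗[K] A ≃ₐ[M] Matrix (Fin n) (Fin n) M) := by
  have := isSimpleRing_tensorProduct K M A
  let g : M ⊗[K] A →ₐ[M] Module.End E (Fin n → E) :=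
    (Matrix.toLinAlgEquiv'.toAlgHom.restrictScalars M).comp
      (Algebra.TensorProduct.lift (Algebra.ofId M _) f fun m a ↦ Algebra.commutes m (f a))
  let : Module (M ⊗[K] A) (Fin n → E) := Module.compHom _ g.toRingHom
  have : IsScalarTower M (M ⊗[K] A) (Fin n → E) :=
    ⟨fun m b v ↦ DFunLike.congr_fun (map_smul g m b) v⟩
  refine nonempty_algEquiv_matrix_of_coprime M (M ⊗[K] A) (Fin n → E) ?_ ?_ hn
  · rw [finrank_baseChange, hA]
  · rw [finrank_pi_fintype]; simp

/-- For an algebra `A` over a commutative `k`-algebra `K`, extending scalars from `k` to `L` agrees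
with extending scalars from `K` to `K ⊗[k] L`. -/
noncomputable def tensorProductRingEquivBaseChange (k K A L : Type*) [CommRing k] [CommRing K]
    [CommRing L] [Algebra k K] [Algebra k L] [Ring A] [Algebra K A] [Algebra k A]
    [IsScalarTower k K A] : A ⊗[k] L ≃+* (K ⊗[k] L) ⊗[K] A :=
  let e : A ⊗[k] L ≃ₐ[K] A ⊗[K] (K ⊗[k] L) :=
    Algebra.TensorProduct.algEquivOfLinearEquivTensorProduct
      (AlgebraTensorModule.cancelBaseChange k K K A L).symm (fun _ _ _ _ ↦ by simp)
      (by simp [Algebra.TensorProduct.one_def])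
  (e.trans (Algebra.TensorProduct.comm K A (K ⊗[k] L))).toRingEquiv

/-- If `A` is represented by matrices over an extension `E` of `K`, then it is split by any
subfield `L` of `E` of degree prime to that of `K`, provided `[E : L]` is prime to the degree
of `A`. -/
theorem nonempty_tensorProduct_ringEquiv_matrix (k K E A : Type*) [Field k] [Field K] [Field E]
    [Algebra k K] [Algebra k E] [Algebra K E] [IsScalarTower k K E] [FiniteDimensional k E]
    [Ring A] [Algebra K A] [Algebra k A] [IsScalarTower k K A] [IsSimpleRing A]
    [Algebra.IsCentral K A] [FiniteDimensional K A] {n : ℕ} (hA : finrank K A = n ^ 2)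
    (f : A →ₐ[K] Matrix (Fin n) (Fin n) E) (L : IntermediateField k E)
    (hKL : (finrank k K).Coprime (finrank k L)) (hn : n.Coprime (finrank L E)) :
    Nonempty (A ⊗[k] L ≃+* Matrix (Fin n) (Fin n) (K ⊗[k] L)) := by
  have : FiniteDimensional k K := .left k K E
  have : IsDomain (K ⊗[k] L) := by
    refine LinearDisjoint.isDomain' (fa := IsScalarTower.toAlgHom k K E) (fb := L.val) ?_
    refine LinearDisjoint.of_finrank_coprime ?_
    convert hKL using 1
    · exact (AlgEquiv.ofInjectiveField (IsScalarTower.toAlgHom k K E)).toLinearEquiv.finrank_eq.symm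
    · exact (AlgEquiv.ofInjectiveField L.val).toLinearEquiv.finrank_eq.symm
  let : Field (K ⊗[k] L) :=
    (Algebra.TensorProduct.isField_of_isAlgebraic k K L (.inl inferInstance)).toField
  let φ : K ⊗[k] L →ₐ[K] E :=
    Algebra.TensorProduct.lift (Algebra.ofId K E) L.val fun _ _ ↦ .all _ _
  let : Algebra (K ⊗[k] L) E := φ.toRingHom.toAlgebra
  have : IsScalarTower K (K ⊗[k] L) E := ⟨fun c x y ↦ by
    change φ (c • x) * y = c • (φ x * y)
    rw [map_smul, smul_mul_assoc]⟩
  have : IsScalarTower k (K ⊗[k] L) E := ⟨fun c x y ↦ by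
    change φ (c • x) * y = c • (φ x * y)
    rw [φ.map_smul_of_tower, smul_mul_assoc]⟩
  have : FiniteDimensional (K ⊗[k] L) E := .right k _ _
  have : Module.Free (K ⊗[k] L) E := .of_divisionRing _ _
  have hdvd : finrank (K ⊗[k] L) E ∣ finrank L E := by
    refine ⟨finrank k K, ?_⟩
    have h1 := finrank_mul_finrank k (K ⊗[k] L) E
    rw [finrank_tensorProduct] at h1
    have h2 := finrank_mul_finrank k L E
    apply Nat.eq_of_mul_eq_mul_left (finrank_pos (R := k) (M := L))
    rw [h2, ← h1]
    ring
  obtain ⟨g⟩ := nonempty_baseChange_algEquiv_matrix K (K ⊗[k] L) E A hA f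
    (hn.coprime_dvd_right hdvd)
  exact ⟨(tensorProductRingEquivBaseChange k K A L).trans g.toRingEquiv⟩

end

open TensorProduct in
/-- Let `k` be a field of characteristic ≠ 2, `K/k` a separable quadratic field
extension with nontrivial `k`-automorphism `ι`, and `A` a central simple `K`-algebra of odd
degree `n` equipped with a unitary involution over `k` (an additive anti-automorphism `τ` with
`τ ∘ τ = id` and `τ (c • x) = ι c • τ x`).  Then there is a finite field extension `L/k` of odd
degree such that `A ⊗_k L ≅ Mₙ(K ⊗_k L)` as rings. -/
theorem unitary_involution_odd_degree_split_after_odd_extension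
    (k K : Type) [Field k] [Field K] [Algebra k K] (h2 : (2 : k) ≠ 0)
    [Algebra.IsSeparable k K] (hK2 : Module.finrank k K = 2)
    (ι : K ≃ₐ[k] K) (hι : ι ≠ AlgEquiv.refl)
    (A : Type) [Ring A] [Algebra K A] [Algebra k A] [IsScalarTower k K A]
    [FiniteDimensional K A]
    (hcenter : Subalgebra.center K A = ⊥)
    (hsimple : IsSimpleRing A)
    (n : ℕ) (hn : Odd n)
    (hdim : Module.finrank K A = n ^ 2)
    (τ : A →+ A)
    (hτmul : ∀ x y : A, τ (x * y) = τ y * τ x)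
    (hτinvol : ∀ x : A, τ (τ x) = x)
    (hτsemilinear : ∀ (c : K) (x : A), τ (c • x) = ι c • τ x) :
    ∃ (L : Type) (_ : Field L) (_ : Algebra k L),
      FiniteDimensional k L ∧ Odd (Module.finrank k L) ∧
        Nonempty ((A ⊗[k] L) ≃+* Matrix (Fin n) (Fin n) (K ⊗[k] L)) := by
  have : FiniteDimensional k K := .of_finrank_pos (by omega)
  have : Algebra.IsCentral K A := ⟨hcenter.le⟩
  obtain ⟨E, i, f, _, _, hf⟩ := exists_algHom_matrix_normal k K A hdim
  obtain ⟨L, hL, a, ha⟩ := exists_intermediateField_odd_finrank k E h2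
  let : Algebra K E := i.toRingHom.toAlgebra
  have : IsScalarTower k K E := .of_algebraMap_eq' i.comp_algebraMap.symm
  let f' : A →ₐ[K] Matrix (Fin n) (Fin n) E :=
    { f with
      commutes' c := by
        change f (algebraMap K A c) = _
        rw [Algebra.algebraMap_eq_smul_one, hf, map_one, Algebra.algebraMap_eq_smul_one]
        rfl }
  refine ⟨L, inferInstance, inferInstance, inferInstance, hL,
    nonempty_tensorProduct_ringEquiv_matrix k K E A hdim f' L ?_ ?_⟩
  · rw [hK2]
    exact hL.coprime_two_left
  · rw [ha]
    exact (hn.coprime_two_right).pow_right a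
end

section
/- Let k be a field of characteristic different from 2, K/k a separable quadratic field extension with nontrivial k-automorphism x ↦ x̄, and let H, H' ∈ GLₙ(K) be invertible hermitian matrices. Then H and H' are congruent (H' = M̄ᵀHM for some M ∈ GLₙ(K)) if and only if the trace forms q_H and q_{H'} are isometric as quadratic forms over k. -/
open Matrix

section SkewSimilitude

open QuadraticMap

variable {k V V' : Type*} [Field k] [AddCommGroup V] [Module k V] [AddCommGroup V'] [Module k V']

theorem QuadraticMap.map_sub_polar (q : QuadraticForm k V) (x y : V) :
    q (x - y) = q x + q y - polar q x y := by
  rw [sub_eq_add_neg, QuadraticMap.map_add q, QuadraticMap.map_neg, polar_neg_right]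
  ring

theorem QuadraticMap.map_sub_polar_div_smul (q : QuadraticForm k V) {u : V} (hu : q u ≠ 0)
    (y : V) : q (y - (polar q u y / q u) • u) = q y := by
  rw [map_sub_polar, QuadraticMap.map_smul, polar_smul_right, polar_comm q y u, smul_eq_mul,
    smul_eq_mul]
  field_simp
  ring

/-- The reflection in a vector `u`, meaningful when `q u ≠ 0`. -/
noncomputable def QuadraticMap.reflectionMap (q : QuadraticForm k V) (u : V) : V →ₗ[k] V :=
  LinearMap.id - (((q u)⁻¹ • q.polarBilin u).smulRight u)

theorem QuadraticMap.reflectionMap_apply (q : QuadraticForm k V) (u y : V) :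
    q.reflectionMap u y = y - (polar q u y / q u) • u := by
  simp [reflectionMap, div_eq_inv_mul]

theorem QuadraticMap.polar_apply_left_of_skew (q : QuadraticForm k V) {J : V →ₗ[k] V} {d : k}
    (hd : d ≠ 0) (hJ : ∀ x, J (J x) = d • x) (hq : ∀ x, q (J x) = -d * q x) (x y : V) :
    polar q (J x) y = -polar q x (J y) := by
  have h : polar q (J x) (J (J y)) = -d * polar q x (J y) := by
    simp only [polar, ← map_add, hq]
    ring
  rw [hJ, polar_smul_right, smul_eq_mul] at h
  exact mul_left_cancel₀ hd (by rw [h]; ring)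

theorem QuadraticMap.polar_apply_self_of_skew (q : QuadraticForm k V) (h2 : (2 : k) ≠ 0)
    {J : V →ₗ[k] V} {d : k} (hd : d ≠ 0) (hJ : ∀ x, J (J x) = d • x)
    (hq : ∀ x, q (J x) = -d * q x) (x : V) : polar q (J x) x = 0 := by
  have h := polar_apply_left_of_skew q hd hJ hq x x
  rw [polar_comm q x] at h
  exact (mul_eq_zero.1 (by linear_combination h : (2 : k) * polar q (J x) x = 0)).resolve_left h2

/-- If `J` and `J'` square to the scalar `d` and multiply the quadratic forms `q` and `q'` by `-d`,
then the existence of an isometric map from `q` to `q'` implies the existence of one that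
intertwines `J` and `J'`. -/
theorem QuadraticMap.exists_isometry_comm [FiniteDimensional k V] (h2 : (2 : k) ≠ 0)
    {q : QuadraticForm k V} {q' : QuadraticForm k V'} {J : V →ₗ[k] V} {J' : V' →ₗ[k] V'} {d : k}
    (hd : d ≠ 0) (hJ : ∀ x, J (J x) = d • x) (hJ' : ∀ x, J' (J' x) = d • x)
    (hq : ∀ x, q (J x) = -d * q x) (hq' : ∀ x, q' (J' x) = -d * q' x)
    (f : V →ₗ[k] V') (hf : ∀ x, q' (f x) = q x) :
    ∃ g : V →ₗ[k] V', (∀ x, q' (g x) = q x) ∧ ∀ x, g (J x) = J' (g x) := by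
  induction hU : LinearMap.ker (f ∘ₗ J - J' ∘ₗ f) using WellFoundedGT.induction generalizing f with
  | ind U ih =>
  subst hU
  by_cases hD : ∀ x, q' (f (J x) - J' (f x)) = 0
  · have hcomm : ∀ x, J' ((2 : k)⁻¹ • (f x + d⁻¹ • J' (f (J x)))) =
        (2 : k)⁻¹ • (f (J x) + J' (f x)) := fun x ↦ by
      rw [map_smul, map_add, map_smul, hJ', inv_smul_smul₀ hd, add_comm]
    refine ⟨(2 : k)⁻¹ • (f + d⁻¹ • (J' ∘ₗ f ∘ₗ J)), fun x ↦ ?_, fun x ↦ ?_⟩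
    · have h := hq' ((2 : k)⁻¹ • (f x + d⁻¹ • J' (f (J x))))
      have hx := hD x
      rw [hcomm, QuadraticMap.map_smul, QuadraticMap.map_add q', smul_eq_mul, hf, hq', hq, hf] at h
      rw [map_sub_polar, hf, hq', hq, hf, sub_eq_zero] at hx
      rw [← hx] at h
      simp only [LinearMap.smul_apply, LinearMap.add_apply, LinearMap.comp_apply]
      refine mul_left_cancel₀ (neg_ne_zero.2 hd) (h.symm.trans ?_)
      field_simp
      ring
    · simp only [LinearMap.smul_apply, LinearMap.add_apply, LinearMap.comp_apply]
      rw [hcomm, hJ, map_smul, map_smul, inv_smul_smul₀ hd]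
  · push Not at hD
    obtain ⟨x, hx⟩ := hD
    have hpolar : ∀ y z, polar q' (f y) (f z) = polar q y z := fun y z ↦ by
      simp only [polar, ← map_add, hf]
    set u := f (J x) - J' (f x) with hu
    have hu_polar : ∀ y, f (J y) = J' (f y) → polar q' u (f y) = 0 := fun y hy ↦ by
      rw [hu, polar_sub_left, hpolar, polar_apply_left_of_skew q' hd hJ' hq', ← hy, hpolar,
        polar_apply_left_of_skew q hd hJ hq]
      ring
    have hux : polar q' u (f x) = 0 := by
      rw [hu, polar_sub_left, hpolar, polar_apply_self_of_skew q h2 hd hJ hq,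
        polar_apply_self_of_skew q' h2 hd hJ' hq', sub_zero]
    have huJx : polar q' u (f (J x)) = q' u := by
      rw [hu, polar_sub_left, map_sub_polar, polar_self, polar_comm q' (J' (f x)), hf, hq', hf, hq]
      ring
    refine ih _ ?_ (q'.reflectionMap u ∘ₗ f) (fun y ↦ ?_) rfl
    · refine lt_of_le_of_ne (fun y hy ↦ ?_) fun h ↦ hx ?_
      · have hy' : f (J y) = J' (f y) := by simpa [sub_eq_zero] using hy
        have hJy : f (J (J y)) = J' (f (J y)) := by rw [hJ, map_smul, hy', hJ']
        simp only [LinearMap.mem_ker, LinearMap.sub_apply, LinearMap.comp_apply,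
          reflectionMap_apply, hu_polar y hy', hu_polar _ hJy, zero_div, zero_smul, sub_zero, ← hy',
          sub_self]
      · have hxU : x ∈ LinearMap.ker (f ∘ₗ J - J' ∘ₗ f) := by
          rw [h]
          simp only [LinearMap.mem_ker, LinearMap.sub_apply, LinearMap.comp_apply,
            reflectionMap_apply, hux, huJx, div_self hx, zero_div, zero_smul, sub_zero, one_smul]
          rw [hu, sub_sub_cancel, sub_self]
        rw [show u = 0 by simpa using hxU, QuadraticMap.map_zero]
    · rw [LinearMap.comp_apply, reflectionMap_apply, map_sub_polar_div_smul q' hx, hf]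

end SkewSimilitude

/-- A nontrivial automorphism of a quadratic extension in characteristic not two is conjugation
`a + b θ ↦ a - b θ` for a square root `θ` of an element of the base field. -/
theorem AlgEquiv.exists_sqrt_generator {k K : Type*} [Field k] [Field K] [Algebra k K]
    (h2 : (2 : k) ≠ 0) (hK2 : Module.finrank k K = 2) (σ : K ≃ₐ[k] K) (hσ : σ ≠ AlgEquiv.refl) :
    ∃ (θ : K) (d : k), θ ≠ 0 ∧ θ * θ = algebraMap k K d ∧ σ θ = -θ ∧
      ∀ c, ∃ a b : k, c = algebraMap k K a + algebraMap k K b * θ := by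
  have hc : ∃ c, σ c ≠ c := by
    by_contra! h
    exact hσ (AlgEquiv.ext h)
  obtain ⟨c, hc⟩ := hc
  have hli : LinearIndependent k ![(1 : K), c] := by
    refine LinearIndependent.pair_iff.2 fun s t hst ↦ ?_
    have ht : t = 0 := by
      by_contra ht
      have h := congrArg σ hst
      rw [map_zero, ← hst, map_add, map_smul, map_smul, map_one] at h
      exact hc (smul_right_injective K ht (add_left_cancel h))
    subst ht
    simpa using hst
  have : FiniteDimensional k K := Module.finite_of_finrank_pos (by omega)
  have hspan : ∀ x : K, ∃ a b : k, x = algebraMap k K a + algebraMap k K b * c := fun x ↦ by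
    have hx : x ∈ Submodule.span k (Set.range ![(1 : K), c]) := by
      rw [hli.span_eq_top_of_card_eq_finrank' (by simp [hK2])]
      trivial
    rw [Matrix.range_cons, Matrix.range_cons, Matrix.range_empty, Set.union_empty,
      Set.singleton_union, Submodule.mem_span_pair] at hx
    obtain ⟨a, b, rfl⟩ := hx
    exact ⟨a, b, by simp [Algebra.smul_def]⟩
  obtain ⟨r, p, hp⟩ := hspan (c * c)
  have h2K : (2 : K) ≠ 0 := by
    rw [← map_ofNat (algebraMap k K) 2]
    exact (map_ne_zero (algebraMap k K)).2 h2
  have hθ : (c - algebraMap k K (p / 2)) * (c - algebraMap k K (p / 2)) =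
      algebraMap k K (r + p * p / 4) := by
    have h4 : (4 : K) ≠ 0 := by
      rw [show (4 : K) = 2 * 2 by norm_num]
      exact mul_ne_zero h2K h2K
    simp only [map_div₀, map_add, map_mul, map_ofNat]
    field_simp
    linear_combination 16 * hp
  have hne : σ (c - algebraMap k K (p / 2)) ≠ c - algebraMap k K (p / 2) := by
    simpa using hc
  refine ⟨c - algebraMap k K (p / 2), r + p * p / 4, fun h ↦ hne (by rw [h, map_zero]), hθ, ?_,
    fun x ↦ ?_⟩
  · have h := congrArg σ hθ
    rw [AlgEquiv.commutes, ← hθ, map_mul] at h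
    exact (mul_self_eq_mul_self_iff.1 h).resolve_left hne
  · obtain ⟨a, b, rfl⟩ := hspan x
    exact ⟨a + b * (p / 2), b, by simp only [map_add, map_mul]; ring⟩

namespace Matrix

variable {k K ι : Type*} [Field k] [Field K] [Algebra k K] [Fintype ι]

/-- The sesquilinear form `(x, y) ↦ x̄ᵀ H y`. -/
def sesqForm (σ : K ≃ₐ[k] K) (H : Matrix ι ι K) (x y : ι → K) : K :=
  (σ ∘ x) ⬝ᵥ (H *ᵥ y)

variable (σ : K ≃ₐ[k] K) (H : Matrix ι ι K)

theorem sesqForm_add_left (x y z : ι → K) :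
    sesqForm σ H (x + y) z = sesqForm σ H x z + sesqForm σ H y z := by
  simp [sesqForm, dotProduct, add_mul, Finset.sum_add_distrib]

theorem sesqForm_add_right (x y z : ι → K) :
    sesqForm σ H x (y + z) = sesqForm σ H x y + sesqForm σ H x z := by
  simp [sesqForm, mulVec_add]

theorem sesqForm_smul_left (c : K) (x y : ι → K) :
    sesqForm σ H (c • x) y = σ c * sesqForm σ H x y := by
  simp [sesqForm, dotProduct, Finset.mul_sum, mul_assoc]

theorem sesqForm_smul_right (c : K) (x y : ι → K) :
    sesqForm σ H x (c • y) = c * sesqForm σ H x y := by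
  simp [sesqForm, mulVec_smul]

theorem sesqForm_single [DecidableEq ι] (i j : ι) :
    sesqForm σ H (Pi.single i 1) (Pi.single j 1) = H i j := by
  have h : σ ∘ Pi.single i (1 : K) = Pi.single i 1 := by
    ext l
    simp [Pi.single_apply, apply_ite σ]
  simp [sesqForm, h]

theorem sesqForm_mulVec (M : Matrix ι ι K) (x y : ι → K) :
    sesqForm σ H (M *ᵥ x) (M *ᵥ y) = sesqForm σ ((M.map σ)ᵀ * H * M) x y := by
  have h : σ ∘ (M *ᵥ x) = (σ ∘ x) ᵥ* (M.map σ)ᵀ := by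
    ext i
    simp [mulVec, vecMul_transpose, dotProduct]
  simp only [sesqForm, h, ← mulVec_mulVec, ← dotProduct_mulVec]

variable {σ H} in
theorem algebraMap_polar_eq_sesqForm_add {q : QuadraticForm k (ι → K)}
    (hq : ∀ x, algebraMap k K (q x) = sesqForm σ H x x) (x y : ι → K) :
    algebraMap k K (QuadraticMap.polar q x y) = sesqForm σ H x y + sesqForm σ H y x := by
  simp only [QuadraticMap.polar, map_sub, hq, sesqForm_add_left, sesqForm_add_right]
  ring

end Matrix

/-- Let `k` be a field of characteristic ≠ 2, `K/k` a separable quadratic field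
extension with nontrivial `k`-automorphism `σ` (conjugation), and `H, H'` invertible hermitian
`n × n` matrices over `K` (`(H.map σ)ᵀ = H`).  Let `q_H, q_H'` be the associated trace forms:
the `k`-quadratic forms on `Kⁿ` with `q_H x = x̄ᵀ H x ∈ k`.  Then `H` and `H'` are congruent
(`H' = M̄ᵀ H M` for some invertible `M`) iff `q_H` and `q_H'` are isometric over `k`. -/
theorem hermitian_congruent_iff_trace_forms_equivalent
    (k K : Type) [Field k] [Field K] [Algebra k K] (h2 : (2 : k) ≠ 0)
    [Algebra.IsSeparable k K] (hK2 : Module.finrank k K = 2)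
    (σ : K ≃ₐ[k] K) (hσ : σ ≠ AlgEquiv.refl)
    (n : ℕ) (H H' : Matrix (Fin n) (Fin n) K)
    (hHherm : (H.map σ)ᵀ = H) (hH'herm : (H'.map σ)ᵀ = H')
    (hHunit : IsUnit H) (hH'unit : IsUnit H')
    (qH qH' : QuadraticForm k (Fin n → K))
    (hqH : ∀ x : Fin n → K,
      algebraMap k K (qH x) = ∑ i, σ (x i) * H.mulVec x i)
    (hqH' : ∀ x : Fin n → K,
      algebraMap k K (qH' x) = ∑ i, σ (x i) * H'.mulVec x i) :
    (∃ M : Matrix (Fin n) (Fin n) K, IsUnit M ∧ H' = (M.map σ)ᵀ * H * M) ↔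
      qH.Equivalent qH' := by
  classical
  replace hqH : ∀ x, algebraMap k K (qH x) = sesqForm σ H x x := hqH
  replace hqH' : ∀ x, algebraMap k K (qH' x) = sesqForm σ H' x x := hqH'
  constructor
  · rintro ⟨M, hM, rfl⟩
    let e : (Fin n → K) ≃ₗ[K] (Fin n → K) := M.toLinearEquiv' hM.invertible
    have he : ∀ x, e x = M *ᵥ x := fun x ↦ rfl
    refine QuadraticMap.Equivalent.symm ⟨⟨e.restrictScalars k, fun x ↦ ?_⟩⟩
    apply (algebraMap k K).injective
    rw [hqH', ← sesqForm_mulVec, ← he]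
    exact hqH _
  · intro hequiv
    obtain ⟨f⟩ := hequiv.symm
    obtain ⟨θ, d, hθ, hθd, hσθ, hgen⟩ := σ.exists_sqrt_generator h2 hK2 hσ
    have hd : d ≠ 0 := by
      rintro rfl
      simp [hθ] at hθd
    let J : (Fin n → K) →ₗ[k] (Fin n → K) :=
      (LinearMap.lsmul K (Fin n → K) θ).restrictScalars k
    have hJ : ∀ x, J x = θ • x := fun x ↦ rfl
    have hJJ : ∀ x, J (J x) = d • x := fun x ↦ by
      rw [hJ, hJ, smul_smul, hθd, algebraMap_smul]
    have hJq : ∀ (A : Matrix (Fin n) (Fin n) K) (q : QuadraticForm k (Fin n → K)),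
        (∀ x, algebraMap k K (q x) = sesqForm σ A x x) → ∀ x, q (J x) = -d * q x := by
      intro A q hq x
      apply (algebraMap k K).injective
      rw [hq, hJ, sesqForm_smul_left, sesqForm_smul_right, hσθ, map_mul, map_neg, ← hθd, hq]
      ring
    have : FiniteDimensional k K := Module.finite_of_finrank_pos (by omega)
    obtain ⟨g, hg, hgJ⟩ := QuadraticMap.exists_isometry_comm h2 hd hJJ hJJ (hJq H' qH' hqH')
      (hJq H qH hqH) f.toLinearEquiv.toLinearMap f.map_app
    let gK : (Fin n → K) →ₗ[K] (Fin n → K) :=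
      { g with
        map_smul' := fun c x ↦ by
          obtain ⟨a, b, rfl⟩ := hgen c
          have h := hgJ x
          rw [hJ, hJ] at h
          simp [add_smul, mul_smul, h] }
    have hgK : ∀ x, LinearMap.toMatrix' gK *ᵥ x = g x := fun x ↦ LinearMap.toMatrix'_mulVec gK x
    have hsum : ∀ x y, sesqForm σ H (g x) (g y) + sesqForm σ H (g y) (g x) =
        sesqForm σ H' x y + sesqForm σ H' y x := fun x y ↦ by
      rw [← algebraMap_polar_eq_sesqForm_add hqH, ← algebraMap_polar_eq_sesqForm_add hqH']
      simp only [QuadraticMap.polar, ← map_add, hg]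
    have h2K : (2 : K) ≠ 0 := by
      rw [← map_ofNat (algebraMap k K) 2]
      exact (map_ne_zero (algebraMap k K)).2 h2
    have hsesq : ∀ x y, sesqForm σ H (g x) (g y) = sesqForm σ H' x y := fun x y ↦ by
      have h := hsum x (J y)
      rw [hgJ, hJ, hJ] at h
      simp only [sesqForm_smul_left, sesqForm_smul_right, hσθ] at h
      refine mul_left_cancel₀ (mul_ne_zero h2K hθ) ?_
      linear_combination h + θ * hsum x y
    have hM : H' = ((LinearMap.toMatrix' gK).map σ)ᵀ * H * LinearMap.toMatrix' gK := by
      ext i j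
      rw [← sesqForm_single σ H', ← hsesq, ← hgK, ← hgK, sesqForm_mulVec, sesqForm_single]
    refine ⟨_, ?_, hM⟩
    rw [hM, Matrix.isUnit_iff_isUnit_det, det_mul] at hH'unit
    exact (Matrix.isUnit_iff_isUnit_det _).2 (isUnit_of_mul_isUnit_right hH'unit)
end

section
/- Let k be a field of characteristic different from 2, a, b ∈ k*, and Q = (a,b)_k the quaternion algebra with conjugation x ↦ x̄. Let H, H' ∈ GLₙ(Q) be invertible hermitian matrices. Then H and H' are congruent (H' = M̄ᵀHM for some M ∈ GLₙ(Q)) if and only if the trace forms q_H and q_{H'} are isometric as quadratic forms over k. -/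
open Matrix

section WittCancellation

open QuadraticMap

variable {K V V₁ V₂ : Type*} [Field K] [AddCommGroup V] [Module K V]
  [AddCommGroup V₁] [Module K V₁] [AddCommGroup V₂] [Module K V₂]

/-- The reflection of a quadratic space in the hyperplane orthogonal to an anisotropic vector. -/
theorem QuadraticForm.exists_isometryEquiv_reflection (q : QuadraticForm K V) {u : V}
    (hu : q u ≠ 0) :
    ∃ τ : q.IsometryEquiv q, ∀ v, τ v = v - (polar q u v / q u) • u := by
  have h : ((q u)⁻¹ • q.polarBilin u) u = 2 := by
    simp only [LinearMap.smul_apply, polarBilin_apply_apply, polar_self, smul_eq_mul, nsmul_eq_mul]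
    field_simp
    norm_num
  refine ⟨⟨Module.reflection h, fun v => ?_⟩, fun v => ?_⟩
  · change q (Module.reflection h v) = q v
    rw [Module.reflection_apply, sub_eq_add_neg, QuadraticMap.map_add q, QuadraticMap.map_neg,
      polar_neg_right, polar_smul_right, QuadraticMap.map_smul, polar_comm q v u]
    simp only [LinearMap.smul_apply, polarBilin_apply_apply, smul_eq_mul]
    field_simp
    ring
  · change Module.reflection h v = _
    rw [Module.reflection_apply]
    simp [div_eq_inv_mul]

theorem QuadraticForm.exists_isometryEquiv_apply_eq (h2 : (2 : K) ≠ 0) (q : QuadraticForm K V)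
    {x y : V} (hx : q x ≠ 0) (hxy : q x = q y) : ∃ τ : q.IsometryEquiv q, τ y = x := by
  have hsub : q (x - y) = 2 * q x - polar q x y := by
    rw [sub_eq_add_neg, QuadraticMap.map_add q, QuadraticMap.map_neg, polar_neg_right, ← hxy]
    ring
  have hadd : q (x + y) = 2 * q x + polar q x y := by
    rw [QuadraticMap.map_add q, ← hxy]
    ring
  by_cases h : q (x - y) = 0
  · have h' : q (x + y) ≠ 0 := by
      intro h'
      have : (2 * 2) * q x = 0 := by linear_combination h + h' - hsub - hadd
      exact mul_ne_zero (mul_ne_zero h2 h2) hx this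
    obtain ⟨τ, hτ⟩ := q.exists_isometryEquiv_reflection h'
    refine ⟨τ.trans ⟨LinearEquiv.neg K, fun v => q.map_neg v⟩, ?_⟩
    change -(τ y) = x
    have : polar q (x + y) y / q (x + y) = 1 := by
      rw [div_eq_one_iff_eq h', polar_add_left, polar_self, hadd, ← hxy]
      simp
      ring
    rw [hτ, this]
    simp
  · obtain ⟨τ, hτ⟩ := q.exists_isometryEquiv_reflection h
    refine ⟨τ, ?_⟩
    have : polar q (x - y) y / q (x - y) = -1 := by
      rw [div_eq_iff h, polar_sub_left, polar_self, hsub, ← hxy]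
      simp
    rw [hτ, this]
    simp

theorem QuadraticForm.exists_apply_zero_mk_eq (h2 : (2 : K) ≠ 0) {c : K} (hc : c ≠ 0)
    {q₁ : QuadraticForm K V₁} {q₂ : QuadraticForm K V₂}
    (σ : ((c • QuadraticMap.sq).prod q₁).IsometryEquiv ((c • QuadraticMap.sq).prod q₂)) (hσ : σ (1, 0) = (1, 0)) (v : V₁) :
    σ (0, v) = (0, (σ (0, v)).2) := by
  refine Prod.ext ?_ rfl
  have h1 := σ.map_app ((1, 0) + (0, v))
  have hadd : σ ((1, 0) + (0, v)) = σ (1, 0) + σ (0, v) := map_add σ.toLinearEquiv _ _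
  have h0 := σ.map_app (0, v)
  rw [hadd, hσ] at h1
  simp only [prod_apply, _root_.smul_apply, sq_apply, Prod.fst_add, Prod.snd_add, smul_eq_mul, zero_add,
    add_zero, mul_zero, mul_one] at h1 h0
  have : 2 * c * (σ (0, v)).1 = 0 := by linear_combination h1 - h0
  simpa [h2, hc] using this

/-- Witt cancellation of a one-dimensional nondegenerate form. -/
theorem QuadraticForm.equivalent_of_smul_sq_prod (h2 : (2 : K) ≠ 0) {c : K} (hc : c ≠ 0)
    {q₁ : QuadraticForm K V₁} {q₂ : QuadraticForm K V₂}
    (h : ((c • QuadraticMap.sq).prod q₁).Equivalent ((c • QuadraticMap.sq).prod q₂)) : q₁.Equivalent q₂ := by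
  obtain ⟨φ⟩ := h
  have hx : (((c • QuadraticMap.sq).prod q₂ : QuadraticForm K (K × V₂))) (1, 0) = c := by simp
  have hy : (((c • QuadraticMap.sq).prod q₂ : QuadraticForm K (K × V₂))) (φ (1, 0)) = c := by
    rw [φ.map_app]
    simp
  obtain ⟨τ, hτ⟩ := exists_isometryEquiv_apply_eq h2 ((c • QuadraticMap.sq).prod q₂) (x := (1, 0))
    (y := φ (1, 0)) (by rwa [hx]) (by rw [hx, hy])
  obtain ⟨σ, hσ⟩ : ∃ σ : ((c • QuadraticMap.sq).prod q₁).IsometryEquiv ((c • QuadraticMap.sq).prod q₂),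
      σ (1, 0) = (1, 0) := ⟨φ.trans τ, hτ⟩
  have hσ' : σ.symm (1, 0) = (1, 0) := by
    rw [← hσ]
    exact σ.toLinearEquiv.symm_apply_apply (1, 0)
  have key := exists_apply_zero_mk_eq h2 hc σ hσ
  have key' := exists_apply_zero_mk_eq h2 hc σ.symm hσ'
  refine ⟨⟨LinearEquiv.ofLinearMap
    (LinearMap.snd K K V₂ ∘ₗ σ.toLinearEquiv.toLinearMap ∘ₗ LinearMap.inr K K V₁)
    (LinearMap.snd K K V₁ ∘ₗ σ.symm.toLinearEquiv.toLinearMap ∘ₗ LinearMap.inr K K V₂)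
    (LinearMap.ext fun v => ?_) (LinearMap.ext fun v => ?_), fun v => ?_⟩⟩
  · change (σ (0, (σ.symm (0, v)).2)).2 = v
    rw [← key']
    exact congrArg Prod.snd (σ.toLinearEquiv.apply_symm_apply (0, v))
  · change (σ.symm (0, (σ (0, v)).2)).2 = v
    rw [← key]
    exact congrArg Prod.snd (σ.toLinearEquiv.symm_apply_apply (0, v))
  · change q₂ (σ (0, v)).2 = q₁ v
    have h0 := σ.map_app (0, v)
    rw [key] at h0
    simpa using h0

end WittCancellation

section InvertibleMatrices

variable {R m n : Type*} [Ring R] [Fintype m] [Fintype n] [DecidableEq m] [DecidableEq n]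

namespace Matrix

theorem isUnit_of_isUnit_fromBlocks_zero {A : Matrix m m R} {D : Matrix n n R}
    (h : IsUnit (Matrix.fromBlocks A 0 0 D)) : IsUnit A := by
  obtain ⟨X, h1, h2⟩ := isUnit_iff_exists.mp h
  rw [← fromBlocks_toBlocks X, fromBlocks_multiply, ← fromBlocks_one, fromBlocks_inj] at h1 h2
  exact isUnit_iff_exists.mpr ⟨X.toBlocks₁₁, by simpa using h1.1, by simpa using h2.1⟩

theorem isUnit_one_add_vecMulVec {w v : n → R} (h : IsUnit (1 + v ⬝ᵥ w)) :
    IsUnit (1 + vecMulVec w v) := by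
  obtain ⟨u, h1, h2⟩ := isUnit_iff_exists.mp h
  refine isUnit_iff_exists.mpr ⟨1 - vecMulVec w (u • v), ?_, ?_⟩
  · have : vecMulVec w v = vecMulVec w (u • v) + vecMulVec w ((v ⬝ᵥ w) • u • v) := by
      rw [← vecMulVec_add, smul_smul, ← add_smul, ← one_add_mul, h1, one_smul]
    rw [mul_sub, Matrix.mul_one, add_mul, Matrix.one_mul, vecMulVec_mul_vecMulVec, ← sub_sub, this]
    abel
  · have : vecMulVec w v = vecMulVec w (u • v) + vecMulVec w (((u • v) ⬝ᵥ w) • v) := by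
      rw [← vecMulVec_add, smul_dotProduct, smul_eq_mul, ← add_smul, ← mul_one_add, h2, one_smul]
    rw [mul_add, Matrix.mul_one, sub_mul, Matrix.one_mul, vecMulVec_mul_vecMulVec, this]
    abel

/-- A vector with an invertible coordinate is a column of an invertible matrix. -/
theorem exists_isUnit_mulVec_single {z : n → R} {j : n} (hz : IsUnit (z j)) :
    ∃ G : Matrix n n R, IsUnit G ∧ G *ᵥ Pi.single j 1 = z := by
  refine ⟨1 + vecMulVec (z - Pi.single j 1) (Pi.single j 1), isUnit_one_add_vecMulVec ?_, ?_⟩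
  · simpa using hz
  · rw [add_mulVec, vecMulVec_mulVec, one_mulVec]
    simp

end Matrix

end InvertibleMatrices

section Congruence

variable {R l m n : Type*} [Ring R] [StarRing R] [Fintype l] [Fintype m] [Fintype n]
  [DecidableEq l] [DecidableEq m] [DecidableEq n]

/-- Congruence of square matrices, with possibly different index types, over a ring with
involution. -/
def Matrix.Congruent (A : Matrix m m R) (B : Matrix n n R) : Prop :=
  ∃ (M : Matrix m n R) (N : Matrix n m R), M * N = 1 ∧ N * M = 1 ∧ B = Mᴴ * A * M

namespace Matrix

theorem Congruent.symm {A : Matrix m m R} {B : Matrix n n R} (h : A.Congruent B) :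
    B.Congruent A := by
  obtain ⟨M, N, hMN, hNM, rfl⟩ := h
  refine ⟨N, M, hNM, hMN, ?_⟩
  calc A = (M * N)ᴴ * A * (M * N) := by simp [hMN]
    _ = _ := by simp only [conjTranspose_mul, Matrix.mul_assoc]

theorem Congruent.trans {A : Matrix l l R} {B : Matrix m m R} {C : Matrix n n R}
    (h : A.Congruent B) (h' : B.Congruent C) : A.Congruent C := by
  obtain ⟨M, N, hMN, hNM, rfl⟩ := h
  obtain ⟨M', N', hMN', hNM', rfl⟩ := h'
  refine ⟨M * M', N' * N, ?_, ?_, by simp only [conjTranspose_mul, Matrix.mul_assoc]⟩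
  · rw [Matrix.mul_assoc, ← Matrix.mul_assoc M', hMN', Matrix.one_mul, hMN]
  · rw [Matrix.mul_assoc, ← Matrix.mul_assoc N, hNM, Matrix.one_mul, hNM']

theorem Congruent.isHermitian {A : Matrix m m R} {B : Matrix n n R} (h : A.Congruent B)
    (hA : A.IsHermitian) : B.IsHermitian := by
  obtain ⟨M, N, -, -, rfl⟩ := h
  exact isHermitian_conjTranspose_mul_mul M hA

theorem Congruent.isUnit {A : Matrix m m R} {B : Matrix n n R} (h : A.Congruent B)
    (hA : IsUnit A) : IsUnit B := by
  obtain ⟨M, N, hMN, hNM, rfl⟩ := h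
  obtain ⟨A', hA', hA''⟩ := isUnit_iff_exists.mp hA
  have hMN' : Nᴴ * Mᴴ = 1 := by rw [← conjTranspose_mul, hMN, conjTranspose_one]
  have hNM' : Mᴴ * Nᴴ = 1 := by rw [← conjTranspose_mul, hNM, conjTranspose_one]
  refine isUnit_iff_exists.mpr ⟨N * A' * Nᴴ, ?_, ?_⟩
  · calc Mᴴ * A * M * (N * A' * Nᴴ) = Mᴴ * (A * (M * N) * A') * Nᴴ := by simp only [Matrix.mul_assoc]
    _ = 1 := by rw [hMN, Matrix.mul_one, hA', Matrix.mul_one, hNM']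
  · calc N * A' * Nᴴ * (Mᴴ * A * M) = N * (A' * (Nᴴ * Mᴴ) * A) * M := by simp only [Matrix.mul_assoc]
    _ = 1 := by rw [hMN', Matrix.mul_one, hA'', Matrix.mul_one, hNM]

theorem congruent_iff_exists_isUnit {A B : Matrix n n R} :
    A.Congruent B ↔ ∃ M : Matrix n n R, IsUnit M ∧ B = Mᴴ * A * M := by
  simp only [Congruent, isUnit_iff_exists]
  grind

/-- Congruence of block diagonal matrices with a common block. -/
theorem Congruent.fromBlocks {A : Matrix m m R} {B : Matrix n n R} (h : A.Congruent B)
    (C : Matrix l l R) :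
    (Matrix.fromBlocks A 0 0 C).Congruent (Matrix.fromBlocks B 0 0 C) := by
  obtain ⟨M, N, hMN, hNM, rfl⟩ := h
  refine ⟨Matrix.fromBlocks M 0 0 1, Matrix.fromBlocks N 0 0 1, ?_, ?_, ?_⟩ <;>
    simp [fromBlocks_multiply, fromBlocks_conjTranspose, hMN, hNM]

theorem congruent_submatrix (A : Matrix m m R) (e : n ≃ m) : A.Congruent (A.submatrix e e) := by
  refine ⟨(1 : Matrix m m R).submatrix id e, (1 : Matrix m m R).submatrix e id, ?_, ?_, ?_⟩
  · rw [submatrix_mul_equiv, Matrix.one_mul, submatrix_id_id]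
  · rw [← submatrix_mul _ _ e id e Function.bijective_id, Matrix.one_mul, submatrix_one_equiv]
  · ext i j
    simp [Matrix.mul_apply, Matrix.one_apply]

/-- A hermitian block matrix is congruent to the block diagonal matrix given by the Schur
complement. -/
theorem IsHermitian.congruent_schur {A : Matrix m m R} {B : Matrix m n R} {D E : Matrix n n R}
    (hD : D.IsHermitian) (hDE : D * E = 1) (hED : E * D = 1) :
    (Matrix.fromBlocks A B Bᴴ D).Congruent (Matrix.fromBlocks (A - B * E * Bᴴ) 0 0 D) := by
  have hE : Eᴴ = E := by
    have : Eᴴ * D = 1 := by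
      rw [← hD.eq, ← conjTranspose_mul, hDE, conjTranspose_one]
    exact left_inv_eq_right_inv this hDE
  refine ⟨Matrix.fromBlocks 1 0 (-(E * Bᴴ)) 1, Matrix.fromBlocks 1 0 (E * Bᴴ) 1, ?_, ?_, ?_⟩
  · simp [fromBlocks_multiply]
  · simp [fromBlocks_multiply]
  · have hDE' (X : Matrix n m R) : D * (E * X) = X := by
      rw [← Matrix.mul_assoc, hDE, Matrix.one_mul]
    simp [fromBlocks_multiply, fromBlocks_conjTranspose, hE, hDE', Matrix.mul_assoc, hED,
      sub_eq_add_neg]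

end Matrix

end Congruence

section QuaternionHermitian

open Quaternion

variable {k : Type*} [Field k] {a b : k}

namespace QuaternionAlgebra

theorem mul_star_eq_algebraMap (x : ℍ[k, a, b]) :
    x * star x = algebraMap k ℍ[k, a, b] (x * star x).re := by
  ext <;> simp [algebraMap_eq] <;> ring

theorem star_mul_eq_mul_star (x : ℍ[k, a, b]) : star x * x = x * star x := by
  ext <;> simp <;> ring

theorem isUnit_of_re_mul_star_ne_zero {x : ℍ[k, a, b]} (hx : (x * star x).re ≠ 0) : IsUnit x := by
  have h : algebraMap k ℍ[k, a, b] (x * star x).re⁻¹ * (x * star x) = 1 := by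
    have := congrArg (algebraMap k ℍ[k, a, b] (x * star x).re⁻¹ * ·) (mul_star_eq_algebraMap x)
    rwa [← map_mul, inv_mul_cancel₀ hx, map_one] at this
  refine isUnit_iff_exists.mpr ⟨algebraMap k ℍ[k, a, b] (x * star x).re⁻¹ * star x, ?_, ?_⟩
  · rw [← h, ← mul_assoc, ← Algebra.commutes, mul_assoc]
  · rw [mul_assoc, star_mul_eq_mul_star, h]

/-- The reduced trace pairing of a quaternion algebra is nondegenerate. -/
theorem eq_zero_of_forall_re_mul_eq_zero (ha : a ≠ 0) (hb : b ≠ 0) {g : ℍ[k, a, b]}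
    (h : ∀ x : ℍ[k, a, b], (x * g).re = 0) : g = 0 := by
  have h0 := h 1
  have h1 := h ⟨0, 1, 0, 0⟩
  have h2 := h ⟨0, 0, 1, 0⟩
  have h3 := h ⟨0, 0, 0, 1⟩
  ext <;> simp_all

theorem eq_algebraMap_re_of_star_eq (h2 : (2 : k) ≠ 0) {x : ℍ[k, a, b]} (h : star x = x) :
    x = algebraMap k ℍ[k, a, b] x.re := by
  have aux {r : k} (hr : -r = r) : r = 0 := by
    have : 2 * r = 0 := by linear_combination -hr
    simpa [h2] using this
  obtain ⟨-, h1, h2, h3⟩ := QuaternionAlgebra.ext_iff.mp h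
  ext
  · rfl
  · exact aux (by simpa using h1)
  · exact aux (by simpa using h2)
  · exact aux (by simpa using h3)

theorem re_mul_star_add (x y z : ℍ[k, a, b]) (hx : (x * star x).re = 0)
    (hy : (y * star y).re = 0) :
    ((x + z * y) * star (x + z * y)).re = 2 * (z * (y * star x)).re := by
  have hzy : ((z * y) * star (z * y)).re = 0 := by
    rw [star_mul, mul_assoc, ← mul_assoc y, mul_star_eq_algebraMap, hy]
    simp
  have hcomm : (x * star (z * y)).re = ((z * y) * star x).re := by
    have : star (x * star (z * y)) = z * y * star x := by rw [star_mul, star_star]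
    rw [← this, re_star, zero_mul, add_zero]
  rw [star_add, mul_add, add_mul, add_mul, re_add, re_add, re_add, hx, hzy, hcomm, mul_assoc]
  ring

end QuaternionAlgebra

namespace Matrix

open QuaternionAlgebra

variable {m n : Type*} [Fintype m] [Fintype n]

/-- A unimodular vector over a quaternion algebra is a column of an invertible matrix. -/
theorem exists_isUnit_mulVec_single_of_dotProduct_eq [DecidableEq n] (h2 : (2 : k) ≠ 0)
    (ha : a ≠ 0) (hb : b ≠ 0) {t y : n → ℍ[k, a, b]} {c : k} (hc : c ≠ 0)
    (hty : t ⬝ᵥ y = algebraMap k ℍ[k, a, b] c) :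
    ∃ (P : Matrix n n ℍ[k, a, b]) (j : n), IsUnit P ∧ P *ᵥ Pi.single j 1 = y := by
  by_cases hy : ∃ j, (y j * star (y j)).re ≠ 0
  · obtain ⟨j, hj⟩ := hy
    obtain ⟨G, hG, hGy⟩ := exists_isUnit_mulVec_single (isUnit_of_re_mul_star_ne_zero hj)
    exact ⟨G, j, hG, hGy⟩
  push Not at hy
  obtain ⟨i, j, hij⟩ : ∃ i j, y i * star (y j) ≠ 0 := by
    by_contra! h
    have hy0 (j : n) : y j = 0 := by
      have : algebraMap k ℍ[k, a, b] c * star (y j) = 0 := by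
        simp [← hty, dotProduct, Finset.sum_mul, mul_assoc, h]
      rw [← Algebra.smul_def, smul_eq_zero_iff_right hc] at this
      exact star_eq_zero.mp this
    have : algebraMap k ℍ[k, a, b] c = 0 := by simp [← hty, dotProduct, hy0]
    exact hc ((map_eq_zero _).mp this)
  have hne : i ≠ j := by
    rintro rfl
    exact hij (by rw [mul_star_eq_algebraMap, hy, map_zero])
  obtain ⟨z, hz⟩ : ∃ z : ℍ[k, a, b], (z * (y i * star (y j))).re ≠ 0 := by
    by_contra! h
    exact hij (eq_zero_of_forall_re_mul_eq_zero ha hb h)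
  have hT : IsUnit (1 + vecMulVec (Pi.single j z) (Pi.single i 1)) :=
    isUnit_one_add_vecMulVec (by simp [hne])
  set T := 1 + vecMulVec (Pi.single j z) (Pi.single i 1) with hTdef
  obtain ⟨S, hTS, hST⟩ := isUnit_iff_exists.mp hT
  have hTy : (T *ᵥ y) j = y j + z * y i := by
    simp [hTdef, add_mulVec, vecMulVec_mulVec]
  have hunit : IsUnit ((T *ᵥ y) j) := by
    apply isUnit_of_re_mul_star_ne_zero
    rw [hTy, re_mul_star_add _ _ _ (hy j) (hy i)]
    exact mul_ne_zero h2 hz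
  obtain ⟨G, hG, hGy⟩ := exists_isUnit_mulVec_single hunit
  refine ⟨S * G, j, (isUnit_iff_exists.mpr ⟨T, hST, hTS⟩).mul hG, ?_⟩
  rw [← mulVec_mulVec, hGy, mulVec_mulVec, hST, one_mulVec]

theorem star_dotProduct_conjTranspose_mul_mul_mulVec {R : Type*} [Ring R] [StarRing R]
    (A : Matrix m m R) (M : Matrix m n R) (x y : n → R) :
    star x ⬝ᵥ (Mᴴ * A * M) *ᵥ y = star (M *ᵥ x) ⬝ᵥ A *ᵥ (M *ᵥ y) := by
  rw [star_mulVec, ← dotProduct_mulVec, mulVec_mulVec, mulVec_mulVec, Matrix.mul_assoc]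

/-- The bilinear form `(x, y) ↦ Re (x̄ᵀ H y)` of a matrix over a quaternion algebra. -/
def traceBilin (H : Matrix n n ℍ[k, a, b]) : LinearMap.BilinForm k (n → ℍ[k, a, b]) :=
  LinearMap.mk₂ k (fun x y => (star x ⬝ᵥ H *ᵥ y).re)
    (fun x x' y => by simp [add_dotProduct])
    (fun c x y => by
      have : star (c • x) = c • star x := funext fun i => by ext <;> simp
      simp [this])
    (fun x y y' => by simp [mulVec_add])
    (fun c x y => by simp [mulVec_smul])

/-- The trace form `x ↦ Re (x̄ᵀ H x)` of a matrix over a quaternion algebra. -/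
def traceForm (H : Matrix n n ℍ[k, a, b]) : QuadraticForm k (n → ℍ[k, a, b]) :=
  LinearMap.BilinMap.toQuadraticMap H.traceBilin

theorem traceForm_apply (H : Matrix n n ℍ[k, a, b]) (x : n → ℍ[k, a, b]) :
    H.traceForm x = (star x ⬝ᵥ H *ᵥ x).re :=
  rfl

theorem Congruent.equivalent_traceForm [DecidableEq m] [DecidableEq n]
    {A : Matrix m m ℍ[k, a, b]} {B : Matrix n n ℍ[k, a, b]} (h : A.Congruent B) :
    A.traceForm.Equivalent B.traceForm := by
  obtain ⟨M, N, hMN, hNM, rfl⟩ := h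
  refine QuadraticMap.Equivalent.symm ⟨{
    toFun := M.mulVec
    map_add' := mulVec_add M
    map_smul' := fun c x => mulVec_smul M c x
    invFun := N.mulVec
    left_inv := fun x => by rw [mulVec_mulVec, hNM, one_mulVec]
    right_inv := fun x => by rw [mulVec_mulVec, hMN, one_mulVec]
    map_app' := fun x => ?_ }⟩
  change A.traceForm (M *ᵥ x) = _
  simp only [traceForm_apply, star_dotProduct_conjTranspose_mul_mul_mulVec]

theorem IsHermitian.star_dotProduct_mulVec_comm {R : Type*} [Ring R] [StarRing R]
    {A : Matrix n n R} (hA : A.IsHermitian) (x y : n → R) :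
    star (star x ⬝ᵥ A *ᵥ y) = star y ⬝ᵥ A *ᵥ x := by
  rw [← star_dotProduct_star, star_mulVec, star_star, hA.eq, ← dotProduct_mulVec]

theorem IsHermitian.star_dotProduct_mulVec_self_eq (h2 : (2 : k) ≠ 0)
    {H : Matrix n n ℍ[k, a, b]} (hH : H.IsHermitian) (x : n → ℍ[k, a, b]) :
    star x ⬝ᵥ H *ᵥ x = algebraMap k ℍ[k, a, b] (H.traceForm x) :=
  eq_algebraMap_re_of_star_eq h2 (hH.star_dotProduct_mulVec_comm x x)

theorem IsHermitian.exists_traceForm_ne_zero [DecidableEq n] [Nonempty n] (h2 : (2 : k) ≠ 0)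
    (ha : a ≠ 0) (hb : b ≠ 0) {H : Matrix n n ℍ[k, a, b]} (hH : H.IsHermitian) (hU : IsUnit H) :
    ∃ x, H.traceForm x ≠ 0 := by
  by_contra! h
  have hbilin (x y : n → ℍ[k, a, b]) : (star x ⬝ᵥ H *ᵥ y).re = 0 := by
    have hxy := LinearMap.BilinMap.polar_toQuadraticMap (B := H.traceBilin) x y
    have hsymm : H.traceBilin y x = H.traceBilin x y := by
      change (star y ⬝ᵥ H *ᵥ x).re = (star x ⬝ᵥ H *ᵥ y).re
      rw [← hH.star_dotProduct_mulVec_comm]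
      simp
    change QuadraticMap.polar H.traceForm x y = _ at hxy
    rw [QuadraticMap.polar, h, h, h, hsymm] at hxy
    have : 2 * H.traceBilin x y = 0 := by linear_combination -hxy
    exact (mul_eq_zero.mp this).resolve_left h2
  have hzero (y : n → ℍ[k, a, b]) : H *ᵥ y = 0 := by
    funext i
    refine eq_zero_of_forall_re_mul_eq_zero ha hb fun x => ?_
    simpa using hbilin (Pi.single i (star x)) y
  obtain ⟨N, -, hN⟩ := isUnit_iff_exists.mp hU
  have : (1 : n → ℍ[k, a, b]) = 0 := by
    rw [← one_mulVec (1 : n → ℍ[k, a, b]), ← hN, ← mulVec_mulVec, hzero, mulVec_zero]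
  exact one_ne_zero this

/-- A nonzero value of the trace form of a hermitian matrix splits off as a diagonal entry. -/
theorem IsHermitian.exists_congruent_fromBlocks (h2 : (2 : k) ≠ 0) (ha : a ≠ 0) (hb : b ≠ 0)
    {N : ℕ} {H : Matrix (Fin (N + 1)) (Fin (N + 1)) ℍ[k, a, b]} (hH : H.IsHermitian)
    {y : Fin (N + 1) → ℍ[k, a, b]} (hy : H.traceForm y ≠ 0) :
    ∃ H₁ : Matrix (Fin N) (Fin N) ℍ[k, a, b], H.Congruent
      (Matrix.fromBlocks H₁ 0 0 (algebraMap k (Matrix Unit Unit ℍ[k, a, b]) (H.traceForm y))) := by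
  have hyy := hH.star_dotProduct_mulVec_self_eq h2 y
  generalize H.traceForm y = c at hy hyy
  obtain ⟨P, j, hP, rfl⟩ := exists_isUnit_mulVec_single_of_dotProduct_eq h2 ha hb hy
    (t := star y ᵥ* H) (y := y) (by rw [← hyy, dotProduct_mulVec])
  have hHP : H.Congruent (Pᴴ * H * P) := congruent_iff_exists_isUnit.mpr ⟨P, hP, rfl⟩
  let e : Fin N ⊕ Unit ≃ Fin (N + 1) :=
    (Equiv.optionEquivSumPUnit (Fin N)).symm.trans (finSuccEquiv' j).symm
  have hHe := hHP.trans (congruent_submatrix _ e)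
  have hherm := hHe.isHermitian hH
  set A := (Pᴴ * H * P).submatrix e e with hA
  have h22 : A.toBlocks₂₂ = algebraMap k (Matrix Unit Unit ℍ[k, a, b]) c := by
    ext1 u v
    have : A.toBlocks₂₂ u v = (Pᴴ * H * P) j j := by simp [hA, toBlocks₂₂, e]
    rw [this]
    rw [← star_dotProduct_conjTranspose_mul_mul_mulVec] at hyy
    simpa [algebraMap_matrix_apply] using hyy
  have h21 : A.toBlocks₂₁ = (A.toBlocks₁₂)ᴴ := by
    ext1 u v
    exact (hherm.apply _ _).symm
  have hblocks : A = Matrix.fromBlocks A.toBlocks₁₁ A.toBlocks₁₂ (A.toBlocks₁₂)ᴴ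
      (algebraMap k (Matrix Unit Unit ℍ[k, a, b]) c) := by
    rw [← h22, ← h21, fromBlocks_toBlocks]
  rw [hblocks] at hHe
  refine ⟨_, hHe.trans (IsHermitian.congruent_schur
    (E := algebraMap k (Matrix Unit Unit ℍ[k, a, b]) c⁻¹) ?_ ?_ ?_)⟩
  · ext1 u v
    simp [algebraMap_matrix_apply, QuaternionAlgebra.algebraMap_eq]
  · rw [← map_mul, mul_inv_cancel₀ hy, map_one]
  · rw [← map_mul, inv_mul_cancel₀ hy, map_one]

/-- The trace form of a hermitian matrix with a scalar block. -/
theorem equivalent_traceForm_fromBlocks (H : Matrix n n ℍ[k, a, b]) (c : k) :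
    (fromBlocks H 0 0 (algebraMap k (Matrix Unit Unit ℍ[k, a, b]) c)).traceForm.Equivalent
      ((c • QuadraticMap.sq).prod <| (-(c * a) • QuadraticMap.sq).prod <|
        (-(c * b) • QuadraticMap.sq).prod <| ((c * a * b) • QuadraticMap.sq).prod H.traceForm) := by
  refine ⟨{
    toFun := fun x => ((x (.inr ())).re, (x (.inr ())).imI, (x (.inr ())).imJ, (x (.inr ())).imK,
      x ∘ Sum.inl)
    map_add' := fun x y => rfl
    map_smul' := fun r x => rfl
    invFun := fun v => Sum.elim v.2.2.2.2 fun _ => ⟨v.1, v.2.1, v.2.2.1, v.2.2.2.1⟩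
    left_inv := fun x => by
      funext i
      rcases i with i | i <;> rfl
    right_inv := fun v => rfl
    map_app' := fun x => ?_ }⟩
  simp [traceForm_apply, dotProduct, Fintype.sum_sum_type,
    algebraMap_matrix_apply, mulVec, algebraMap_eq]
  ring

theorem IsHermitian.congruent_of_equivalent_traceForm (h2 : (2 : k) ≠ 0) (ha : a ≠ 0)
    (hb : b ≠ 0) {N : ℕ} {H H' : Matrix (Fin N) (Fin N) ℍ[k, a, b]} (hH : H.IsHermitian)
    (hH' : H'.IsHermitian) (hU : IsUnit H) (hU' : IsUnit H')
    (h : H.traceForm.Equivalent H'.traceForm) : H.Congruent H' := by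
  induction N with
  | zero => exact ⟨1, 1, Subsingleton.elim _ _, Subsingleton.elim _ _, Subsingleton.elim _ _⟩
  | succ N ih =>
    obtain ⟨x, hx⟩ := hH.exists_traceForm_ne_zero h2 ha hb hU
    obtain ⟨f⟩ := id h
    have hfx := f.map_app x
    obtain ⟨H₁, hH₁⟩ := hH.exists_congruent_fromBlocks h2 ha hb hx
    obtain ⟨H₁', hH₁'⟩ := hH'.exists_congruent_fromBlocks h2 ha hb (y := f x) (by rwa [hfx])
    rw [hfx] at hH₁'
    generalize H.traceForm x = c at *
    have hequiv : H₁.traceForm.Equivalent H₁'.traceForm := by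
      have := (equivalent_traceForm_fromBlocks H₁ c).symm.trans <|
        hH₁.symm.equivalent_traceForm.trans <| h.trans <|
        hH₁'.equivalent_traceForm.trans (equivalent_traceForm_fromBlocks H₁' c)
      have hca := mul_ne_zero hx ha
      have hcb := mul_ne_zero hx hb
      exact QuadraticForm.equivalent_of_smul_sq_prod h2 (mul_ne_zero hca hb) <|
        QuadraticForm.equivalent_of_smul_sq_prod h2 (neg_ne_zero.mpr hcb) <|
        QuadraticForm.equivalent_of_smul_sq_prod h2 (neg_ne_zero.mpr hca) <|
        QuadraticForm.equivalent_of_smul_sq_prod h2 hx this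
    have hcong : H₁.Congruent H₁' := ih
      (isHermitian_fromBlocks_iff.mp (hH₁.isHermitian hH)).1
      (isHermitian_fromBlocks_iff.mp (hH₁'.isHermitian hH')).1
      (isUnit_of_isUnit_fromBlocks_zero (hH₁.isUnit hU))
      (isUnit_of_isUnit_fromBlocks_zero (hH₁'.isUnit hU')) hequiv
    exact (hH₁.trans (hcong.fromBlocks _)).trans hH₁'.symm

theorem eq_traceForm_of_algebraMap_eq {H : Matrix n n ℍ[k, a, b]}
    {q : QuadraticForm k (n → ℍ[k, a, b])}
    (hq : ∀ x, algebraMap k ℍ[k, a, b] (q x) = ∑ i, star (x i) * H.mulVec x i) :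
    q = H.traceForm := by
  ext x
  exact congrArg QuaternionAlgebra.re (hq x)

end Matrix

end QuaternionHermitian

open Quaternion in
/-- Let `k` be a field of characteristic ≠ 2, `Q = (a,b)_k` a quaternion algebra
with its standard conjugation `star`, and `H, H'` invertible hermitian `n × n` matrices over `Q`
(`Hᴴ = H`).  Let `q_H, q_H'` be the associated trace forms: the `k`-quadratic forms on `Qⁿ` with
`q_H x = x̄ᵀ H x ∈ k·1`.  Then `H` and `H'` are congruent (`H' = M̄ᵀ H M` for some invertible
`M`) iff `q_H` and `q_H'` are isometric over `k`. -/
theorem quaternion_hermitian_congruent_iff_trace_forms_equivalent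
    (k : Type) [Field k] (h2 : (2 : k) ≠ 0)
    (a b : k) (ha : a ≠ 0) (hb : b ≠ 0)
    (n : ℕ) (H H' : Matrix (Fin n) (Fin n) ℍ[k, a, b])
    (hHherm : Hᴴ = H) (hH'herm : H'ᴴ = H')
    (hHunit : IsUnit H) (hH'unit : IsUnit H')
    (qH qH' : QuadraticForm k (Fin n → ℍ[k, a, b]))
    (hqH : ∀ x : Fin n → ℍ[k, a, b],
      algebraMap k ℍ[k, a, b] (qH x) = ∑ i, star (x i) * H.mulVec x i)
    (hqH' : ∀ x : Fin n → ℍ[k, a, b],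
      algebraMap k ℍ[k, a, b] (qH' x) = ∑ i, star (x i) * H'.mulVec x i) :
    (∃ M : Matrix (Fin n) (Fin n) ℍ[k, a, b], IsUnit M ∧ H' = Mᴴ * H * M) ↔
      qH.Equivalent qH' := by
  rw [eq_traceForm_of_algebraMap_eq hqH, eq_traceForm_of_algebraMap_eq hqH',
    ← congruent_iff_exists_isUnit]
  exact ⟨Congruent.equivalent_traceForm,
    IsHermitian.congruent_of_equivalent_traceForm h2 ha hb hHherm hH'herm hHunit hH'unit⟩
end

section
/- Let k be a field of characteristic different from 2 and K/k a separable quadratic field extension with nontrivial k-automorphism x ↦ x̄. Let τ : Mₙ(K) → Mₙ(K) be an additive map satisfying τ(XY) = τ(Y)τ(X) for all X, Y, τ ∘ τ = id, and τ(c·I) = c̄·I for all c ∈ K. Then there exists an invertible hermitian matrix H ∈ GLₙ(K) (H̄ᵀ = H) such that τ(X) = H⁻¹X̄ᵀH for all X ∈ Mₙ(K). -/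
open Matrix

/-- Every `K`-algebra automorphism of a matrix algebra over a field is inner. -/
theorem Matrix.exists_isUnit_algEquiv_mul_eq {n K : Type*} [Fintype n] [DecidableEq n] [Field K]
    (f : Matrix n n K ≃ₐ[K] Matrix n n K) :
    ∃ P : Matrix n n K, IsUnit P ∧ ∀ X, f X * P = P * X := by
  obtain ⟨T, hT⟩ := AlgEquiv.eq_linearEquivConjAlgEquiv
    ((Matrix.toLinAlgEquiv'.symm.trans f).trans Matrix.toLinAlgEquiv')
  have hTX (X : Matrix n n K) :
      toLinAlgEquiv' (f X) = T.toLinearMap ∘ₗ toLinAlgEquiv' X ∘ₗ T.symm.toLinearMap := by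
    simpa [LinearEquiv.conjAlgEquiv_apply] using congr($hT (toLinAlgEquiv' X))
  refine ⟨LinearMap.toMatrixAlgEquiv' T.toLinearMap, ?_, fun X ↦ ?_⟩
  · exact ((LinearMap.GeneralLinearGroup.ofLinearEquiv T).isUnit).map
      LinearMap.toMatrixAlgEquiv'
  · apply toLinAlgEquiv'.injective
    rw [map_mul, map_mul, toLinAlgEquiv'_toMatrixAlgEquiv', hTX]
    ext
    simp

/-- A matrix over a field commuting with all matrices is scalar. -/
theorem Matrix.exists_eq_smul_one_of_forall_mul_comm {n K : Type*} [Fintype n] [DecidableEq n]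
    [Field K] {M : Matrix n n K} (h : ∀ X, X * M = M * X) : ∃ c : K, M = c • 1 := by
  obtain ⟨c, rfl⟩ := Matrix.mem_range_scalar_of_commute_single
    (M := M) fun i j _ ↦ h (Matrix.single i j 1)
  exact ⟨c, by simp [Matrix.smul_one_eq_diagonal]⟩

/-- The elementary case of Hilbert's Theorem 90 for a nontrivial involution of a field. -/
theorem exists_ne_zero_apply_mul_eq_self {K : Type*} [Field K] (σ : K →+* K)
    (hσσ : ∀ c, σ (σ c) = c) (hσ : σ ≠ RingHom.id K) {l : K} (hl : σ l * l = 1) :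
    ∃ c, c ≠ 0 ∧ σ c * l = c := by
  have key (a : K) : σ (a + l * σ a) * l = a + l * σ a := by
    rw [map_add, map_mul, hσσ]
    linear_combination a * hl
  by_cases h : 1 + l = 0
  · obtain ⟨a, ha⟩ : ∃ a, σ a ≠ a := by
      by_contra! H
      exact hσ (RingHom.ext H)
    refine ⟨a + l * σ a, fun h0 ↦ ha ?_, key a⟩
    linear_combination σ a * h - h0
  · exact ⟨1 + l * σ 1, by simpa using h, key 1⟩

/-- Let `k` be a field of characteristic ≠ 2 and `K/k` a separable quadratic
field extension with nontrivial `k`-automorphism `σ` (conjugation).  Every unitary involution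
`τ` on `Mₙ(K)` over `k` (an additive anti-automorphism with `τ ∘ τ = id` acting on scalar
matrices by conjugation) is the adjoint involution of some invertible hermitian matrix `H`:
`τ X = H⁻¹ * X̄ᵀ * H` for all `X`. -/
theorem unitary_involution_is_adjoint_of_hermitian
    (k K : Type) [Field k] [Field K] [Algebra k K] (h2 : (2 : k) ≠ 0)
    [Algebra.IsSeparable k K] (hK2 : Module.finrank k K = 2)
    (σ : K ≃ₐ[k] K) (hσ : σ ≠ AlgEquiv.refl)
    (n : ℕ)
    (τ : Matrix (Fin n) (Fin n) K →+ Matrix (Fin n) (Fin n) K)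
    (hτmul : ∀ X Y : Matrix (Fin n) (Fin n) K, τ (X * Y) = τ Y * τ X)
    (hτinvol : ∀ X : Matrix (Fin n) (Fin n) K, τ (τ X) = X)
    (hτscalar : ∀ c : K,
      τ (c • (1 : Matrix (Fin n) (Fin n) K)) = σ c • (1 : Matrix (Fin n) (Fin n) K)) :
    ∃ H : Matrix (Fin n) (Fin n) K, IsUnit H ∧ (H.map σ)ᵀ = H ∧
      ∀ X : Matrix (Fin n) (Fin n) K, τ X = H⁻¹ * (X.map σ)ᵀ * H := by
  rcases Nat.eq_zero_or_pos n with rfl | hn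
  · exact ⟨1, isUnit_one, Subsingleton.elim _ _, fun _ ↦ Subsingleton.elim _ _⟩
  have : Nonempty (Fin n) := ⟨⟨0, hn⟩⟩
  have smul_one_inj {a b : K} (h : a • (1 : Matrix (Fin n) (Fin n) K) = b • 1) : a = b := by
    simpa using congr($h ⟨0, hn⟩ ⟨0, hn⟩)
  have hσσ (c : K) : σ (σ c) = c := smul_one_inj <| by
    rw [← hτscalar, ← hτscalar, hτinvol]
  set s : Matrix (Fin n) (Fin n) K → Matrix (Fin n) (Fin n) K := fun X ↦ (X.map σ)ᵀ with hs
  have s_mul (X Y) : s (X * Y) = s Y * s X := by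
    simp [hs, Matrix.map_mul]
  have s_s (X) : s (s X) = X := by
    ext; simp [hs, hσσ]
  have s_add (X Y) : s (X + Y) = s X + s Y := by
    ext; simp [hs]
  have s_smul (c : K) (X) : s (c • X) = σ c • s X := by
    ext; simp [hs]
  have s_one : s 1 = 1 := by
    simp [hs]
  have τ_one : τ 1 = 1 := by simpa using hτscalar 1
  have τ_smul (c : K) (X) : τ (c • X) = σ c • τ X := by
    have := hτmul (c • 1) X
    rwa [smul_one_mul, hτscalar, mul_smul_one] at this
  let f : Matrix (Fin n) (Fin n) K ≃ₐ[K] Matrix (Fin n) (Fin n) K :=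
    AlgEquiv.ofLinearEquiv
      { toFun := fun X ↦ τ (s X)
        invFun := fun X ↦ s (τ X)
        left_inv := fun X ↦ by simp only [hτinvol, s_s]
        right_inv := fun X ↦ by simp only [s_s, hτinvol]
        map_add' := fun X Y ↦ by rw [s_add, map_add]
        map_smul' := fun c X ↦ by rw [s_smul, τ_smul, hσσ, RingHom.id_apply] }
      (by simp [s_one, τ_one]) (fun X Y ↦ by simp [s_mul, hτmul])
  obtain ⟨P, hP, hfP⟩ := Matrix.exists_isUnit_algEquiv_mul_eq f
  have hτP (X) : τ X * P = P * s X := by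
    have : τ (s (s X)) * P = P * s X := hfP (s X)
    rwa [s_s] at this
  obtain ⟨G, hPG, hGP⟩ := isUnit_iff_exists.mp hP
  have hG : IsUnit G := isUnit_iff_exists.mpr ⟨P, hGP, hPG⟩
  have hGτ (X) : G * τ X = s X * G := by
    calc G * τ X = G * (τ X * P) * G := by rw [mul_assoc, mul_assoc, hPG, mul_one]
      _ = s X * G := by rw [hτP, ← mul_assoc, hGP, one_mul]
  have hcomm (X) : X * (P * s G) = P * s G * X := by
    have h1 : s (τ X) * s G = s G * X := by rw [← s_mul, hGτ, s_mul, s_s]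
    have h2 : s (τ X) * G = G * X := by rw [← hGτ, hτinvol]
    have h3 : s (τ X) = G * X * P := by rw [← h2, mul_assoc, hGP, mul_one]
    calc X * (P * s G) = P * G * (X * (P * s G)) := by rw [hPG, one_mul]
      _ = P * (G * X * P * s G) := by simp only [mul_assoc]
      _ = P * s G * X := by rw [← h3, h1, mul_assoc]
  obtain ⟨l, hl⟩ := Matrix.exists_eq_smul_one_of_forall_mul_comm hcomm
  have hsG : s G = l • G := by
    rw [← one_mul (s G), ← hGP, mul_assoc, hl, mul_smul_one]
  have hl1 : σ l * l = 1 := smul_one_inj <| by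
    have h : (σ l * l) • G = G := by
      rw [mul_smul, ← hsG, ← s_smul, ← hsG, s_s]
    rw [one_smul, ← hGP, ← smul_mul_assoc, h]
  obtain ⟨c, hc, hcl⟩ := exists_ne_zero_apply_mul_eq_self (σ : K →+* K) hσσ
    (fun h ↦ hσ (AlgEquiv.ext fun x ↦ congr($h x))) hl1
  have hH : IsUnit (c • G) := hG.smul (Units.mk0 c hc)
  refine ⟨c • G, hH, ?_, fun X ↦ ?_⟩
  · change s (c • G) = c • G
    rw [s_smul, hsG, smul_smul]
    exact congr($hcl • G)
  · change τ X = (c • G)⁻¹ * s X * (c • G)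
    rw [mul_assoc, mul_smul_comm, ← hGτ, ← smul_mul_assoc, ← mul_assoc,
      Matrix.nonsing_inv_mul _ ((Matrix.isUnit_iff_isUnit_det _).mp hH), one_mul]
end

section
/- Let k be a field of characteristic different from 2, K/k a separable quadratic field extension with nontrivial k-automorphism x ↦ x̄, and H ∈ GLₙ(K) an invertible hermitian matrix. Then there exist a₁, …, aₙ ∈ k* such that the trace form q_H is isometric over k to N_{K/k} ⊗ ⟨a₁, …, aₙ⟩, where N_{K/k} is the norm form of K (the 2-dimensional quadratic form x ↦ x·x̄ on K viewed as a k-vector space). -/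
open Matrix

open Module TensorProduct

namespace LinearMap.IsSymm

variable {K V : Type*} [Field K] {σ : K →+* K} [AddCommGroup V] [Module K V]
  {B : V →ₛₗ[σ] V →ₗ[K] K}

/-- A nonzero hermitian form in characteristic not two has an anisotropic vector. -/
theorem exists_self_ne_zero (hB : B.IsSymm) (h2 : (2 : K) ≠ 0) (hB₀ : B ≠ 0) :
    ∃ x, B x x ≠ 0 := by
  by_contra! h
  refine hB₀ (LinearMap.ext₂ fun x y ↦ ?_)
  by_contra hxy
  set y' := (B x y)⁻¹ • y with hy'
  have h₁ : B x y' = 1 := by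
    rw [hy', map_smul, smul_eq_mul, inv_mul_cancel₀ hxy]
  have h₂ : B y' x = 1 := by rw [← hB.eq, h₁, map_one]
  have h₃ := h (x + y')
  simp only [map_add, add_apply, h, h₁, h₂] at h₃
  exact h2 (by linear_combination h₃)

/-- A hermitian form in characteristic not two has an orthogonal basis. -/
theorem exists_isOrtho_basis [FiniteDimensional K V] (hB : B.IsSymm) (h2 : (2 : K) ≠ 0)
    {d : ℕ} (hd : finrank K V = d) : ∃ v : Basis (Fin d) K V, B.IsOrthoᵢ v := by
  induction d generalizing V with
  | zero => exact ⟨basisOfFinrankZero hd, fun i ↦ i.elim0⟩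
  | succ d ih =>
    obtain rfl | hB₀ := eq_or_ne B 0
    · exact ⟨finBasisOfFinrankEq K V hd, fun i j _ ↦ rfl⟩
    obtain ⟨x, hx⟩ := hB.exists_self_ne_zero h2 hB₀
    have hker : finrank K (ker (B x)) = d := by
      have hr := (B x).finrank_range_add_finrank_ker
      rw [range_eq_top.2 (LinearMap.surjective fun h ↦ hx (by rw [h, zero_apply])), finrank_top,
        finrank_self] at hr
      omega
    obtain ⟨v, hv⟩ := ih (hB.domRestrict (ker (B x))) hker
    let b := Basis.mkFinCons x v
      (fun c y hy hc ↦ by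
        have hc' := congrArg (B x) hc
        rw [map_add, mem_ker.1 hy, map_smul, map_zero, add_zero, smul_eq_mul] at hc'
        exact (mul_eq_zero.1 hc').resolve_right hx)
      (fun y ↦ ⟨-(B x y / B x x), by simp [hx]⟩)
    refine ⟨b, ?_⟩
    rw [Basis.coe_mkFinCons]
    intro i j hij
    induction i using Fin.cases with
    | zero =>
      induction j using Fin.cases with
      | zero => exact (hij rfl).elim
      | succ j => exact (v j).2
    | succ i =>
      induction j using Fin.cases with
      | zero => exact hB.isRefl _ _ (v i).2
      | succ j => exact hv (ne_of_apply_ne _ hij)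

end LinearMap.IsSymm

namespace LinearMap.IsOrthoᵢ

variable {K V ι : Type*} [Field K] {σ : K →+* K} [AddCommGroup V] [Module K V] [Fintype ι]
  {B : V →ₛₗ[σ] V →ₗ[K] K} {v : ι → V}

theorem apply_sum_smul (hv : B.IsOrthoᵢ v) (c d : ι → K) :
    B (∑ i, c i • v i) (∑ i, d i • v i) = ∑ i, σ (c i) * d i * B (v i) (v i) := by
  simp only [map_sum, sum_apply, map_smulₛₗ, smul_apply, smul_eq_mul, RingHom.id_apply]
  refine Finset.sum_congr rfl fun i _ ↦ ?_
  rw [Finset.sum_eq_single i _ (by simp)]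
  · ring
  · intro j _ hji
    rw [(isOrthoᵢ_def.1 hv) _ _ hji]
    simp

theorem self_ne_zero_of_separatingLeft {v : Basis ι K V} (hv : B.IsOrthoᵢ v)
    (hB : B.SeparatingLeft) (i : ι) : B (v i) (v i) ≠ 0 := by
  classical
  intro h
  refine v.ne_zero i (hB _ fun y ↦ ?_)
  have := hv.apply_sum_smul (Pi.single i 1) (v.repr y)
  rw [v.sum_repr] at this
  simpa [Pi.single_apply, ite_smul, apply_ite σ, h] using this

end LinearMap.IsOrthoᵢ

namespace QuadraticForm

variable {k M ι : Type*} [Field k] [Invertible (2 : k)] [AddCommGroup M] [Module k M]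
  [Fintype ι] [DecidableEq ι]

theorem tmul_weightedSumSquares_piScalarRight_symm (Q : QuadraticForm k M) (a : ι → k)
    (x : ι → M) :
    Q.tmul (QuadraticMap.weightedSumSquares k a) ((piScalarRight k k M ι).symm x) =
      ∑ i, a i * Q (x i) := by
  rw [← Finset.univ_sum_single x, map_sum]
  simp only [piScalarRight_symm_single]
  have hpolar : ∀ i j, i ≠ j → QuadraticMap.polar (QuadraticMap.weightedSumSquares k a)
      (Pi.single i 1) (Pi.single j 1) = 0 := by
    intro i j hij
    simp only [QuadraticMap.polar, QuadraticMap.weightedSumSquares_apply, Pi.add_apply,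
      ← Finset.sum_sub_distrib]
    refine Finset.sum_eq_zero fun l _ ↦ ?_
    by_cases hi : l = i
    · subst hi; simp [hij]
    · simp [hi]
  rw [QuadraticMap.map_sum, Finset.sum_eq_zero (s := Finset.filter _ _), add_zero]
  · refine Finset.sum_congr rfl fun i _ ↦ ?_
    rw [tensorDistrib_tmul, smul_eq_mul, QuadraticMap.weightedSumSquares_apply]
    simp [Pi.single_apply]
  · intro ij hij
    induction ij with | _ i j
    have hne : i ≠ j := by simpa using hij
    rw [Sym2.map_mk, QuadraticMap.polarSym2_sym2Mk, ← QuadraticMap.polarBilin_apply_apply,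
      polarBilin_tmul]
    simp [hpolar i j hne]

end QuadraticForm

namespace Matrix

variable {K n : Type*} [Field K] [Fintype n]

/-- The sesquilinear form `x, y ↦ σ(x)ᵀ H y`. -/
def toSesqForm (σ : K →+* K) (H : Matrix n n K) : (n → K) →ₛₗ[σ] (n → K) →ₗ[K] K :=
  LinearMap.mk₂'ₛₗ σ (RingHom.id K) (fun x y ↦ (σ ∘ x) ⬝ᵥ (H *ᵥ y))
    (fun x x' y ↦ by simp [dotProduct, add_mul, Finset.sum_add_distrib])
    (fun c x y ↦ by simp [dotProduct, mul_assoc, Finset.mul_sum])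
    (fun x y y' ↦ by simp [mulVec_add])
    (fun c x y ↦ by simp [mulVec_smul])

theorem toSesqForm_apply (σ : K →+* K) (H : Matrix n n K) (x y : n → K) :
    H.toSesqForm σ x y = (σ ∘ x) ⬝ᵥ (H *ᵥ y) := rfl

theorem isSymm_toSesqForm {σ : K →+* K} (hσ : ∀ x, σ (σ x) = x) {H : Matrix n n K}
    (hH : (H.map σ)ᵀ = H) : (H.toSesqForm σ).IsSymm where
  eq x y := by
    have hx : σ ∘ σ ∘ x = x := funext fun i ↦ hσ _
    rw [toSesqForm_apply, toSesqForm_apply, RingHom.map_dotProduct, hx, dotProduct_comm]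
    have : σ ∘ (H *ᵥ y) = (H.map σ) *ᵥ (σ ∘ y) := funext fun i ↦ RingHom.map_mulVec σ H y i
    rw [this, dotProduct_comm, dotProduct_mulVec, ← mulVec_transpose, hH, dotProduct_comm]

theorem separatingLeft_toSesqForm [DecidableEq n] (σ : K →+* K) {H : Matrix n n K}
    (hH : IsUnit H) : (H.toSesqForm σ).SeparatingLeft := by
  intro x hx
  have hσx : σ ∘ x = 0 := dotProduct_eq_zero _ fun y ↦ by
    obtain ⟨z, rfl⟩ := (mulVec_surjective_iff_isUnit.2 hH) y
    exact hx z
  exact funext fun i ↦ (map_eq_zero σ).1 (congrFun hσx i)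

end Matrix

/-- Let `k` be a field of characteristic ≠ 2 (2 is invertible), `K/k` a
separable quadratic field extension with nontrivial `k`-automorphism `σ` (conjugation), `H` an
invertible hermitian `n × n` matrix over `K`, `q_H` its trace form (the `k`-quadratic form on
`Kⁿ` with `q_H x = x̄ᵀ H x ∈ k`), and `N` the norm form of `K/k` (the `k`-quadratic form on `K`
with `N x = x * x̄ ∈ k`).  Then there are `a₁, …, aₙ ∈ k*` such that `q_H` is isometric over `k`
to `N ⊗ ⟨a₁, …, aₙ⟩`. -/
theorem trace_form_of_hermitian_eq_norm_tensor_diagonal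
    (k K : Type) [Field k] [Field K] [Algebra k K] [Invertible (2 : k)]
    [Algebra.IsSeparable k K] (hK2 : Module.finrank k K = 2)
    (σ : K ≃ₐ[k] K) (hσ : σ ≠ AlgEquiv.refl)
    (n : ℕ) (H : Matrix (Fin n) (Fin n) K)
    (hHherm : (H.map σ)ᵀ = H) (hHunit : IsUnit H)
    (qH : QuadraticForm k (Fin n → K))
    (hqH : ∀ x : Fin n → K,
      algebraMap k K (qH x) = ∑ i, σ (x i) * H.mulVec x i)
    (N : QuadraticForm k K)
    (hN : ∀ x : K, algebraMap k K (N x) = x * σ x) :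
    ∃ a : Fin n → k, (∀ i, a i ≠ 0) ∧
      qH.Equivalent (N.tmul (QuadraticMap.weightedSumSquares k a)) := by
  have hσσ (x : K) : σ (σ x) = x := by
    obtain rfl | hx := eq_or_ne x 0
    · simp
    have h := congrArg σ (hN x)
    rw [AlgEquiv.commutes, hN, map_mul, mul_comm] at h
    exact (mul_left_cancel₀ (by simpa using hx) h).symm
  have h2 : (2 : K) ≠ 0 := by
    rw [← map_ofNat (algebraMap k K) 2]
    exact (map_ne_zero _).2 (Invertible.ne_zero 2)
  set B := H.toSesqForm (σ : K →+* K)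
  have hB : B.IsSymm := isSymm_toSesqForm hσσ hHherm
  have hqB (x : Fin n → K) : algebraMap k K (qH x) = B x x := hqH x
  obtain ⟨v, hv⟩ := hB.exists_isOrtho_basis h2 (finrank_fin_fun K)
  refine ⟨fun i ↦ qH (v i), fun i hi ↦ ?_, ⟨⟨(v.equivFun.restrictScalars k).trans
    (piScalarRight k k K (Fin n)).symm, fun x ↦ ?_⟩⟩⟩
  · refine hv.self_ne_zero_of_separatingLeft (separatingLeft_toSesqForm _ hHunit) i ?_
    rw [← hqB]
    exact (map_eq_zero _).2 hi
  · apply (algebraMap k K).injective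
    change algebraMap k K (N.tmul _ ((piScalarRight k k K (Fin n)).symm (v.equivFun x))) = _
    rw [QuadraticForm.tmul_weightedSumSquares_piScalarRight_symm, hqB]
    conv_rhs => rw [← v.sum_equivFun x, hv.apply_sum_smul]
    simp only [map_sum, map_mul, hN, hqB]
    refine Finset.sum_congr rfl fun i _ ↦ ?_
    rw [mul_comm, mul_comm (v.equivFun x i)]
    rfl
end

section
/- Let k be a field of characteristic different from 2, let φ = ⟨⟨a₁, …, a_r⟩⟩ be an r-fold Pfister form over k, let λ ∈ k*, and let q, q' be nondegenerate quadratic forms over k of the same odd dimension n. If φ ⊗ q is isometric to φ ⊗ (λ·q'), then φ ⊗ (d(q)·q) is isometric to φ ⊗ (d(q')·q'), where d(q) ∈ k* denotes (any representative of) the determinant of q. -/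
open QuadraticMap

namespace PfisterMultiples

variable {k : Type} [Field k]

section Basics

variable {V W : Type} [AddCommGroup V] [Module k V] [AddCommGroup W] [Module k W]

theorem equivalent_smul {Q : QuadraticForm k V} {P : QuadraticForm k W} (c : k)
    (h : Q.Equivalent P) : (c • Q).Equivalent (c • P) := by
  obtain ⟨e⟩ := h
  exact ⟨⟨e.toLinearEquiv, fun x => congrArg (c • ·) (e.map_app x)⟩⟩

theorem equivalent_mul_sq_smul (Q : QuadraticForm k V) (c : k) {s : k} (hs : s ≠ 0) :
    ((c * (s * s)) • Q).Equivalent (c • Q) :=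
  ⟨⟨LinearEquiv.smulOfNeZero k V s hs, fun x => by
    simp [QuadraticMap.map_smul, mul_assoc]⟩⟩

theorem smul_prod (c : k) (Q : QuadraticForm k V) (P : QuadraticForm k W) :
    c • Q.prod P = (c • Q).prod (c • P) := by
  ext x
  simp [mul_add]

/-- The form `φ ⊗ ⟨a₁, …, aₙ⟩`, realised as the orthogonal sum of the scaled forms `aᵢ φ`. -/
def diagMul (φ : QuadraticForm k V) {n : ℕ} (a : Fin n → k) : QuadraticForm k (Fin n → V) :=
  QuadraticMap.pi fun i => a i • φ

@[simp]
theorem diagMul_apply (φ : QuadraticForm k V) {n : ℕ} (a : Fin n → k) (x : Fin n → V) :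
    diagMul φ a x = ∑ i, a i * φ (x i) := by
  simp [diagMul]

theorem diagMul_sq {n : ℕ} (a : Fin n → k) :
    diagMul (sq (R := k)) a = weightedSumSquares k a := by
  ext x
  simp

theorem diagMul_cons (φ : QuadraticForm k V) {n : ℕ} (a : k) (b : Fin n → k) :
    ((a • φ).prod (diagMul φ b)).Equivalent (diagMul φ (Fin.cons a b : Fin (n + 1) → k)) :=
  ⟨⟨Fin.consLinearEquiv k (fun _ : Fin (n + 1) => V), fun x => by
    simp [Fin.sum_univ_succ]⟩⟩

theorem smul_diagMul (φ : QuadraticForm k V) {n : ℕ} (a : Fin n → k) (c : k) :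
    c • diagMul φ a = diagMul φ (fun i => c * a i) := by
  ext x
  simp [Finset.mul_sum, mul_assoc]

theorem tmul_weightedSumSquares [Invertible (2 : k)] (φ : QuadraticForm k V) {n : ℕ}
    (a : Fin n → k) :
    (QuadraticForm.tmul φ (weightedSumSquares k a)).Equivalent (diagMul φ a) := by
  refine ⟨⟨TensorProduct.piScalarRight k k V (Fin n), fun x => ?_⟩⟩
  have : (diagMul φ a).comp (TensorProduct.piScalarRight k k V (Fin n)).toLinearMap =
      QuadraticForm.tmul φ (weightedSumSquares k a) := by
    refine (QuadraticMap.associated_rightInverse k).injective ?_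
    ext m i m' j
    simp only [QuadraticForm.associated_tmul, QuadraticMap.associated_comp]
    rw [← diagMul_sq]
    rcases eq_or_ne i j with rfl | hij
    · simp only [diagMul]
      simp [Pi.single_apply, associated_apply]
      rw [Finset.sum_eq_single i (by simp +contextual) (by simp)]
      simp
    · simp only [diagMul]
      simp [Pi.single_apply, associated_apply, hij.symm]
      refine Finset.sum_eq_zero fun c _ => ?_
      rcases eq_or_ne c i with rfl | hc
      · simp [hij]
      · simp [hc]
  exact DFunLike.congr_fun this x

theorem equivalent_tmul [Invertible (2 : k)] {V' W' : Type} [AddCommGroup V'] [Module k V']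
    [AddCommGroup W'] [Module k W'] {φ : QuadraticForm k V} {φ' : QuadraticForm k V'}
    {q : QuadraticForm k W} {q' : QuadraticForm k W'} (h : φ.Equivalent φ')
    (h' : q.Equivalent q') :
    (QuadraticForm.tmul φ q).Equivalent (QuadraticForm.tmul φ' q') := by
  obtain ⟨e⟩ := h
  obtain ⟨f⟩ := h'
  exact ⟨⟨TensorProduct.congr e.toLinearEquiv f.toLinearEquiv,
    fun x => QuadraticForm.tmul_tensorMap_apply e.toIsometry f.toIsometry x⟩⟩

theorem diagMul_congr_of_weightedSumSquares [Invertible (2 : k)] (φ : QuadraticForm k V)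
    {n m : ℕ} {a : Fin n → k} {b : Fin m → k}
    (h : (weightedSumSquares k a).Equivalent (weightedSumSquares k b)) :
    (diagMul φ a).Equivalent (diagMul φ b) :=
  (tmul_weightedSumSquares φ a).symm.trans
    ((equivalent_tmul (.refl φ) h).trans (tmul_weightedSumSquares φ b))

theorem diagMul_congr (φ : QuadraticForm k V) {n : ℕ} {a b : Fin n → k}
    (h : ∀ i, (a i • φ).Equivalent (b i • φ)) : (diagMul φ a).Equivalent (diagMul φ b) :=
  Equivalent.pi h

theorem prod_congr_right {W' : Type} [AddCommGroup W'] [Module k W'] (φ : QuadraticForm k V)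
    {Q : QuadraticForm k W} {P : QuadraticForm k W'} (h : Q.Equivalent P) :
    (φ.prod Q).Equivalent (φ.prod P) :=
  Equivalent.prod (.refl φ) h

end Basics

section Cancellation

/-- The form `Q` can be cancelled from orthogonal sums. -/
def Cancellable {V : Type} [AddCommGroup V] [Module k V] (Q : QuadraticForm k V) : Prop :=
  ∀ (W W' : Type) [AddCommGroup W] [Module k W] [AddCommGroup W'] [Module k W']
    (P : QuadraticForm k W) (P' : QuadraticForm k W'),
    (Q.prod P).Equivalent (Q.prod P') → P.Equivalent P'

variable {V W : Type} [AddCommGroup V] [Module k V] [AddCommGroup W] [Module k W]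

theorem Cancellable.congr {Q : QuadraticForm k V} {P : QuadraticForm k W} (hQ : Cancellable Q)
    (h : Q.Equivalent P) : Cancellable P := by
  intro W W' _ _ _ _ R R' hR
  exact hQ _ _ R R' ((Equivalent.prod h (.refl R)).trans
    (hR.trans (Equivalent.prod h.symm (.refl R'))))

theorem prod_assoc_equivalent {U : Type} [AddCommGroup U] [Module k U] (Q : QuadraticForm k V)
    (P : QuadraticForm k W) (R : QuadraticForm k U) :
    ((Q.prod P).prod R).Equivalent (Q.prod (P.prod R)) :=
  ⟨⟨LinearEquiv.prodAssoc k V W U, fun x => by simp [add_assoc]⟩⟩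

theorem Cancellable.prod {Q : QuadraticForm k V} {P : QuadraticForm k W} (hQ : Cancellable Q)
    (hP : Cancellable P) : Cancellable (Q.prod P) := by
  intro W W' _ _ _ _ R R' hR
  exact hP _ _ R R' (hQ _ _ _ _ ((prod_assoc_equivalent Q P R).symm.trans
    (hR.trans (prod_assoc_equivalent Q P R'))))

theorem reflection_isometry (Q : QuadraticForm k V) {w : V} (hw : Q w ≠ 0) :
    ∃ σ : Q.IsometryEquiv Q, ∀ y, σ y = y - (polar Q w y / Q w) • w := by
  let f : Module.Dual k V := (Q w)⁻¹ • Q.polarBilin w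
  have hf : f w = 2 := by simp [f]; field_simp
  refine ⟨⟨Module.reflection hf, fun y => ?_⟩, fun y => ?_⟩
  · change Q (Module.reflection hf y) = Q y
    rw [Module.reflection_apply, sub_eq_add_neg, ← neg_smul, QuadraticMap.map_add Q,
      QuadraticMap.map_smul, polar_smul_right]
    simp only [f, LinearMap.smul_apply, polarBilin_apply_apply, smul_eq_mul, polar_comm Q y w]
    field_simp
    ring
  · change Module.reflection hf y = _
    rw [Module.reflection_apply]
    simp [f, div_eq_inv_mul]

/-- Two vectors of the same nonzero length are conjugate under the orthogonal group. -/
theorem exists_isometry_map_eq (h2 : (2 : k) ≠ 0) (Q : QuadraticForm k V) {u v : V}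
    (huv : Q u = Q v) (hv : Q v ≠ 0) : ∃ σ : Q.IsometryEquiv Q, σ u = v := by
  have hsub : Q (u - v) = 2 * Q v - polar Q u v := by
    rw [sub_eq_add_neg, QuadraticMap.map_add Q, QuadraticMap.map_neg, polar_neg_right, huv]
    ring
  have hadd : Q (u + v) = 2 * Q v + polar Q u v := by
    rw [QuadraticMap.map_add Q, huv]
    ring
  by_cases h : Q (u - v) = 0
  · have h' : Q (u + v) ≠ 0 := by
      have : Q (u + v) = 2 * 2 * Q v := by linear_combination hadd + hsub - h
      rw [this]
      simp [h2, hv]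
    obtain ⟨σ, hσ⟩ := reflection_isometry Q h'
    refine ⟨σ.trans ⟨LinearEquiv.neg k, fun y => by simp⟩, ?_⟩
    change -(σ u) = v
    have : polar Q (u + v) u / Q (u + v) = 1 := by
      rw [div_eq_one_iff_eq h', polar_add_left, polar_self, hadd, polar_comm Q v u, huv]
      simp
    rw [hσ, this]
    simp
  · obtain ⟨σ, hσ⟩ := reflection_isometry Q h
    refine ⟨σ, ?_⟩
    have : polar Q (u - v) u / Q (u - v) = 1 := by
      rw [div_eq_one_iff_eq h, polar_sub_left, polar_self, hsub, polar_comm Q v u, huv]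
      simp
    rw [hσ, this]
    simp

theorem fst_eq_zero_of_map_eq (h2 : (2 : k) ≠ 0) {a : k} (ha : a ≠ 0) {P : QuadraticForm k V}
    {P' : QuadraticForm k W}
    (g : ((a • sq (R := k)).prod P).IsometryEquiv ((a • sq (R := k)).prod P'))
    (hg : g (1, 0) = (1, 0)) (y : V) : (g (0, y)).1 = 0 := by
  have h1 := g.map_app ((1, 0) + (0, y))
  have h2' := g.map_app (0, y)
  rw [map_add, hg] at h1
  rcases hs : g (0, y) with ⟨s, z⟩
  rw [hs] at h1 h2'
  simp at h1 h2'
  have : 2 * a * s = 0 := by linear_combination h1 - h2'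
  simpa [h2, ha] using this

/-- Witt cancellation for one-dimensional forms. -/
theorem cancellable_smul_sq (h2 : (2 : k) ≠ 0) {a : k} (ha : a ≠ 0) :
    Cancellable (a • sq (R := k)) := by
  rintro W W' _ _ _ _ P P' ⟨e⟩
  obtain ⟨σ, hσ⟩ := exists_isometry_map_eq h2 ((a • sq (R := k)).prod P')
    (u := e (1, 0)) (v := (1, 0)) (by rw [e.map_app]; simp) (by simpa using ha)
  let g := e.trans σ
  have hg : g (1, 0) = (1, 0) := hσ
  have hg' : g.symm (1, 0) = (1, 0) := (g.symm_apply_eq).2 hg.symm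
  have key := fst_eq_zero_of_map_eq h2 ha g hg
  have key' := fst_eq_zero_of_map_eq h2 ha g.symm hg'
  have hy (y : W) : g (0, y) = (0, (g (0, y)).2) := Prod.ext (key y) rfl
  have hy' (y : W') : g.symm (0, y) = (0, (g.symm (0, y)).2) := Prod.ext (key' y) rfl
  refine ⟨⟨LinearEquiv.ofLinearMap
    (LinearMap.snd k k W' ∘ₗ g.toLinearEquiv.toLinearMap ∘ₗ LinearMap.inr k k W)
    (LinearMap.snd k k W ∘ₗ g.symm.toLinearEquiv.toLinearMap ∘ₗ LinearMap.inr k k W')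
    ?_ ?_, ?_⟩⟩
  · ext y
    change (g (0, (g.symm (0, y)).2)).2 = y
    rw [← hy', g.apply_symm_apply]
  · ext y
    change (g.symm (0, (g (0, y)).2)).2 = y
    rw [← hy, g.symm_apply_apply]
  · intro y
    change P' (g (0, y)).2 = P y
    have := g.map_app (0, y)
    rw [hy] at this
    simpa using this

end Cancellation

section Diagonalization

variable {n : ℕ}

theorem discr'_weightedSumSquares [Invertible (2 : k)] (a : Fin n → k) :
    QuadraticForm.discr' (weightedSumSquares k a) = ∏ i, a i := by
  have : QuadraticForm.toMatrix' (weightedSumSquares k a) = Matrix.diagonal a := by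
    rw [← diagMul_sq]
    ext i j
    rcases eq_or_ne i j with rfl | hij
    · simp [QuadraticForm.toMatrix', LinearMap.toMatrix₂'_apply, diagMul, Pi.single_apply]
    · simp [QuadraticForm.toMatrix', LinearMap.toMatrix₂'_apply, diagMul, Pi.single_apply, hij,
        hij.symm]
  rw [QuadraticForm.discr', this, Matrix.det_diagonal]

theorem exists_prod_eq_mul_sq [Invertible (2 : k)] {a b : Fin n → k}
    (h : (weightedSumSquares k a).Equivalent (weightedSumSquares k b)) (ha : ∏ i, a i ≠ 0) :
    ∃ s ≠ 0, ∏ i, a i = (∏ i, b i) * (s * s) := by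
  obtain ⟨e⟩ := h
  have : (weightedSumSquares k b).comp e.toLinearEquiv.toLinearMap = weightedSumSquares k a := by
    ext x
    exact e.map_app x
  have h' := QuadraticForm.discr'_comp (Q := weightedSumSquares k b) e.toLinearEquiv.toLinearMap
  rw [this, discr'_weightedSumSquares, discr'_weightedSumSquares] at h'
  refine ⟨_, ?_, h'.trans (mul_comm _ _)⟩
  intro h0
  rw [h0] at h'
  simp [ha] at h'

theorem exists_equivalent_cons [Invertible (2 : k)] (a : Fin (n + 1) → k) (v : Fin (n + 1) → k)
    (hv : weightedSumSquares k a v ≠ 0) :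
    ∃ c : Fin n → k, (weightedSumSquares k a).Equivalent
      (weightedSumSquares k (Fin.cons (weightedSumSquares k a v) c : Fin (n + 1) → k)) := by
  set Q : QuadraticForm k (Fin (n + 1) → k) := weightedSumSquares k a
  let B : LinearMap.BilinForm k (Fin (n + 1) → k) := Q.polarBilin
  have hB : B v v ≠ 0 := by
    simpa [B, hv] using (isUnit_of_invertible (2 : k)).ne_zero
  have hv0 : v ≠ 0 := fun h => hv (by rw [h, QuadraticMap.map_zero])
  let U := B.orthogonal (k ∙ v)
  have hc : IsCompl (k ∙ v) U := LinearMap.BilinForm.isCompl_span_singleton_orthogonal hB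
  have hfin : Module.finrank k U = n := by
    have := Submodule.finrank_add_eq_of_isCompl hc
    rw [finrank_span_singleton hv0, Module.finrank_fin_fun] at this
    omega
  obtain ⟨c, hcU⟩ : ∃ c : Fin n → k, (Q.comp U.subtype).Equivalent (weightedSumSquares k c) := by
    have := QuadraticForm.equivalent_weightedSumSquares (Q.comp U.subtype)
    rwa [hfin] at this
  have hsplit : ((Q v • sq (R := k)).prod (Q.comp U.subtype)).Equivalent Q := by
    refine ⟨⟨((LinearEquiv.toSpanNonzeroSingleton k _ v hv0).prodCongr (.refl k U)).trans
      (Submodule.prodEquivOfIsCompl _ _ hc), ?_⟩⟩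
    rintro ⟨x, u⟩
    change Q (x • v + u) = _
    have hu : polar Q v u = 0 :=
      LinearMap.BilinForm.mem_orthogonal_iff.1 u.2 v (Submodule.mem_span_singleton_self v)
    rw [QuadraticMap.map_add Q, polar_smul_left, hu, QuadraticMap.map_smul]
    simp [mul_comm]
  refine ⟨c, hsplit.symm.trans ((prod_congr_right _ hcU).trans ?_)⟩
  have := diagMul_cons (sq (R := k)) (Q v) c
  rwa [diagMul_sq, diagMul_sq] at this

end Diagonalization

section Pfister

variable {V W : Type} [AddCommGroup V] [Module k V] [AddCommGroup W] [Module k W]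

/-- The properties of Pfister forms that matter here: every represented nonzero value is a
similarity factor, `1` is represented, and all scalings satisfy Witt cancellation. -/
structure IsRound (φ : QuadraticForm k V) : Prop where
  smul_equivalent : ∀ v, φ v ≠ 0 → (φ v • φ).Equivalent φ
  exists_eq_one : ∃ v, φ v = 1
  cancellable : ∀ c : k, c ≠ 0 → Cancellable (c • φ)

theorem IsRound.congr {φ : QuadraticForm k V} {ψ : QuadraticForm k W} (hφ : IsRound φ)
    (h : φ.Equivalent ψ) : IsRound ψ := by
  refine ⟨fun w hw => ?_, ?_, fun c hc => (hφ.cancellable c hc).congr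
    (equivalent_smul c h)⟩
  · obtain ⟨e⟩ := id h
    have he : φ (e.symm w) = ψ w := e.symm.map_app w
    have := hφ.smul_equivalent (e.symm w) (he ▸ hw)
    rw [he] at this
    exact (equivalent_smul _ h.symm).trans (this.trans h)
  · obtain ⟨e⟩ := h
    obtain ⟨v, hv⟩ := hφ.exists_eq_one
    exact ⟨e v, (e.map_app v).trans hv⟩

/-- The similarity factors of `φ`. -/
def similarityFactors (φ : QuadraticForm k V) : Submonoid k where
  carrier := {x | ∀ d : k, ((d * x) • φ).Equivalent (d • φ)}
  one_mem' d := by rw [mul_one]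
  mul_mem' {x y} hx hy d := by
    rw [← mul_assoc]
    exact (hy (d * x)).trans (hx d)

theorem mul_self_mem_similarityFactors (φ : QuadraticForm k V) {s : k} (hs : s ≠ 0) :
    s * s ∈ similarityFactors φ :=
  fun d => equivalent_mul_sq_smul φ d hs

theorem IsRound.mem_similarityFactors {φ : QuadraticForm k V} (hφ : IsRound φ) {v : V}
    (hv : φ v ≠ 0) : φ v ∈ similarityFactors φ := fun d => by
  rw [mul_smul]
  exact equivalent_smul d (hφ.smul_equivalent v hv)

theorem isRound_sq (h2 : (2 : k) ≠ 0) : IsRound (sq (R := k)) := by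
  refine ⟨fun v hv => ?_, ⟨1, by simp⟩, fun c hc => cancellable_smul_sq h2 hc⟩
  have hv_ne : v ≠ 0 := by
    rintro rfl
    simp at hv
  simpa using equivalent_mul_sq_smul (sq (R := k)) 1 hv_ne

/-- The relation `⟨x, z⟩ ≅ ⟨x + z, (x + z) x z⟩`, tensored with `φ`. -/
theorem prod_smul_equivalent_add (φ : QuadraticForm k V) {x z : k} (h : x + z ≠ 0) :
    (((x + z) • φ).prod (((x + z) * (x * z)) • φ)).Equivalent ((x • φ).prod (z • φ)) := by
  refine ⟨⟨LinearEquiv.ofLinearMap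
    ((LinearMap.fst k V V + z • LinearMap.snd k V V).prod
      (LinearMap.fst k V V - x • LinearMap.snd k V V))
    (((x + z)⁻¹ • (x • LinearMap.fst k V V + z • LinearMap.snd k V V)).prod
      ((x + z)⁻¹ • (LinearMap.fst k V V - LinearMap.snd k V V))) ?_ ?_, ?_⟩⟩
  · apply LinearMap.ext
    rintro ⟨s, t⟩
    ext
    · simp
      match_scalars <;> field_simp
      ring
    · simp
      match_scalars <;> (field_simp; ring)
  · apply LinearMap.ext
    rintro ⟨s, t⟩
    ext
    · simp
      match_scalars <;> field_simp
      ring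
    · simp
      match_scalars
      field_simp
      ring
  · rintro ⟨s, t⟩
    change (x • φ).prod (z • φ) (s + z • t, s - x • t) = _
    simp only [prod_apply, smul_apply, sub_eq_add_neg, ← neg_smul,
      QuadraticMap.map_add φ, QuadraticMap.map_smul, polar_smul_right, smul_eq_mul]
    ring

theorem IsRound.prod_smul {φ : QuadraticForm k V} (hφ : IsRound φ) {b : k} (hb : b ≠ 0) :
    IsRound (φ.prod (b • φ)) := by
  refine ⟨?_, ?_, fun c hc => ?_⟩
  · rintro ⟨u, w⟩ hc
    have hval : φ.prod (b • φ) (u, w) = φ u + b * φ w := by simp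
    rw [hval] at hc ⊢
    rw [smul_prod, smul_smul]
    have hone : (1 : k) • φ = φ := one_smul k φ
    by_cases hw : φ w = 0
    · rw [hw, mul_zero, add_zero] at hc ⊢
      refine Equivalent.prod (hφ.smul_equivalent u hc) ?_
      rw [mul_comm]
      exact hφ.mem_similarityFactors hc b
    have hw' := hφ.mem_similarityFactors hw
    by_cases hu : φ u = 0
    · rw [hu, zero_add]
      refine Equivalent.trans (Equivalent.prod (hw' b) ?_) ⟨IsometryEquiv.prodComm _ _⟩
      have := mul_mem hw' (mul_self_mem_similarityFactors φ hb) 1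
      rw [hone] at this
      convert this using 2
      ring
    have hu' := hφ.mem_similarityFactors hu
    refine Equivalent.trans ?_ ((prod_smul_equivalent_add φ hc).trans
      (Equivalent.prod (hφ.smul_equivalent u hu) (hw' b)))
    refine prod_congr_right _ (Equivalent.symm ?_)
    convert mul_mem hu' hw' ((φ u + b * φ w) * b) using 2
    ring
  · obtain ⟨v, hv⟩ := hφ.exists_eq_one
    exact ⟨(v, 0), by simp [hv]⟩
  · rw [smul_prod, smul_smul]
    exact (hφ.cancellable c hc).prod (hφ.cancellable _ (mul_ne_zero hc hb))

/-- Splitting the subsets of `{0, …, r}` according to whether they contain `0`. -/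
theorem bijective_finset_sum_fin (r : ℕ) :
    Function.Bijective (Sum.elim (fun S : Finset (Fin r) => S.map (Fin.succEmb r))
      (fun S : Finset (Fin r) => Finset.cons 0 (S.map (Fin.succEmb r)) (by simp))) := by
  rw [Fintype.bijective_iff_injective_and_card]
  constructor
  · refine Function.Injective.sumElim (Finset.map_injective _) (fun S T h => ?_) (fun S T h => ?_)
    · have h0 : (0 : Fin (r + 1)) ∉ S.map (Fin.succEmb r) := by simp
      have h0' : (0 : Fin (r + 1)) ∉ T.map (Fin.succEmb r) := by simp
      apply Finset.map_injective (Fin.succEmb r)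
      simp only [Finset.cons_eq_insert] at h
      rw [← Finset.erase_insert h0, h, Finset.erase_insert h0']
    · have h0 : (0 : Fin (r + 1)) ∉ S.map (Fin.succEmb r) := by simp
      rw [h] at h0
      simp at h0
  · simp [pow_succ, mul_two]

theorem isRound_pfister (h2 : (2 : k) ≠ 0) : ∀ (r : ℕ) (a : Fin r → k), (∀ i, a i ≠ 0) →
    IsRound (weightedSumSquares k (fun S : Finset (Fin r) => ∏ i ∈ S, a i))
  | 0, a, _ => by
    refine (isRound_sq h2).congr ⟨⟨(LinearEquiv.funUnique (Finset (Fin 0)) k k).symm, fun x => ?_⟩⟩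
    simp [Subsingleton.elim default (∅ : Finset (Fin 0))]
  | r + 1, a, ha => by
    refine ((isRound_pfister h2 r (fun i => a i.succ) fun i => ha _).prod_smul (ha 0)).congr
      (Equivalent.symm ⟨⟨(LinearEquiv.funCongrLeft k k
        (Equiv.ofBijective _ (bijective_finset_sum_fin r))).trans
          (LinearEquiv.sumArrowLequivProdArrow _ _ k k), fun x => ?_⟩⟩)
    simp only [weightedSumSquares_apply]
    rw [← (bijective_finset_sum_fin r).sum_comp, Fintype.sum_sum_type]
    simp [LinearEquiv.funCongrLeft, Finset.mul_sum, mul_assoc]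

/-- Isometric multiples `φ ⊗ ⟨a₁, …, aₙ⟩ ≅ φ ⊗ ⟨b₁, …, bₙ⟩` have determinants that agree up to a
similarity factor of `φ`. -/
theorem IsRound.prod_smul_equivalent [Invertible (2 : k)] {φ : QuadraticForm k V}
    (hφ : IsRound φ) : ∀ (n : ℕ) (a b : Fin n → k), (∀ i, a i ≠ 0) → (∀ i, b i ≠ 0) →
      (diagMul φ a).Equivalent (diagMul φ b) →
      ((∏ i, a i) • φ).Equivalent ((∏ i, b i) • φ)
  | 0, a, b, _, _, _ => by
    simp only [Finset.univ_eq_empty, Finset.prod_empty]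
    exact .refl _
  | n + 1, a, b, ha, hb, h => by
    classical
    obtain ⟨v₀, hv₀⟩ := hφ.exists_eq_one
    obtain ⟨e⟩ := id h.symm
    set u := e (Pi.single 0 v₀)
    have hu : ∑ i, a i * φ (u i) = b 0 := by
      have := e.map_app (Pi.single 0 v₀)
      simp only [diagMul_apply] at this
      rw [this, Finset.sum_eq_single 0 (fun i _ hi => by simp [hi]) (by simp)]
      simp [hv₀]
    let x : Fin (n + 1) → k := fun i => if φ (u i) = 0 then 1 else φ (u i)
    let ε : Fin (n + 1) → k := fun i => if φ (u i) = 0 then 0 else 1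
    have hx0 (i) : x i ≠ 0 := by
      by_cases hi : φ (u i) = 0 <;> simp [x, hi]
    have hx (i) : x i ∈ similarityFactors φ := by
      by_cases hi : φ (u i) = 0
      · simp [x, hi, one_mem]
      · simpa [x, hi] using hφ.mem_similarityFactors hi
    have hε : weightedSumSquares k (fun i => a i * x i) ε = b 0 := by
      rw [← hu, weightedSumSquares_apply]
      refine Finset.sum_congr rfl fun i _ => ?_
      by_cases hi : φ (u i) = 0 <;> simp [x, ε, hi]
    obtain ⟨c, hc⟩ := exists_equivalent_cons (fun i => a i * x i) ε (hε ▸ hb 0)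
    rw [hε] at hc
    have hne : ∏ i, a i * x i ≠ 0 :=
      Finset.prod_ne_zero_iff.2 fun i _ => mul_ne_zero (ha i) (hx0 i)
    obtain ⟨s, hs, hdet⟩ := exists_prod_eq_mul_sq hc hne
    rw [Fin.prod_cons] at hdet
    have hc0 : ∀ i, c i ≠ 0 := by
      intro i hi
      rw [Finset.prod_eq_zero (Finset.mem_univ i) hi] at hdet
      simp [hdet] at hne
    have hb' : b = Fin.cons (b 0) (Fin.tail b) := (Fin.cons_self_tail b).symm
    have htail : (diagMul φ c).Equivalent (diagMul φ (Fin.tail b)) := by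
      refine hφ.cancellable (b 0) (hb 0) _ _ _ _ ?_
      refine (diagMul_cons φ (b 0) c).trans ((diagMul_congr_of_weightedSumSquares φ hc).symm.trans
        ((diagMul_congr φ fun i => hx i (a i)).trans (h.trans ?_)))
      have := (diagMul_cons φ (b 0) (Fin.tail b)).symm
      rwa [← hb'] at this
    have ih := hφ.prod_smul_equivalent n c (Fin.tail b) hc0 (fun i => hb i.succ) htail
    have h₁ : ((∏ i, a i * x i) • φ).Equivalent ((∏ i, a i) • φ) := by
      rw [Finset.prod_mul_distrib]
      exact Submonoid.prod_mem (similarityFactors φ) (fun i _ => hx i) _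
    refine h₁.symm.trans ?_
    rw [hdet, Fin.prod_univ_succ b]
    refine (mul_self_mem_similarityFactors φ hs _).trans ?_
    rw [mul_smul, mul_smul]
    exact equivalent_smul _ ih

/-- If `φ ⊗ ⟨a₁, …, aₙ⟩` is similar to `φ ⊗ ⟨b₁, …, bₙ⟩` with `n` odd, then the two multiples become
isometric after scaling each by its determinant. -/
theorem IsRound.diagMul_prod_mul_equivalent [Invertible (2 : k)] {φ : QuadraticForm k V}
    (hφ : IsRound φ) {n : ℕ} (hn : Odd n) {a b : Fin n → k} (ha : ∀ i, a i ≠ 0)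
    (hb : ∀ i, b i ≠ 0) {c : k} (hc : c ≠ 0)
    (h : (diagMul φ a).Equivalent (c • diagMul φ b)) :
    ((∏ i, a i) • diagMul φ a).Equivalent ((∏ i, b i) • diagMul φ b) := by
  obtain ⟨m, hm⟩ := hn
  have hsim : ((∏ i, a i) • φ).Equivalent (((∏ i, b i) * c) • φ) := by
    have h' := h
    rw [smul_diagMul] at h'
    have := hφ.prod_smul_equivalent n _ _ ha (fun i => mul_ne_zero hc (hb i)) h'
    refine this.trans ?_
    convert mul_self_mem_similarityFactors φ (pow_ne_zero m hc) ((∏ i, b i) * c) using 2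
    rw [Finset.prod_mul_distrib, Finset.prod_const, Finset.card_univ, Fintype.card_fin, (by rw [hm] : c ^ n = c ^ (2 * m + 1))]
    ring
  refine (equivalent_smul _ h).trans ?_
  simp only [smul_diagMul]
  refine diagMul_congr φ fun i => ?_
  have h₁ := equivalent_smul (c * b i) hsim
  rw [smul_smul, smul_smul] at h₁
  rw [mul_comm]
  refine h₁.trans ?_
  convert mul_self_mem_similarityFactors φ hc ((∏ i, b i) * b i) using 2
  ring

end Pfister

end PfisterMultiples

/-- Let `k` be a field of characteristic ≠ 2, `φ` an `r`-fold Pfister form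
`⟨⟨a₁,…,a_r⟩⟩` over `k` (diagonalized by the products `∏_{i ∈ S} (-aᵢ)` over subsets `S` of
`{1,…,r}`), `λ ∈ k*`, and `q, q'` nondegenerate quadratic forms of the same odd dimension `n`
(with diagonalizations `⟨b₁,…,bₙ⟩` and `⟨b'₁,…,b'ₙ⟩`, so that `d(q) = ∏ bᵢ`, `d(q') = ∏ b'ᵢ`
represent the determinants).  If `φ ⊗ q ≅ φ ⊗ (λ·q')` then `φ ⊗ (d(q)·q) ≅ φ ⊗ (d(q')·q')`. -/
theorem pfister_tensor_similar_implies_tensor_det_scaled_isometric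
    (k : Type) [Field k] [Invertible (2 : k)]
    (r n : ℕ) (hn : Odd n)
    (a : Fin r → k) (ha : ∀ i, a i ≠ 0)
    (V : Type) [AddCommGroup V] [Module k V]
    (φ : QuadraticForm k V)
    (hφ : φ.Equivalent
      (weightedSumSquares k (fun S : Finset (Fin r) => ∏ i ∈ S, (-a i))))
    (W W' : Type) [AddCommGroup W] [Module k W] [AddCommGroup W'] [Module k W']
    (q : QuadraticForm k W) (q' : QuadraticForm k W')
    (b b' : Fin n → k) (hb : ∀ i, b i ≠ 0) (hb' : ∀ i, b' i ≠ 0)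
    (hq : q.Equivalent (weightedSumSquares k b))
    (hq' : q'.Equivalent (weightedSumSquares k b'))
    (lam : k) (hlam : lam ≠ 0)
    (h : (φ.tmul q).Equivalent (φ.tmul (lam • q'))) :
    (φ.tmul ((∏ i, b i) • q)).Equivalent (φ.tmul ((∏ i, b' i) • q')) := by
  have h2 : (2 : k) ≠ 0 := (isUnit_of_invertible (2 : k)).ne_zero
  have hround : PfisterMultiples.IsRound φ :=
    (PfisterMultiples.isRound_pfister h2 r (fun i => -a i) fun i => neg_ne_zero.2 (ha i)).congr
      hφ.symm
  have key {U : Type} [AddCommGroup U] [Module k U] {p : QuadraticForm k U} {d : Fin n → k}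
      (hp : p.Equivalent (weightedSumSquares k d)) (c : k) :
      (φ.tmul (c • p)).Equivalent (c • PfisterMultiples.diagMul φ d) := by
    refine (PfisterMultiples.equivalent_tmul (.refl φ)
      (PfisterMultiples.equivalent_smul c hp)).trans ?_
    rw [← PfisterMultiples.diagMul_sq, PfisterMultiples.smul_diagMul,
      PfisterMultiples.smul_diagMul, PfisterMultiples.diagMul_sq]
    exact PfisterMultiples.tmul_weightedSumSquares φ _
  have hdiag := key hq 1
  rw [one_smul, one_smul] at hdiag
  exact (key hq _).trans ((hround.diagMul_prod_mul_equivalent hn hb hb' hlam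
    (hdiag.symm.trans (h.trans (key hq' lam)))).trans (key hq' _).symm)
end
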